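/- arXiv:1808.04159 — 4 statements merged into one kernel-verified Lean document; each statement's English description precedes it below -/
import Mathlib

section
/- For m ∈ ℕ and s ∈ (m, m+1], the Zygmund space 𝒞^s(Ω) on a bounded connected open set Ω ⊂ ℝ^n is an algebra: there is a constant C depending only on m and n such that ‖fg‖_{𝒞^s(Ω)} ≤ C ‖f‖_{𝒞^s(Ω)} ‖g‖_{𝒞^s(Ω)} for all f, g ∈ 𝒞^s(Ω). -/
open Set Metric ENNReal

noncomputable section

variable {E F : Type*} [NormedAddCommGroup E] [NormedSpace ℝ E]
  [NormedAddCommGroup F] [NormedSpace ℝ F]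

/-- The Hölder norm `‖f‖_{C^{0,s}(Ω)} = sup_Ω ‖f‖ + sup_{x≠y} ‖x-y‖^{-s}‖f x - f y‖`,
valued in `ℝ≥0∞`. -/
noncomputable def holderNorm (s : ℝ) (Ω : Set E) (f : E → F) : ℝ≥0∞ :=
  (⨆ x ∈ Ω, ENNReal.ofReal ‖f x‖) +
    ⨆ (x ∈ Ω) (y ∈ Ω) (_ : x ≠ y), ENNReal.ofReal (‖f x - f y‖ / ‖x - y‖ ^ s)

/-- The second-difference (Zygmund) seminorm
`sup_{h ≠ 0, x, x+h, x+2h ∈ Ω} |h|^{-s} ‖f(x+2h) - 2 f(x+h) + f x‖`. -/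
noncomputable def secondDiff (s : ℝ) (Ω : Set E) (f : E → F) : ℝ≥0∞ :=
  ⨆ (x : E) (h : E) (_ : h ≠ 0) (_ : x ∈ Ω) (_ : x + h ∈ Ω) (_ : x + 2 • h ∈ Ω),
    ENNReal.ofReal (‖f (x + 2 • h) - 2 • f (x + h) + f x‖ / ‖h‖ ^ s)

/-- The Zygmund norm of order `s ∈ (0,1]`:
`‖f‖_{𝒞^s(Ω)} = ‖f‖_{C^{0,s/2}(Ω)} + second difference seminorm`. -/
noncomputable def zygBase (s : ℝ) (Ω : Set E) (f : E → F) : ℝ≥0∞ :=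
  holderNorm (s / 2) Ω f + secondDiff s Ω f

/-- The Hölder norm `‖f‖_{C^{m,s}(Ω)} = Σ_{|α| ≤ m} ‖∂^α f‖_{C^{0,s}(Ω)}`, where
derivatives of order `i` are packaged as the full `i`-th derivative. -/
noncomputable def holderCm (m : ℕ) (s : ℝ) (Ω : Set E) (f : E → F) : ℝ≥0∞ :=
  ∑ i ∈ Finset.range (m + 1), holderNorm s Ω (iteratedFDerivWithin ℝ i f Ω)

/-- The Zygmund norm of order `s > 0`: writing `s = m + σ` with `m ∈ ℕ`, `σ ∈ (0,1]`,
`‖f‖_{𝒞^s(Ω)} = Σ_{|α| ≤ m} ‖∂^α f‖_{𝒞^σ(Ω)}`. -/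
noncomputable def zygNorm (s : ℝ) (Ω : Set E) (f : E → F) : ℝ≥0∞ :=
  ∑ i ∈ Finset.range ⌈s⌉₊, zygBase (s - (⌈s⌉₊ - 1 : ℕ)) Ω (iteratedFDerivWithin ℝ i f Ω)

/-- Membership in the Zygmund space `𝒞^s(Ω)`. -/
def MemZyg (s : ℝ) (Ω : Set E) (f : E → F) : Prop :=
  ContDiffOn ℝ (⌈s⌉₊ - 1 : ℕ) f Ω ∧ zygNorm s Ω f ≠ ⊤

end
/-- Pointwise form of the bounds in the Zygmund norm. -/
structure ZygBound {E F : Type} [NormedAddCommGroup E] [NormedSpace ℝ E]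
    [NormedAddCommGroup F] [NormedSpace ℝ F]
    (σ : ℝ) (Ω : Set E) (f : E → F) (A H S : ℝ≥0∞) : Prop where
  sup : ∀ x ∈ Ω, ‖f x‖ₑ ≤ A
  hol : ∀ x ∈ Ω, ∀ y ∈ Ω, x ≠ y → ‖f x - f y‖ₑ ≤ H * ENNReal.ofReal (‖x - y‖ ^ (σ / 2))
  sec : ∀ x h : E, h ≠ 0 → x ∈ Ω → x + h ∈ Ω → x + 2 • h ∈ Ω →
    ‖f (x + 2 • h) - 2 • f (x + h) + f x‖ₑ ≤ S * ENNReal.ofReal (‖h‖ ^ σ)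

theorem zyg_div_iff {F : Type} [NormedAddCommGroup F] {v : F} {t : ℝ} (ht : 0 < t) {c : ℝ≥0∞} :
    ENNReal.ofReal (‖v‖ / t) ≤ c ↔ ‖v‖ₑ ≤ c * ENNReal.ofReal t := by
  rw [ENNReal.ofReal_div_of_pos ht, ofReal_norm,
    ENNReal.div_le_iff (by simpa using ht) ENNReal.ofReal_ne_top]

theorem zygBase_le_of_bound {E F : Type} [NormedAddCommGroup E] [NormedSpace ℝ E]
    [NormedAddCommGroup F] [NormedSpace ℝ F]
    {σ : ℝ} {Ω : Set E} {f : E → F} {A H S : ℝ≥0∞} (hb : ZygBound σ Ω f A H S) :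
    zygBase σ Ω f ≤ A + H + S := by
  unfold zygBase holderNorm secondDiff
  gcongr
  · refine iSup₂_le fun x hx => ?_
    rw [ofReal_norm]
    exact hb.sup x hx
  · refine iSup₂_le fun x hx => iSup₂_le fun y hy => iSup_le fun hxy => ?_
    rw [zyg_div_iff (Real.rpow_pos_of_pos (norm_pos_iff.2 (sub_ne_zero.2 hxy)) _)]
    exact hb.hol x hx y hy hxy
  · refine iSup₂_le fun x h => iSup₂_le fun h0 hx => iSup₂_le fun h1 h2 => ?_
    rw [zyg_div_iff (Real.rpow_pos_of_pos (norm_pos_iff.2 h0) _)]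
    exact hb.sec x h h0 hx h1 h2

theorem exists_zygBound {E F : Type} [NormedAddCommGroup E] [NormedSpace ℝ E]
    [NormedAddCommGroup F] [NormedSpace ℝ F]
    (σ : ℝ) (Ω : Set E) (f : E → F) :
    ∃ A H S, ZygBound σ Ω f A H S ∧ zygBase σ Ω f = A + H + S := by
  refine ⟨_, _, _, ⟨?_, ?_, ?_⟩, rfl⟩
  · intro x hx
    rw [← ofReal_norm]
    exact le_iSup₂ (f := fun x (_ : x ∈ Ω) => ENNReal.ofReal ‖f x‖) x hx
  · intro x hx y hy hxy
    rw [← zyg_div_iff (Real.rpow_pos_of_pos (norm_pos_iff.2 (sub_ne_zero.2 hxy)) _)]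
    refine le_iSup₂_of_le x hx (le_iSup₂_of_le y hy (le_iSup_of_le hxy le_rfl))
  · intro x h h0 hx h1 h2
    rw [← zyg_div_iff (Real.rpow_pos_of_pos (norm_pos_iff.2 h0) _)]
    exact le_iSup₂_of_le x h (le_iSup₂_of_le h0 hx (le_iSup₂_of_le h1 h2 le_rfl))

theorem zygBase_comp_le {E F G : Type} [NormedAddCommGroup E] [NormedSpace ℝ E]
    [NormedAddCommGroup F] [NormedSpace ℝ F] [NormedAddCommGroup G] [NormedSpace ℝ G]
    {σ : ℝ} {Ω : Set E} {f : E → F} {g : E → G} (L : F ≃ₗᵢ[ℝ] G)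
    (hg : ∀ x ∈ Ω, g x = L (f x)) : zygBase σ Ω g ≤ zygBase σ Ω f := by
  obtain ⟨A, H, S, hb, he⟩ := exists_zygBound σ Ω f
  rw [he]
  have hn : ∀ v, ‖L v‖ₑ = ‖v‖ₑ := fun v => by rw [← ofReal_norm, ← ofReal_norm, L.norm_map]
  refine zygBase_le_of_bound ⟨?_, ?_, ?_⟩
  · intro x hx
    rw [hg x hx, hn]
    exact hb.sup x hx
  · intro x hx y hy hxy
    rw [hg x hx, hg y hy, ← map_sub, hn]
    exact hb.hol x hx y hy hxy
  · intro x h h0 hx h1 h2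
    rw [hg _ hx, hg _ h1, hg _ h2, ← map_nsmul, ← map_sub, ← map_add, hn]
    exact hb.sec x h h0 hx h1 h2

theorem zygBase_add_le {E F : Type} [NormedAddCommGroup E] [NormedSpace ℝ E]
    [NormedAddCommGroup F] [NormedSpace ℝ F]
    {σ : ℝ} {Ω : Set E} {f f₁ f₂ : E → F}
    (hf : ∀ x ∈ Ω, f x = f₁ x + f₂ x) :
    zygBase σ Ω f ≤ zygBase σ Ω f₁ + zygBase σ Ω f₂ := by
  obtain ⟨A, H, S, hb, he⟩ := exists_zygBound σ Ω f₁
  obtain ⟨A', H', S', hb', he'⟩ := exists_zygBound σ Ω f₂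
  rw [he, he']
  have : A + H + S + (A' + H' + S') = (A + A') + (H + H') + (S + S') := by ring
  rw [this]
  refine zygBase_le_of_bound ⟨?_, ?_, ?_⟩
  · intro x hx
    rw [hf x hx]
    exact (enorm_add_le _ _).trans (add_le_add (hb.sup x hx) (hb'.sup x hx))
  · intro x hx y hy hxy
    rw [hf x hx, hf y hy, add_sub_add_comm, add_mul]
    exact (enorm_add_le _ _).trans (add_le_add (hb.hol x hx y hy hxy) (hb'.hol x hx y hy hxy))
  · intro x h h0 hx h1 h2
    rw [hf _ hx, hf _ h1, hf _ h2, smul_add, add_sub_add_comm, add_add_add_comm, add_mul]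
    exact (enorm_add_le _ _).trans
      (add_le_add (hb.sec x h h0 hx h1 h2) (hb'.sec x h h0 hx h1 h2))

theorem zygBase_bilin_le {E F G K : Type} [NormedAddCommGroup E] [NormedSpace ℝ E]
    [NormedAddCommGroup F] [NormedSpace ℝ F] [NormedAddCommGroup G] [NormedSpace ℝ G]
    [NormedAddCommGroup K] [NormedSpace ℝ K]
    (σ : ℝ) (Ω : Set E) (B : F →L[ℝ] G →L[ℝ] K) (f : E → F) (g : E → G) :
    zygBase σ Ω (fun x => B (f x) (g x)) ≤ 2 * ‖B‖ₑ * zygBase σ Ω f * zygBase σ Ω g := by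
  obtain ⟨A, H, S, hb, he⟩ := exists_zygBound σ Ω f
  obtain ⟨A', H', S', hb', he'⟩ := exists_zygBound σ Ω g
  rw [he, he']
  have key : ZygBound σ Ω (fun x => B (f x) (g x)) (‖B‖ₑ * A * A')
      (‖B‖ₑ * H * A' + ‖B‖ₑ * A * H')
      (‖B‖ₑ * S * A' + ‖B‖ₑ * A * S' + ‖B‖ₑ * H * H' + ‖B‖ₑ * H * H') := by
    have hB : ∀ {u v} {a b : ℝ≥0∞}, ‖u‖ₑ ≤ a → ‖v‖ₑ ≤ b → ‖B u v‖ₑ ≤ ‖B‖ₑ * a * b := by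
      intro u v a b hu hv
      exact (B.le_opENorm₂ u v).trans (by gcongr)
    refine ⟨?_, ?_, ?_⟩
    · intro x hx
      exact hB (hb.sup x hx) (hb'.sup x hx)
    · intro x hx y hy hxy
      have e : B (f x) (g x) - B (f y) (g y) = B (f x - f y) (g x) + B (f y) (g x - g y) := by
        simp
      rw [e]
      refine (enorm_add_le _ _).trans ((add_le_add (hB (hb.hol x hx y hy hxy) (hb'.sup x hx))
        (hB (hb.sup y hy) (hb'.hol x hx y hy hxy))).trans (le_of_eq ?_))
      ring
    · intro x h h0 hx h1 h2
      have e : B (f (x + 2 • h)) (g (x + 2 • h)) - 2 • B (f (x + h)) (g (x + h)) + B (f x) (g x)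
          = B (f (x + 2 • h) - 2 • f (x + h) + f x) (g (x + h))
            + B (f (x + h)) (g (x + 2 • h) - 2 • g (x + h) + g x)
            + B (f (x + 2 • h) - f (x + h)) (g (x + 2 • h) - g (x + h))
            + B (f x - f (x + h)) (g x - g (x + h)) := by
        simp only [map_sub, map_add, map_nsmul, _root_.sub_apply,
          _root_.add_apply, _root_.smul_apply]
        abel
      rw [e]
      have n1 : x + 2 • h ≠ x + h := by
        intro hh
        apply h0
        have := add_left_cancel hh
        rw [two_nsmul] at this
        simpa using this
      have n2 : x ≠ x + h := by
        intro hh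
        apply h0
        simpa using hh
      have r1 : x + 2 • h - (x + h) = h := by rw [two_nsmul]; abel
      have r2 : x - (x + h) = -h := by abel
      have f1 := hb.hol _ h2 _ h1 n1
      have g1 := hb'.hol _ h2 _ h1 n1
      have f2 := hb.hol _ hx _ h1 n2
      have g2 := hb'.hol _ hx _ h1 n2
      rw [r1] at f1 g1
      rw [r2, norm_neg] at f2 g2
      have hp : ENNReal.ofReal (‖h‖ ^ σ) =
          ENNReal.ofReal (‖h‖ ^ (σ / 2)) * ENNReal.ofReal (‖h‖ ^ (σ / 2)) := by
        rw [← ENNReal.ofReal_mul (by positivity), ← Real.rpow_add (norm_pos_iff.2 h0)]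
        congr 2
        ring
      refine (enorm_add_le _ _).trans ((add_le_add ((enorm_add_le _ _).trans
        (add_le_add ((enorm_add_le _ _).trans (add_le_add
          (hB (hb.sec x h h0 hx h1 h2) (hb'.sup _ h1))
          (hB (hb.sup _ h1) (hb'.sec x h h0 hx h1 h2)))) (hB f1 g1))) (hB f2 g2)).trans
          (le_of_eq ?_))
      rw [hp]
      ring
  refine (zygBase_le_of_bound key).trans ?_
  have : 2 * ‖B‖ₑ * (A + H + S) * (A' + H' + S') =
      (‖B‖ₑ * A * A' + (‖B‖ₑ * H * A' + ‖B‖ₑ * A * H') +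
      (‖B‖ₑ * S * A' + ‖B‖ₑ * A * S' + ‖B‖ₑ * H * H' + ‖B‖ₑ * H * H')) +
      ‖B‖ₑ * (A * A' + H * A' + A * H' + S * A' + A * S' + 2 * (H * S') + 2 * (S * H')
        + 2 * (S * S')) := by ring
  rw [this]
  exact le_self_add

/-- Sum of the Zygmund norms of the derivatives up to order `k`. -/
noncomputable def zygSum {E F : Type} [NormedAddCommGroup E] [NormedSpace ℝ E]
    [NormedAddCommGroup F] [NormedSpace ℝ F] (k : ℕ) (σ : ℝ) (Ω : Set E) (f : E → F) : ℝ≥0∞ :=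
  ∑ i ∈ Finset.range (k + 1), zygBase σ Ω (iteratedFDerivWithin ℝ i f Ω)

theorem zygSum_mono {E F : Type} [NormedAddCommGroup E] [NormedSpace ℝ E]
    [NormedAddCommGroup F] [NormedSpace ℝ F] {k l : ℕ} (h : k ≤ l) (σ : ℝ) (Ω : Set E)
    (f : E → F) : zygSum k σ Ω f ≤ zygSum l σ Ω f := by
  unfold zygSum
  exact Finset.sum_le_sum_of_subset (Finset.range_mono (by omega))

theorem zygSum_fderivWithin_le {E F : Type} [NormedAddCommGroup E] [NormedSpace ℝ E]
    [NormedAddCommGroup F] [NormedSpace ℝ F] (k : ℕ) (σ : ℝ) {Ω : Set E}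
    (hΩ : UniqueDiffOn ℝ Ω) (f : E → F) :
    zygSum k σ Ω (fun y => fderivWithin ℝ f Ω y) ≤ zygSum (k + 1) σ Ω f := by
  unfold zygSum
  rw [Finset.sum_range_succ' _ (k + 1)]
  refine le_trans (Finset.sum_le_sum fun i _ => ?_) le_self_add
  refine zygBase_comp_le (continuousMultilinearCurryRightEquiv' ℝ i E F) fun x hx => ?_
  rw [iteratedFDerivWithin_succ_eq_comp_right hΩ hx]
  simp only [Function.comp_apply, LinearIsometryEquiv.apply_symm_apply]

theorem zygBase_iterated_bilin_le {E F G K : Type} [NormedAddCommGroup E] [NormedSpace ℝ E]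
    [NormedAddCommGroup F] [NormedSpace ℝ F] [NormedAddCommGroup G] [NormedSpace ℝ G]
    [NormedAddCommGroup K] [NormedSpace ℝ K]
    (σ : ℝ) {Ω : Set E} (hs : UniqueDiffOn ℝ Ω) (k : ℕ)
    {b : ℝ} (B : F →L[ℝ] G →L[ℝ] K) (hB : ‖B‖ ≤ b) {f : E → F} {g : E → G}
    (hf : ContDiffOn ℝ k f Ω) (hg : ContDiffOn ℝ k g Ω) :
    zygBase σ Ω (iteratedFDerivWithin ℝ k (fun x => B (f x) (g x)) Ω) ≤
      2 ^ (k + 1) * ENNReal.ofReal b * zygSum k σ Ω f * zygSum k σ Ω g := by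
  induction k generalizing F G K with
  | zero =>
    have h0 : ∀ {V : Type} [NormedAddCommGroup V] [NormedSpace ℝ V] (u : E → V),
        zygBase σ Ω u ≤ zygSum 0 σ Ω u := by
      intro V _ _ u
      simp only [zygSum, zero_add, Finset.range_one, Finset.sum_singleton]
      exact zygBase_comp_le (continuousMultilinearCurryFin0 ℝ E V) fun x hx => by
        simp [iteratedFDerivWithin_zero_eq_comp]
    refine (zygBase_comp_le (continuousMultilinearCurryFin0 ℝ E K).symm
      (f := fun x => B (f x) (g x)) fun x hx => by
        simp only [iteratedFDerivWithin_zero_eq_comp, Function.comp_apply]).trans ?_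
    refine (zygBase_bilin_le σ Ω B f g).trans ?_
    rw [zero_add, pow_one]
    have hB' : ‖B‖ₑ ≤ ENNReal.ofReal b := by
      rw [← ofReal_norm]
      exact ENNReal.ofReal_le_ofReal hB
    gcongr
    · exact h0 f
    · exact h0 g
  | succ k IH =>
    have In : ((k : ℕ) : WithTop ℕ∞) + 1 ≤ ((k + 1 : ℕ) : WithTop ℕ∞) := by
      simp only [Nat.cast_succ, le_refl]
    have hf' := hf.of_le (Nat.cast_le.2 (Nat.le_succ k))
    have hg' := hg.of_le (Nat.cast_le.2 (Nat.le_succ k))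
    have hdf := hf.fderivWithin hs In
    have hdg := hg.fderivWithin hs In
    have I1 := IH (B.precompR E) ((B.norm_precompR_le E).trans hB) hf' hdg
    have I2 := IH (B.precompL E) ((B.norm_precompL_le E).trans hB) hdf hg'
    have A : ContDiffOn ℝ k (fun y => B.precompR E (f y) (fderivWithin ℝ g Ω y)) Ω :=
      (B.precompR E).isBoundedBilinearMap.contDiff.comp₂_contDiffOn hf' hdg
    have A' : ContDiffOn ℝ k (fun y => B.precompL E (fderivWithin ℝ f Ω y) (g y)) Ω :=
      (B.precompL E).isBoundedBilinearMap.contDiff.comp₂_contDiffOn hdf hg'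
    have J : ∀ x ∈ Ω, iteratedFDerivWithin ℝ k
        (fun y => fderivWithin ℝ (fun y => B (f y) (g y)) Ω y) Ω x =
          iteratedFDerivWithin ℝ k (fun y => B.precompR E (f y) (fderivWithin ℝ g Ω y)) Ω x +
          iteratedFDerivWithin ℝ k (fun y => B.precompL E (fderivWithin ℝ f Ω y) (g y)) Ω x := by
      intro x hx
      rw [← fun_iteratedFDerivWithin_add_apply (A.contDiffWithinAt hx)
        (A'.contDiffWithinAt hx) hs hx]
      apply iteratedFDerivWithin_congr (fun y hy => ?_) hx
      exact B.fderivWithin_of_bilinear (hf.differentiableOn (by positivity) y hy)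
        (hg.differentiableOn (by positivity) y hy) (hs y hy)
    refine (zygBase_comp_le (continuousMultilinearCurryRightEquiv' ℝ k E K).symm
      (f := iteratedFDerivWithin ℝ k
        (fun y => fderivWithin ℝ (fun y => B (f y) (g y)) Ω y) Ω) fun x hx => by
        rw [iteratedFDerivWithin_succ_eq_comp_right hs hx, Function.comp_apply]).trans ?_
    refine (zygBase_add_le J).trans ((add_le_add I1 I2).trans ?_)
    calc _ ≤ 2 ^ (k + 1) * ENNReal.ofReal b * zygSum (k + 1) σ Ω f * zygSum (k + 1) σ Ω g
          + 2 ^ (k + 1) * ENNReal.ofReal b * zygSum (k + 1) σ Ω f * zygSum (k + 1) σ Ω g := by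
          gcongr
          · exact zygSum_mono (Nat.le_succ k) σ Ω f
          · exact zygSum_fderivWithin_le k σ hs g
          · exact zygSum_fderivWithin_le k σ hs f
          · exact zygSum_mono (Nat.le_succ k) σ Ω g
      _ = _ := by ring

/-- For `m ∈ ℕ`, `s ∈ (m, m+1]`, the Zygmund space `𝒞^s(Ω)` on a bounded connected
open `Ω ⊆ ℝ^n` is an algebra: `‖fg‖_{𝒞^s} ≤ C ‖f‖_{𝒞^s} ‖g‖_{𝒞^s}` with `C = C(m,n)`. -/
theorem zygmund_algebra (n m : ℕ) :
    ∃ C : ℝ≥0∞, C < ⊤ ∧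
      ∀ s : ℝ, (m : ℝ) < s → s ≤ m + 1 →
        ∀ Ω : Set (EuclideanSpace ℝ (Fin n)),
          IsOpen Ω → Bornology.IsBounded Ω → IsConnected Ω →
            ∀ f g : EuclideanSpace ℝ (Fin n) → ℝ,
              MemZyg s Ω f → MemZyg s Ω g →
                MemZyg s Ω (fun x => f x * g x) ∧
                  zygNorm s Ω (fun x => f x * g x) ≤ C * zygNorm s Ω f * zygNorm s Ω g := by
  refine ⟨∑ k ∈ Finset.range (m + 1), 2 ^ (k + 1), ?_, ?_⟩
  · exact ENNReal.sum_lt_top.2 fun k _ => ENNReal.pow_lt_top (by simp)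
  intro s hms hsm Ω hΩ _ _ f g hf hg
  have hc : ⌈s⌉₊ = m + 1 := by
    rw [Nat.ceil_eq_iff (by omega)]
    simpa using ⟨hms, hsm⟩
  have hN : ∀ u : EuclideanSpace ℝ (Fin n) → ℝ, zygNorm s Ω u = zygSum m (s - m) Ω u := by
    intro u
    simp only [zygNorm, zygSum, hc, Nat.add_sub_cancel]
  obtain ⟨cf, nf⟩ := hf
  obtain ⟨cg, ng⟩ := hg
  rw [hc, Nat.add_sub_cancel] at cf cg
  have hb : zygNorm s Ω (fun x => f x * g x) ≤
      (∑ k ∈ Finset.range (m + 1), 2 ^ (k + 1)) * zygNorm s Ω f * zygNorm s Ω g := by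
    rw [hN, hN, hN, Finset.sum_mul, Finset.sum_mul]
    refine Finset.sum_le_sum fun k hk => ?_
    have hkm : k ≤ m := Nat.lt_succ_iff.1 (Finset.mem_range.1 hk)
    have := zygBase_iterated_bilin_le (s - m) hΩ.uniqueDiffOn k (ContinuousLinearMap.mul ℝ ℝ)
      (ContinuousLinearMap.opNorm_mul_le ℝ ℝ)
      (cf.of_le (Nat.cast_le.2 hkm)) (cg.of_le (Nat.cast_le.2 hkm))
    simp only [ContinuousLinearMap.mul_apply'] at this
    refine this.trans ?_
    calc _ ≤ 2 ^ (k + 1) * 1 * zygSum m (s - m) Ω f * zygSum m (s - m) Ω g := by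
          rw [ENNReal.ofReal_one]
          gcongr
          · exact zygSum_mono hkm _ _ _
          · exact zygSum_mono hkm _ _ _
      _ = _ := by rw [mul_one]
  refine ⟨⟨?_, ?_⟩, hb⟩
  · rw [hc, Nat.add_sub_cancel]
    exact cf.mul cg
  · refine ne_top_of_le_ne_top ?_ hb
    refine ENNReal.mul_ne_top (ENNReal.mul_ne_top ?_ nf) ng
    exact (ENNReal.sum_lt_top.2 fun k _ => ENNReal.pow_lt_top (by simp)).ne
end

section
/- Let D₁, D₂ > 0, s₁ > 0, s₂ ≥ s₁ with s₂ > 1. Suppose f ∈ 𝒞^{s₁}(B^n(D₁)) and g ∈ 𝒞^{s₂}(B^m(D₂); ℝ^n) with g(B^m(D₂)) ⊆ B^n(D₁). Then f ∘ g ∈ 𝒞^{s₁}(B^m(D₂)) and ‖f ∘ g‖_{𝒞^{s₁}(B^m(D₂))} ≤ C ‖f‖_{𝒞^{s₁}(B^n(D₁))}, where C depends only on s₁, s₂, D₁, D₂, m, n, and an upper bound for ‖g‖_{𝒞^{s₂}(B^m(D₂))}. -/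
open Set Metric ENNReal

namespace ZygAux

/-- Real-valued version of `zygBase σ Ω f ≤ A`. -/
structure Zb {E F : Type} [NormedAddCommGroup E] [NormedSpace ℝ E]
    [NormedAddCommGroup F] [NormedSpace ℝ F] (σ : ℝ) (Ω : Set E) (f : E → F) (A : ℝ) : Prop where
  nonneg : 0 ≤ A
  sup : ∀ x ∈ Ω, ‖f x‖ ≤ A
  hol : ∀ x ∈ Ω, ∀ y ∈ Ω, ‖f x - f y‖ ≤ A * ‖x - y‖ ^ (σ / 2)
  sec : ∀ x h : E, x ∈ Ω → x + h ∈ Ω → x + 2 • h ∈ Ω →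
    ‖f (x + 2 • h) - 2 • f (x + h) + f x‖ ≤ A * ‖h‖ ^ σ

/-- Real-valued version of membership in the Zygmund space of order `k + σ` with norm bound. -/
def Zk {E F : Type} [NormedAddCommGroup E] [NormedSpace ℝ E]
    [NormedAddCommGroup F] [NormedSpace ℝ F] (k : ℕ) (σ : ℝ) (Ω : Set E) (f : E → F)
    (A : ℝ) : Prop :=
  ContDiffOn ℝ k f Ω ∧ ∀ i ≤ k, Zb σ Ω (iteratedFDerivWithin ℝ i f Ω) A

section
variable {E F G : Type} [NormedAddCommGroup E] [NormedSpace ℝ E]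
  [NormedAddCommGroup F] [NormedSpace ℝ F] [NormedAddCommGroup G] [NormedSpace ℝ G]

lemma Zb.mono {σ : ℝ} {Ω : Set E} {f : E → F} {A B : ℝ} (h : Zb σ Ω f A) (hAB : A ≤ B) :
    Zb σ Ω f B where
  nonneg := h.nonneg.trans hAB
  sup x hx := (h.sup x hx).trans hAB
  hol x hx y hy := (h.hol x hx y hy).trans (by gcongr)
  sec x v h0 h1 h2 := (h.sec x v h0 h1 h2).trans (by gcongr)

lemma Zk.mono {k : ℕ} {σ : ℝ} {Ω : Set E} {f : E → F} {A B : ℝ} (h : Zk k σ Ω f A)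
    (hAB : A ≤ B) : Zk k σ Ω f B := ⟨h.1, fun i hi => (h.2 i hi).mono hAB⟩

lemma Zk.nonneg {k : ℕ} {σ : ℝ} {Ω : Set E} {f : E → F} {A : ℝ} (h : Zk k σ Ω f A) : 0 ≤ A :=
  (h.2 0 (Nat.zero_le _)).nonneg

/-- Transfer along functions with same norms of differences. -/
lemma Zb.isom {σ : ℝ} {Ω : Set E} {f : E → F} {f' : E → G} {A : ℝ} (h : Zb σ Ω f A)
    (L : F →ₗᵢ[ℝ] G) (hf : ∀ x ∈ Ω, f' x = L (f x)) : Zb σ Ω f' A where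
  nonneg := h.nonneg
  sup x hx := by rw [hf x hx, L.norm_map]; exact h.sup x hx
  hol x hx y hy := by rw [hf x hx, hf y hy, ← map_sub, L.norm_map]; exact h.hol x hx y hy
  sec x v h0 h1 h2 := by
    rw [hf _ h0, hf _ h1, hf _ h2, ← map_nsmul, ← map_sub, ← map_add, L.norm_map]
    exact h.sec x v h0 h1 h2

lemma Zb.congr {σ : ℝ} {Ω : Set E} {f f' : E → F} {A : ℝ} (h : Zb σ Ω f A)
    (hf : ∀ x ∈ Ω, f' x = f x) : Zb σ Ω f' A :=
  h.isom LinearIsometry.id (by simpa using hf)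

lemma Zk.congr {k : ℕ} {σ : ℝ} {Ω : Set E} {f f' : E → F} {A : ℝ} (h : Zk k σ Ω f A)
    (hf : ∀ x ∈ Ω, f' x = f x) : Zk k σ Ω f' A :=
  ⟨h.1.congr hf, fun i hi => (h.2 i hi).congr fun _ hx => iteratedFDerivWithin_congr hf hx i⟩

lemma Zk.zb {k : ℕ} {σ : ℝ} {Ω : Set E} {f : E → F} {A : ℝ} (h : Zk k σ Ω f A) : Zb σ Ω f A :=
  (h.2 0 (Nat.zero_le _)).isom
    (continuousMultilinearCurryFin0 ℝ E F).toLinearIsometry (fun x hx => by simp)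

lemma Zb.iter0 {σ : ℝ} {Ω : Set E} {f : E → F} {A : ℝ} (h : Zb σ Ω f A) :
    Zb σ Ω (iteratedFDerivWithin ℝ 0 f Ω) A :=
  h.isom (continuousMultilinearCurryFin0 ℝ E F).symm.toLinearIsometry
    (fun x hx => by ext; simp)

lemma Zb.contOn {σ : ℝ} (hσ : 0 < σ) {Ω : Set E} {f : E → F} {A : ℝ} (h : Zb σ Ω f A) :
    ContinuousOn f Ω := by
  intro x hx
  rw [ContinuousWithinAt, tendsto_iff_norm_sub_tendsto_zero]
  have h1 : Filter.Tendsto (fun y => A * ‖y - x‖ ^ (σ / 2)) (nhdsWithin x Ω) (nhds 0) := by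
    have : Continuous (fun y => A * ‖y - x‖ ^ (σ / 2)) := by
      have h3 : Continuous fun r : ℝ => r ^ (σ / 2) := Real.continuous_rpow_const (by positivity)
      have h4 : Continuous fun y : E => ‖y - x‖ := by fun_prop
      exact continuous_const.mul (h3.comp h4)
    have h2 := (this.tendsto x).mono_left (nhdsWithin_le_nhds (s := Ω))
    have : (0 : ℝ) ^ (σ / 2) = 0 := Real.zero_rpow (by positivity)
    simpa [this] using h2
  refine squeeze_zero' (Filter.Eventually.of_forall fun _ => norm_nonneg _) ?_ h1
  filter_upwards [self_mem_nhdsWithin] with y hy using h.hol y hy x hx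

lemma zk_zero {σ : ℝ} (hσ : 0 < σ) {Ω : Set E} {f : E → F} {A : ℝ} :
    Zk 0 σ Ω f A ↔ Zb σ Ω f A := by
  refine ⟨Zk.zb, fun h => ⟨?_, fun i hi => ?_⟩⟩
  · simpa using h.contOn hσ
  · obtain rfl : i = 0 := by omega
    exact h.iter0

lemma zk_succ {k : ℕ} {σ : ℝ} {Ω : Set E} (hΩ : IsOpen Ω) {f : E → F} {A : ℝ} :
    Zk (k + 1) σ Ω f A ↔
      Zb σ Ω f A ∧ DifferentiableOn ℝ f Ω ∧ Zk k σ Ω (fderivWithin ℝ f Ω) A := by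
  have hu := hΩ.uniqueDiffOn (𝕜 := ℝ)
  have key : ContDiffOn ℝ ((k + 1 : ℕ) : WithTop ℕ∞) f Ω ↔
      DifferentiableOn ℝ f Ω ∧ ContDiffOn ℝ (k : WithTop ℕ∞) (fderivWithin ℝ f Ω) Ω := by
    push_cast
    rw [contDiffOn_succ_iff_fderivWithin hu]
    simp
  constructor
  · rintro h
    refine ⟨h.zb, (key.1 h.1).1, (key.1 h.1).2, fun i hi => ?_⟩
    refine (h.2 (i + 1) (by omega)).isom
      (continuousMultilinearCurryRightEquiv' ℝ i E F).toLinearIsometry fun x hx => ?_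
    rw [iteratedFDerivWithin_succ_eq_comp_right hu hx]
    simp
  · rintro ⟨h0, hd, h1⟩
    refine ⟨key.2 ⟨hd, h1.1⟩, fun i hi => ?_⟩
    rcases i with _ | i
    · exact h0.iter0
    · refine (h1.2 i (by omega)).isom
        (continuousMultilinearCurryRightEquiv' ℝ i E F).symm.toLinearIsometry fun x hx => ?_
      rw [iteratedFDerivWithin_succ_eq_comp_right hu hx]
      simp

lemma Zb.add {σ : ℝ} {Ω : Set E} {f f' : E → F} {A A' : ℝ} (h : Zb σ Ω f A)
    (h' : Zb σ Ω f' A') : Zb σ Ω (fun x => f x + f' x) (A + A') where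
  nonneg := add_nonneg h.nonneg h'.nonneg
  sup x hx := (norm_add_le _ _).trans (add_le_add (h.sup x hx) (h'.sup x hx))
  hol x hx y hy := by
    rw [add_mul, add_sub_add_comm]
    exact (norm_add_le _ _).trans (add_le_add (h.hol x hx y hy) (h'.hol x hx y hy))
  sec x v h0 h1 h2 := by
    have : f (x + 2 • v) + f' (x + 2 • v) - 2 • (f (x + v) + f' (x + v)) + (f x + f' x) =
      (f (x + 2 • v) - 2 • f (x + v) + f x) + (f' (x + 2 • v) - 2 • f' (x + v) + f' x) := by
      rw [smul_add]; abel
    rw [add_mul, this]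
    exact (norm_add_le _ _).trans (add_le_add (h.sec x v h0 h1 h2) (h'.sec x v h0 h1 h2))

lemma Zk.add {k : ℕ} {σ : ℝ} {Ω : Set E} (hΩ : IsOpen Ω) {f f' : E → F} {A A' : ℝ}
    (h : Zk k σ Ω f A) (h' : Zk k σ Ω f' A') : Zk k σ Ω (fun x => f x + f' x) (A + A') := by
  refine ⟨h.1.add h'.1, fun i hi => ((h.2 i hi).add (h'.2 i hi)).congr fun x hx => ?_⟩
  have hi' : (i : WithTop ℕ∞) ≤ k := by exact_mod_cast hi
  exact fun_iteratedFDerivWithin_add_apply ((h.1.of_le hi') x hx) ((h'.1.of_le hi') x hx)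
    (hΩ.uniqueDiffOn) hx

/-- powers on a bounded set -/
lemma rpow_le_bdd {r R a b : ℝ} (hr : 0 ≤ r) (hR : r ≤ R) (ha : 0 < a) (hab : a ≤ b) :
    r ^ b ≤ R ^ (b - a) * r ^ a := by
  rcases hr.eq_or_lt with rfl | hr
  · rw [Real.zero_rpow ha.ne', Real.zero_rpow (by linarith)]; simp
  · have : r ^ b = r ^ (b - a) * r ^ a := by rw [← Real.rpow_add hr]; congr 1; ring
    rw [this]
    gcongr

lemma Zb.lower {σ σ' D : ℝ} (hσ : 0 < σ) (hσσ : σ ≤ σ') {Ω : Set E}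
    (hD : ∀ x ∈ Ω, ‖x‖ ≤ D) (hD0 : 0 ≤ D) {f : E → F} {A : ℝ} (h : Zb σ' Ω f A) :
    Zb σ Ω f ((1 + (2 * D) ^ (σ' / 2 - σ / 2) + (2 * D) ^ (σ' - σ)) * A) := by
  have hA := h.nonneg
  have p1 : 0 ≤ (2 * D) ^ (σ' / 2 - σ / 2) := by positivity
  have p2 : 0 ≤ (2 * D) ^ (σ' - σ) := by positivity
  have hd : ∀ x ∈ Ω, ∀ y ∈ Ω, ‖x - y‖ ≤ 2 * D := fun x hx y hy => by
    have := norm_sub_le x y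
    linarith [hD x hx, hD y hy]
  refine ⟨by positivity, fun x hx => (h.sup x hx).trans ?_, fun x hx y hy =>
    (h.hol x hx y hy).trans ?_, fun x v h0 h1 h2 => (h.sec x v h0 h1 h2).trans ?_⟩
  · nlinarith [mul_nonneg p1 hA, mul_nonneg p2 hA]
  · have := rpow_le_bdd (norm_nonneg (x - y)) (hd x hx y hy) (half_pos hσ)
      (by linarith : σ / 2 ≤ σ' / 2)
    calc A * ‖x - y‖ ^ (σ' / 2) ≤ A * ((2 * D) ^ (σ' / 2 - σ / 2) * ‖x - y‖ ^ (σ / 2)) := by gcongr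
      _ = ((2 * D) ^ (σ' / 2 - σ / 2) * A) * ‖x - y‖ ^ (σ / 2) := by ring
      _ ≤ _ := by gcongr; linarith
  · have hv : ‖v‖ ≤ 2 * D := by simpa using hd _ h1 _ h0
    have := rpow_le_bdd (norm_nonneg v) hv hσ hσσ
    calc A * ‖v‖ ^ σ' ≤ A * ((2 * D) ^ (σ' - σ) * ‖v‖ ^ σ) := by gcongr
      _ = ((2 * D) ^ (σ' - σ) * A) * ‖v‖ ^ σ := by ring
      _ ≤ _ := by gcongr; linarith

lemma lip_of_deriv {σ : ℝ} {Ω : Set E} (hc : Convex ℝ Ω) {f : E → F} {A : ℝ}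
    (hd : DifferentiableOn ℝ f Ω) (h : Zb σ Ω (fderivWithin ℝ f Ω) A) :
    ∀ x ∈ Ω, ∀ y ∈ Ω, ‖f x - f y‖ ≤ A * ‖x - y‖ := fun x hx y hy =>
  hc.norm_image_sub_le_of_norm_fderivWithin_le hd h.sup hy hx

lemma sec_of_deriv {σ : ℝ} {Ω : Set E} (hΩ : IsOpen Ω) (hc : Convex ℝ Ω) {f : E → F} {A : ℝ}
    (hd : DifferentiableOn ℝ f Ω) (h : Zb σ Ω (fderivWithin ℝ f Ω) A) (hσ : 0 < σ) :
    ∀ x v : E, x ∈ Ω → x + v ∈ Ω → x + 2 • v ∈ Ω →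
    ‖f (x + 2 • v) - 2 • f (x + v) + f x‖ ≤ A * ‖v‖ ^ (1 + σ / 2) := by
  intro x v h0 h1 h2
  have hs : Convex ℝ (segment ℝ x (x + v)) := convex_segment _ _
  have hs1 : segment ℝ x (x + v) ⊆ Ω := hc.segment_subset h0 h1
  have hs2 : ∀ y ∈ segment ℝ x (x + v), y + v ∈ Ω := by
    intro y hy
    have h2' : (x + v) + v ∈ Ω := by rwa [add_assoc, ← two_nsmul]
    have := hc.segment_subset h1 h2'
    apply this
    rw [add_comm y v, add_comm (x + v) v]
    nth_rewrite 1 [add_comm x v]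
    exact (mem_segment_translate ℝ v).2 hy
  have hder : ∀ y ∈ Ω, HasFDerivAt f (fderivWithin ℝ f Ω y) y := fun y hy =>
    (hd y hy).hasFDerivWithinAt.hasFDerivAt (hΩ.mem_nhds hy)
  have := hs.norm_image_sub_le_of_norm_hasFDerivWithin_le
    (f := fun y => f (y + v) - f y)
    (f' := fun y => fderivWithin ℝ f Ω (y + v) - fderivWithin ℝ f Ω y)
    (C := A * ‖v‖ ^ (σ / 2)) (x := x) (y := x + v)
    (fun y hy => by
      have e1 := (hasFDerivAt_comp_add_right v).2 (hder _ (hs2 y hy))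
      exact (e1.sub (hder y (hs1 hy))).hasFDerivWithinAt)
    (fun y hy => by simpa using h.hol _ (hs2 y hy) _ (hs1 hy))
    (left_mem_segment _ _ _) (right_mem_segment _ _ _)
  have e : f (x + 2 • v) - 2 • f (x + v) + f x =
      (f (x + v + v) - f (x + v)) - (f (x + v) - f x) := by
    rw [two_nsmul v, two_nsmul, ← add_assoc]; abel
  rw [e]
  refine this.trans (le_of_eq ?_)
  rw [add_sub_cancel_left, Real.rpow_add' (norm_nonneg _) (by positivity), Real.rpow_one]
  ring

lemma zb_of_lip {σ D : ℝ} (hσ : 0 < σ) (hσ1 : σ ≤ 1) {Ω : Set E}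
    (hD : ∀ x ∈ Ω, ‖x‖ ≤ D) (hD0 : 0 ≤ D) {f : E → F} {A : ℝ} (hA : 0 ≤ A)
    (hs : ∀ x ∈ Ω, ‖f x‖ ≤ A) (hl : ∀ x ∈ Ω, ∀ y ∈ Ω, ‖f x - f y‖ ≤ A * ‖x - y‖) :
    Zb σ Ω f ((1 + (2 * D) ^ (1 - σ / 2) + 2 * (2 * D) ^ (1 - σ)) * A) := by
  have p1 : 0 ≤ (2 * D) ^ (1 - σ / 2) := by positivity
  have p2 : 0 ≤ (2 * D) ^ (1 - σ) := by positivity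
  have hd : ∀ x ∈ Ω, ∀ y ∈ Ω, ‖x - y‖ ≤ 2 * D := fun x hx y hy => by
    have := norm_sub_le x y
    linarith [hD x hx, hD y hy]
  refine ⟨by positivity, fun x hx => (hs x hx).trans ?_, fun x hx y hy =>
    (hl x hx y hy).trans ?_, fun x v h0 h1 h2 => ?_⟩
  · nlinarith [mul_nonneg p1 hA, mul_nonneg p2 hA]
  · have := rpow_le_bdd (norm_nonneg (x - y)) (hd x hx y hy) (half_pos hσ)
      (by linarith : σ / 2 ≤ 1)
    rw [Real.rpow_one] at this
    calc A * ‖x - y‖ ≤ A * ((2 * D) ^ (1 - σ / 2) * ‖x - y‖ ^ (σ / 2)) := by gcongr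
      _ = ((2 * D) ^ (1 - σ / 2) * A) * ‖x - y‖ ^ (σ / 2) := by ring
      _ ≤ _ := by gcongr; linarith
  · have hv : ‖v‖ ≤ 2 * D := by simpa using hd _ h1 _ h0
    have := rpow_le_bdd (norm_nonneg v) hv hσ hσ1
    rw [Real.rpow_one] at this
    have e : f (x + 2 • v) - 2 • f (x + v) + f x =
      (f (x + 2 • v) - f (x + v)) + (f x - f (x + v)) := by
      rw [two_nsmul (f _)]; abel
    have e1 := hl _ h2 _ h1
    have e2 := hl _ h0 _ h1
    have e3 : x + 2 • v - (x + v) = v := by rw [two_nsmul]; abel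
    have e4 : x - (x + v) = -v := by abel
    rw [e3] at e1
    rw [e4, norm_neg] at e2
    rw [e]
    calc _ ≤ A * ‖v‖ + A * ‖v‖ := (norm_add_le _ _).trans (add_le_add e1 e2)
      _ = 2 * A * ‖v‖ := by ring
      _ ≤ 2 * A * ((2 * D) ^ (1 - σ) * ‖v‖ ^ σ) := by gcongr
      _ = (2 * (2 * D) ^ (1 - σ) * A) * ‖v‖ ^ σ := by ring
      _ ≤ _ := by gcongr; linarith

end

/-- Embedding of Zygmund spaces. -/
lemma embed {E : Type} [NormedAddCommGroup E] [NormedSpace ℝ E] {Ω : Set E} (hΩ : IsOpen Ω)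
    (hc : Convex ℝ Ω) {D : ℝ} (hD : ∀ x ∈ Ω, ‖x‖ ≤ D) (hD0 : 0 ≤ D) {σ σ' : ℝ} (hσ : 0 < σ)
    (hσ1 : σ ≤ 1) (hσ' : 0 < σ') (hσ1' : σ' ≤ 1) (k : ℕ) :
    ∀ k' : ℕ, (k : ℝ) + σ ≤ k' + σ' → ∃ C : ℝ, 0 ≤ C ∧
      ∀ (F : Type) [NormedAddCommGroup F] [NormedSpace ℝ F] (f : E → F) (A : ℝ),
        Zk k' σ' Ω f A → Zk k σ Ω f (C * A) := by
  have base : ∀ k' : ℕ, σ ≤ k' + σ' → ∃ C : ℝ, 0 ≤ C ∧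
      ∀ (F : Type) [NormedAddCommGroup F] [NormedSpace ℝ F] (f : E → F) (A : ℝ),
        Zk k' σ' Ω f A → Zb σ Ω f (C * A) := by
    intro k' hk
    rcases k' with _ | k'
    · refine ⟨_, ?_, fun F _ _ f A h => Zb.lower hσ (by simpa using hk) hD hD0 h.zb⟩
      positivity
    · refine ⟨1 + (2 * D) ^ (1 - σ / 2) + 2 * (2 * D) ^ (1 - σ), by positivity,
        fun F _ _ f A h => ?_⟩
      · have h' := (zk_succ hΩ).1 h
        exact zb_of_lip hσ hσ1 hD hD0 h.nonneg h'.1.sup (lip_of_deriv hc h'.2.1 h'.2.2.zb)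
  induction k with
  | zero =>
    intro k' hk
    obtain ⟨C, hC, H⟩ := base k' (by simpa using hk)
    exact ⟨C, hC, fun F _ _ f A h => (zk_zero hσ).2 (H F f A h)⟩
  | succ k ih =>
    intro k' hk
    rcases k' with _ | k'
    · push_cast at hk
      have : (0 : ℝ) ≤ k := Nat.cast_nonneg k
      linarith
    push_cast at hk
    obtain ⟨C, hC, H⟩ := base (k' + 1) (by
      have : (0 : ℝ) ≤ k' := Nat.cast_nonneg k'
      push_cast
      linarith)
    obtain ⟨C', hC', H'⟩ := ih k' (by linarith)
    refine ⟨C + C', by positivity, fun F _ _ f A h => ?_⟩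
    have h' := (zk_succ hΩ).1 h
    have hA := h.nonneg
    refine (zk_succ hΩ).2 ⟨(H F f A h).mono ?_, h'.2.1, (H' _ _ _ h'.2.2).mono ?_⟩
    · nlinarith [mul_nonneg hC' hA]
    · nlinarith [mul_nonneg hC hA]

lemma zb_bilin {E F₁ F₂ G : Type} [NormedAddCommGroup E] [NormedSpace ℝ E]
    [NormedAddCommGroup F₁] [NormedSpace ℝ F₁] [NormedAddCommGroup F₂] [NormedSpace ℝ F₂]
    [NormedAddCommGroup G] [NormedSpace ℝ G] {Ω : Set E} {σ : ℝ} (hσ : 0 < σ)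
    (B : F₁ →L[ℝ] F₂ →L[ℝ] G) (hB : ‖B‖ ≤ 1) {u : E → F₁} {v : E → F₂} {A A' : ℝ}
    (hu : Zb σ Ω u A) (hv : Zb σ Ω v A') : Zb σ Ω (fun x => B (u x) (v x)) (4 * (A * A')) := by
  have hA := hu.nonneg
  have hA' := hv.nonneg
  have hb : ∀ a b, ∀ α β : ℝ, ‖a‖ ≤ α → ‖b‖ ≤ β → ‖B a b‖ ≤ α * β := by
    intro a b α β ha hb
    have h1 := B.le_opNorm₂ a b
    have h2 : 0 ≤ α := (norm_nonneg _).trans ha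
    calc _ ≤ ‖B‖ * ‖a‖ * ‖b‖ := h1
      _ ≤ 1 * α * β := by gcongr
      _ = _ := by ring
  refine ⟨by positivity, fun x hx => ?_, fun x hx y hy => ?_, fun x h h0 h1 h2 => ?_⟩
  · refine (hb _ _ _ _ (hu.sup x hx) (hv.sup x hx)).trans ?_
    nlinarith [mul_nonneg hA hA']
  · have e : B (u x) (v x) - B (u y) (v y) = B (u x - u y) (v x) + B (u y) (v x - v y) := by
      simp
    rw [e]
    refine (norm_add_le _ _).trans ((add_le_add
      (hb _ _ _ _ (hu.hol x hx y hy) (hv.sup x hx))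
      (hb _ _ _ _ (hu.sup y hy) (hv.hol x hx y hy))).trans ?_)
    have : 0 ≤ A * A' * ‖x - y‖ ^ (σ / 2) := by positivity
    nlinarith
  · have e : B (u (x + 2 • h)) (v (x + 2 • h)) - 2 • B (u (x + h)) (v (x + h)) + B (u x) (v x) =
      B (u (x + 2 • h) - 2 • u (x + h) + u x) (v (x + h)) +
      B (u (x + h)) (v (x + 2 • h) - 2 • v (x + h) + v x) +
      B (u (x + 2 • h) - u (x + h)) (v (x + 2 • h) - v (x + h)) +
      B (u x - u (x + h)) (v x - v (x + h)) := by
      simp only [map_sub, map_add, map_nsmul, _root_.sub_apply,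
        _root_.add_apply, _root_.smul_apply]
      abel
    have e3 : x + 2 • h - (x + h) = h := by rw [two_nsmul]; abel
    have e4 : x - (x + h) = -h := by abel
    have u1 := hu.hol _ h2 _ h1
    have u2 := hu.hol _ h0 _ h1
    have v1 := hv.hol _ h2 _ h1
    have v2 := hv.hol _ h0 _ h1
    rw [e3] at u1 v1
    rw [e4, norm_neg] at u2 v2
    have er : ‖h‖ ^ (σ / 2) * ‖h‖ ^ (σ / 2) = ‖h‖ ^ σ := by
      rw [← Real.rpow_add' (norm_nonneg _) (by linarith), add_halves]
    rw [e]
    refine (norm_add_le _ _).trans ((add_le_add ((norm_add_le _ _).trans (add_le_add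
      ((norm_add_le _ _).trans (add_le_add
        (hb _ _ _ _ (hu.sec x h h0 h1 h2) (hv.sup _ h1))
        (hb _ _ _ _ (hu.sup _ h1) (hv.sec x h h0 h1 h2))))
        (hb _ _ _ _ u1 v1))) (hb _ _ _ _ u2 v2)).trans (le_of_eq ?_))
    rw [← er]
    ring

lemma bilin {E : Type} [NormedAddCommGroup E] [NormedSpace ℝ E] {Ω : Set E} (hΩ : IsOpen Ω)
    (hc : Convex ℝ Ω) {D : ℝ} (hD : ∀ x ∈ Ω, ‖x‖ ≤ D) (hD0 : 0 ≤ D) {σ : ℝ} (hσ : 0 < σ)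
    (hσ1 : σ ≤ 1) (k : ℕ) :
    ∃ C : ℝ, 0 ≤ C ∧
      ∀ (F₁ F₂ G : Type) [NormedAddCommGroup F₁] [NormedSpace ℝ F₁]
        [NormedAddCommGroup F₂] [NormedSpace ℝ F₂] [NormedAddCommGroup G] [NormedSpace ℝ G]
        (B : F₁ →L[ℝ] F₂ →L[ℝ] G) (_ : ‖B‖ ≤ 1) (u : E → F₁) (v : E → F₂) (A A' : ℝ),
        Zk k σ Ω u A → Zk k σ Ω v A' →
          Zk k σ Ω (fun x => B (u x) (v x)) (C * (A * A')) := by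
  induction k with
  | zero =>
    refine ⟨4, by norm_num, ?_⟩
    intro F₁ F₂ G _ _ _ _ _ _ B hB u v A A' hu hv
    exact (zk_zero hσ).2 (zb_bilin hσ B hB hu.zb hv.zb)
  | succ k ih =>
    obtain ⟨C, hC, H⟩ := ih
    obtain ⟨C₁, hC₁, H₁⟩ := embed hΩ hc hD hD0 hσ hσ1 hσ hσ1 k (k + 1) (by push_cast; linarith)
    refine ⟨4 + C * C₁ + C * C₁, by positivity, ?_⟩
    intro F₁ F₂ G _ _ _ _ _ _ B hB u v A A' hu hv
    have hu' := (zk_succ hΩ).1 hu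
    have hv' := (zk_succ hΩ).1 hv
    have hA := hu.nonneg
    have hA' := hv.nonneg
    have hAA := mul_nonneg hA hA'
    have hder : ∀ x ∈ Ω, HasFDerivWithinAt (fun x => B (u x) (v x))
        (B.precompR E (u x) (fderivWithin ℝ v Ω x) + B.precompL E (fderivWithin ℝ u Ω x) (v x))
        Ω x := fun x hx =>
      B.hasFDerivWithinAt_of_bilinear (hu'.2.1 x hx).hasFDerivWithinAt
        (hv'.2.1 x hx).hasFDerivWithinAt
    refine (zk_succ hΩ).2 ⟨(zb_bilin hσ B hB hu.zb hv.zb).mono ?_,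
      fun x hx => (hder x hx).differentiableWithinAt, ?_⟩
    · nlinarith [mul_nonneg (mul_nonneg hC hC₁) hAA]
    · have p1 := H _ _ _ (B.precompR E) ((ContinuousLinearMap.norm_precompR_le E B).trans hB)
        u (fderivWithin ℝ v Ω) _ _ (H₁ _ _ _ hu) hv'.2.2
      have p2 := H _ _ _ (B.precompL E) ((ContinuousLinearMap.norm_precompL_le E B).trans hB)
        (fderivWithin ℝ u Ω) v _ _ hu'.2.2 (H₁ _ _ _ hv)
      refine ((p1.add hΩ p2).congr fun x hx =>
        (hder x hx).fderivWithin (hΩ.uniqueDiffOn x hx)).mono ?_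
      nlinarith

/-- One-dimensional step of the improved Hölder estimate. -/
lemma improve_step {E F : Type} [NormedAddCommGroup E] [NormedSpace ℝ E]
    [NormedAddCommGroup F] [NormedSpace ℝ F] {D σ t : ℝ} (hD : 0 < D) (hσ : 0 < σ) (ht : 0 < t)
    (ht1 : t < 1) (hts : t ≤ σ) {f : E → F} {A : ℝ} (hf : Zb σ (ball (0 : E) D) f A)
    {x w : E} (hx : x ∈ ball (0 : E) D) (hw : w ∈ ball (0 : E) D) (j : ℕ) :
    ∀ l : ℝ, 0 < l → l ≤ 1 → 1 ≤ 2 ^ j * l →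
      ‖f (x + l • (w - x)) - f x‖ ≤ (4 + (2 * D) ^ σ / (2 - 2 ^ t)) * A * l ^ t := by
  have hA := hf.nonneg
  have hq : (2 : ℝ) ^ t < 2 := by
    calc (2 : ℝ) ^ t < 2 ^ (1 : ℝ) := Real.rpow_lt_rpow_of_exponent_lt (by norm_num) ht1
      _ = 2 := by simp
  have hq' : 0 < 2 - (2 : ℝ) ^ t := by linarith
  set Q : ℝ := (2 * D) ^ σ / (2 - 2 ^ t) with hQ
  have hQ0 : 0 ≤ Q := by positivity
  have hQe : Q * (2 - 2 ^ t) = (2 * D) ^ σ := by rw [hQ]; field_simp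
  have hmem : ∀ l : ℝ, 0 ≤ l → l ≤ 1 → x + l • (w - x) ∈ ball (0 : E) D := fun l h0 h1 =>
    (convex_ball (0 : E) D).add_smul_sub_mem hx hw ⟨h0, h1⟩
  have big : ∀ l : ℝ, 0 < l → l ≤ 1 → 1 / 2 ≤ l →
      ‖f (x + l • (w - x)) - f x‖ ≤ (4 + Q) * A * l ^ t := by
    intro l h0 h1 h2
    have e1 : l ≤ l ^ t := by
      calc l = l ^ (1 : ℝ) := by simp
        _ ≤ l ^ t := Real.rpow_le_rpow_of_exponent_ge h0 h1 ht1.le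
    have e2 := norm_sub_le (f (x + l • (w - x))) (f x)
    have e3 := hf.sup _ (hmem l h0.le h1)
    have e4 := hf.sup _ hx
    have e5 : 1 / 2 ≤ l ^ t := h2.trans e1
    calc _ ≤ 4 * A * (1 / 2) := by linarith
      _ ≤ (4 + Q) * A * l ^ t := by gcongr; linarith
  induction j with
  | zero =>
    intro l h0 h1 h2
    exact big l h0 h1 (by simp at h2; linarith)
  | succ j ih =>
    intro l h0 h1 h2
    by_cases hl : 1 / 2 ≤ l
    · exact big l h0 h1 hl
    push Not at hl
    have i1 := ih (2 * l) (by linarith) (by linarith) (by rw [pow_succ] at h2; linarith)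
    have i2 := hf.sec x (l • (w - x)) hx (hmem l h0.le h1) (by
      have := hmem (2 * l) (by linarith) (by linarith)
      rwa [two_nsmul, ← add_smul, ← two_mul])
    rw [two_nsmul (l • (w - x)), ← add_smul, ← two_mul, norm_smul, Real.norm_of_nonneg h0.le,
      Real.mul_rpow h0.le (norm_nonneg _)] at i2
    have e1 : (2 : ℝ) • (f (x + l • (w - x)) - f x) = (f (x + (2 * l) • (w - x)) - f x) -
        (f (x + (2 * l) • (w - x)) - 2 • f (x + l • (w - x)) + f x) := by
      rw [two_smul, two_nsmul]; abel
    have e2 : 2 * ‖f (x + l • (w - x)) - f x‖ ≤ ‖f (x + (2 * l) • (w - x)) - f x‖ +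
        ‖f (x + (2 * l) • (w - x)) - 2 • f (x + l • (w - x)) + f x‖ := by
      have := congrArg norm e1
      rw [norm_smul] at this
      norm_num at this
      rw [this]
      exact norm_sub_le _ _
    have hn : ‖w - x‖ ≤ 2 * D := by
      rw [mem_ball_zero_iff] at hx hw
      linarith [norm_sub_le w x]
    have e3 : l ^ σ * ‖w - x‖ ^ σ ≤ l ^ t * (2 * D) ^ σ := by
      have := Real.rpow_le_rpow_of_exponent_ge h0 h1 hts
      gcongr
    have e4 : A * (l ^ σ * ‖w - x‖ ^ σ) ≤ A * (l ^ t * (2 * D) ^ σ) := by gcongr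
    rw [Real.mul_rpow (by norm_num) h0.le] at i1
    have hlt : 0 ≤ l ^ t := by positivity
    have e5 : 0 ≤ A * l ^ t := by positivity
    have e6 : 0 ≤ (A * l ^ t) * (2 - (2 : ℝ) ^ t) := by positivity
    rw [← hQe] at e4
    nlinarith

lemma improve {E F : Type} [NormedAddCommGroup E] [NormedSpace ℝ E]
    [NormedAddCommGroup F] [NormedSpace ℝ F] {D σ t : ℝ} (hD : 0 < D) (hσ : 0 < σ) (ht : 0 < t)
    (ht1 : t < 1) (hts : t ≤ σ) {f : E → F} {A : ℝ} (hf : Zb σ (ball (0 : E) D) f A)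
    {x y : E} (hx : x ∈ ball (0 : E) D) (hy : y ∈ ball (0 : E) D) :
    ‖f x - f y‖ ≤ (2 * (4 + (2 * D) ^ σ / (2 - 2 ^ t)) / (2 * D) ^ t) * A * ‖x - y‖ ^ t := by
  rcases eq_or_ne x y with rfl | hxy
  · simp [Real.zero_rpow ht.ne']
  set r := ‖x - y‖ with hr
  have hr0 : 0 < r := norm_pos_iff.2 (sub_ne_zero.2 hxy)
  have hr1 : r < 2 * D := by
    rw [mem_ball_zero_iff] at hx hy
    linarith [norm_sub_le x y]
  set l := r / (2 * D) with hl
  have hl0 : 0 < l := by positivity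
  have hl1 : l < 1 := by rw [hl, div_lt_one (by positivity)]; exact hr1
  have hlr : r = 2 * D * l := by rw [hl]; field_simp
  obtain ⟨j, hj⟩ : ∃ j : ℕ, 1 ≤ 2 ^ j * l := by
    obtain ⟨j, hj⟩ := pow_unbounded_of_one_lt (1 / l) (by norm_num : (1 : ℝ) < 2)
    refine ⟨j, ?_⟩
    rw [div_lt_iff₀ hl0] at hj
    exact hj.le
  set c := (1 - l) / (2 * l) with hcdef
  have hc0 : 0 ≤ c := by
    have : 0 ≤ 1 - l := by linarith
    positivity
  have hlc : l * c = (1 - l) / 2 := by rw [hcdef]; field_simp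
  have hnorm : c * r < D := by
    have : c * r = D * (1 - l) := by rw [hlr, hcdef]; field_simp
    rw [this]; nlinarith
  have w1 : c • (y - x) ∈ ball (0 : E) D := by
    rw [mem_ball_zero_iff, norm_smul, Real.norm_of_nonneg hc0, norm_sub_rev]; exact hnorm
  have w2 : c • (x - y) ∈ ball (0 : E) D := by
    rw [mem_ball_zero_iff, norm_smul, Real.norm_of_nonneg hc0]; exact hnorm
  have i1 := improve_step hD hσ ht ht1 hts hf hx w1 j l hl0 hl1.le hj
  have i2 := improve_step hD hσ ht ht1 hts hf hy w2 j l hl0 hl1.le hj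
  have z1 : x + l • (c • (y - x) - x) = ((1 - l) / 2) • (x + y) := by
    rw [smul_sub, smul_smul, hlc]; module
  have z2 : y + l • (c • (x - y) - y) = ((1 - l) / 2) • (x + y) := by
    rw [smul_sub, smul_smul, hlc]; module
  rw [z1] at i1
  rw [z2] at i2
  have hrt : r ^ t = (2 * D) ^ t * l ^ t := by
    rw [hlr, Real.mul_rpow (by positivity) hl0.le]
  have hp : 0 < (2 * D) ^ t := by positivity
  rw [hrt]
  have := norm_sub_le_norm_sub_add_norm_sub (f x) (f (((1 - l) / 2) • (x + y))) (f y)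
  rw [norm_sub_rev (f x) (f (((1 - l) / 2) • (x + y)))] at this
  refine this.trans ((add_le_add i1 i2).trans (le_of_eq ?_))
  field_simp
  ring

lemma zb_comp {E E' : Type} [NormedAddCommGroup E] [NormedSpace ℝ E]
    [NormedAddCommGroup E'] [NormedSpace ℝ E'] {D₁ σ δ M : ℝ} (hD : 0 < D₁)
    (hσ : 0 < σ) (hσ1 : σ ≤ 1) (hδ : 0 < δ) (hM : 0 ≤ M) :
    ∃ C : ℝ, 0 ≤ C ∧
      ∀ (F : Type) [NormedAddCommGroup F] [NormedSpace ℝ F] (f : E → F) (g : E' → E)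
        (Ω : Set E') (A : ℝ), Zb σ (ball (0 : E) D₁) f A → MapsTo g Ω (ball (0 : E) D₁) →
        (∀ x ∈ Ω, ∀ y ∈ Ω, ‖g x - g y‖ ≤ M * ‖x - y‖) →
        (∀ x v : E', x ∈ Ω → x + v ∈ Ω → x + 2 • v ∈ Ω →
          ‖g (x + 2 • v) - 2 • g (x + v) + g x‖ ≤ M * ‖v‖ ^ (1 + δ)) →
        Zb σ Ω (f ∘ g) (C * A) := by
  set t := σ / (1 + δ) with htdef
  have ht : 0 < t := by positivity
  have htσ : t * (1 + δ) = σ := by rw [htdef]; field_simp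
  have hts : t ≤ σ := by nlinarith
  have ht1 : t < 1 := by nlinarith
  have hq : (2 : ℝ) ^ t < 2 := by
    calc (2 : ℝ) ^ t < 2 ^ (1 : ℝ) := Real.rpow_lt_rpow_of_exponent_lt (by norm_num) ht1
      _ = 2 := by simp
  have hq' : 0 < 2 - (2 : ℝ) ^ t := by linarith
  set K := 2 * (4 + (2 * D₁) ^ σ / (2 - 2 ^ t)) / (2 * D₁) ^ t with hK
  have hK0 : 0 ≤ K := by positivity
  have p1 : 0 ≤ M ^ (σ / 2) := by positivity
  have p2 : 0 ≤ M ^ σ := by positivity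
  have p3 : 0 ≤ M ^ t := by positivity
  refine ⟨1 + M ^ (σ / 2) + (M ^ σ + 2 * (K * M ^ t)), by positivity, ?_⟩
  intro F _ _ f g Ω A hf hg hl hs
  have hA := hf.nonneg
  refine ⟨by positivity, fun x hx => (hf.sup _ (hg hx)).trans ?_, fun x hx y hy =>
    (hf.hol _ (hg hx) _ (hg hy)).trans ?_, fun x v h0 h1 h2 => ?_⟩
  · have : 0 ≤ (M ^ (σ / 2) + (M ^ σ + 2 * (K * M ^ t))) * A := by positivity
    linarith
  · calc A * ‖g x - g y‖ ^ (σ / 2) ≤ A * (M * ‖x - y‖) ^ (σ / 2) := by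
          gcongr; exact hl x hx y hy
      _ = (M ^ (σ / 2) * A) * ‖x - y‖ ^ (σ / 2) := by
          rw [Real.mul_rpow hM (norm_nonneg _)]; ring
      _ ≤ _ := by
        gcongr
        have : 0 ≤ (M ^ σ + 2 * (K * M ^ t)) := by positivity
        linarith
  · set a := g x
    set b := g (x + v)
    set c := g (x + 2 • v)
    have ha : a ∈ ball (0 : E) D₁ := hg h0
    have hb : b ∈ ball (0 : E) D₁ := hg h1
    have hc : c ∈ ball (0 : E) D₁ := hg h2
    set e := (1 / 2 : ℝ) • (c - a) with he
    have ee : a + 2 • e = c := by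
      rw [he]; module
    have hm : a + e ∈ ball (0 : E) D₁ :=
      (convex_ball (0 : E) D₁).add_smul_sub_mem ha hc ⟨by norm_num, by norm_num⟩
    have hca : ‖c - a‖ ≤ M * (2 * ‖v‖) := by
      have := hl _ h2 _ h0
      have hv2 : ‖x + 2 • v - x‖ = 2 * ‖v‖ := by
        rw [add_sub_cancel_left, two_nsmul, ← two_smul ℝ v, norm_smul, Real.norm_two]
      rwa [hv2] at this
    have hen : ‖e‖ ≤ M * ‖v‖ := by
      rw [he, norm_smul]
      norm_num
      linarith
    have q1 : ‖f c - 2 • f (a + e) + f a‖ ≤ A * (M * ‖v‖) ^ σ := by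
      have := hf.sec a e ha hm (by rw [ee]; exact hc)
      rw [ee] at this
      refine this.trans ?_
      gcongr
    have hmb : ‖(a + e) - b‖ ≤ M * ‖v‖ ^ (1 + δ) := by
      have h3 : (a + e) - b = (1 / 2 : ℝ) • (c - 2 • b + a) := by rw [he]; module
      have h4 := hs x v h0 h1 h2
      rw [h3, norm_smul]
      have := norm_nonneg (c - 2 • b + a)
      norm_num
      linarith
    have q2 : ‖f (a + e) - f b‖ ≤ K * A * (M * ‖v‖ ^ (1 + δ)) ^ t := by
      refine (improve hD hσ ht ht1 hts hf hm hb).trans ?_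
      gcongr
    have h5 : (M * ‖v‖ ^ (1 + δ)) ^ t = M ^ t * ‖v‖ ^ σ := by
      rw [Real.mul_rpow hM (by positivity), ← Real.rpow_mul (norm_nonneg _), mul_comm (1 + δ), htσ]
    rw [h5] at q2
    rw [Real.mul_rpow hM (norm_nonneg _)] at q1
    have h6 : f c - 2 • f b + f a = (f c - 2 • f (a + e) + f a) + (2 : ℝ) • (f (a + e) - f b) := by
      module
    show ‖f c - 2 • f b + f a‖ ≤ _
    rw [h6]
    refine (norm_add_le _ _).trans ?_
    rw [norm_smul, Real.norm_two]
    have h7 : 0 ≤ (1 + M ^ (σ / 2)) * A * ‖v‖ ^ σ := by positivity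
    nlinarith

lemma comp_main {E E' : Type} [NormedAddCommGroup E] [NormedSpace ℝ E]
    [NormedAddCommGroup E'] [NormedSpace ℝ E'] {D₁ D₂ σ σ' M : ℝ} (hD : 0 < D₁) (hD₂ : 0 < D₂)
    (hσ : 0 < σ) (hσ1 : σ ≤ 1) (hσ' : 0 < σ') (hσ1' : σ' ≤ 1) (hM : 0 ≤ M) (k' : ℕ) (k : ℕ) :
    (k : ℝ) + σ ≤ (k' + 1 : ℕ) + σ' → ∃ C : ℝ, 0 ≤ C ∧
      ∀ (F : Type) [NormedAddCommGroup F] [NormedSpace ℝ F] (f : E → F) (g : E' → E)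
        (A : ℝ), Zk k σ (ball (0 : E) D₁) f A → Zk (k' + 1) σ' (ball (0 : E') D₂) g M →
        MapsTo g (ball (0 : E') D₂) (ball (0 : E) D₁) →
        Zk k σ (ball (0 : E') D₂) (f ∘ g) (C * A) := by
  have hΩ : IsOpen (ball (0 : E') D₂) := isOpen_ball
  have hΩ₁ : IsOpen (ball (0 : E) D₁) := isOpen_ball
  have hc : Convex ℝ (ball (0 : E') D₂) := convex_ball _ _
  have hbd : ∀ x ∈ ball (0 : E') D₂, ‖x‖ ≤ D₂ := fun x hx => (mem_ball_zero_iff.1 hx).le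
  obtain ⟨C₀, hC₀, H₀⟩ := zb_comp (E := E) (E' := E') hD hσ hσ1 (half_pos hσ') hM
  have base : ∀ (F : Type) [NormedAddCommGroup F] [NormedSpace ℝ F] (f : E → F) (g : E' → E)
        (A : ℝ), Zb σ (ball (0 : E) D₁) f A → Zk (k' + 1) σ' (ball (0 : E') D₂) g M →
        MapsTo g (ball (0 : E') D₂) (ball (0 : E) D₁) →
        Zb σ (ball (0 : E') D₂) (f ∘ g) (C₀ * A) := by
    intro F _ _ f g A hf hg hm
    have hg' := (zk_succ hΩ).1 hg
    exact H₀ F f g _ A hf hm (lip_of_deriv hc hg'.2.1 hg'.2.2.zb)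
      (sec_of_deriv hΩ hc hg'.2.1 hg'.2.2.zb hσ')
  induction k with
  | zero =>
    intro _
    exact ⟨C₀, hC₀, fun F _ _ f g A hf hg hm => (zk_zero hσ).2 (base F f g A hf.zb hg hm)⟩
  | succ k ih =>
    intro hk
    push_cast at hk ih
    obtain ⟨C, hC, H⟩ := ih (by linarith)
    obtain ⟨C₁, hC₁, H₁⟩ := embed hΩ hc hbd hD₂.le hσ hσ1 hσ' hσ1' k k' (by linarith)
    obtain ⟨C₂, hC₂, H₂⟩ := bilin hΩ hc hbd hD₂.le hσ hσ1 k
    refine ⟨C₀ + C₂ * (C * (C₁ * M)), by positivity, ?_⟩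
    intro F _ _ f g A hf hg hm
    have hA := hf.nonneg
    have hf' := (zk_succ hΩ₁).1 hf
    have hg' := (zk_succ hΩ).1 hg
    have hder : ∀ x ∈ ball (0 : E') D₂, HasFDerivWithinAt (f ∘ g)
        ((fderivWithin ℝ f (ball (0 : E) D₁) (g x)).comp
          (fderivWithin ℝ g (ball (0 : E') D₂) x)) (ball (0 : E') D₂) x := fun x hx =>
      (hf'.2.1 (g x) (hm hx)).hasFDerivWithinAt.comp x (hg'.2.1 x hx).hasFDerivWithinAt hm
    refine (zk_succ hΩ).2 ⟨(base F f g A hf.zb hg hm).mono ?_,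
      fun x hx => (hder x hx).differentiableWithinAt, ?_⟩
    · have : 0 ≤ C₂ * (C * (C₁ * M)) * A := by positivity
      linarith
    · have p := H₂ _ _ _ (ContinuousLinearMap.compL ℝ E' E F)
        (ContinuousLinearMap.norm_compL_le ℝ E' E F) _ _ _ _
        (H _ _ g A hf'.2.2 hg hm) (H₁ _ _ _ hg'.2.2)
      refine (p.congr fun x hx => ?_).mono ?_
      · exact (hder x hx).fderivWithin (hΩ.uniqueDiffOn x hx)
      · have : 0 ≤ C₀ * A := by positivity
        nlinarith

section
variable {E F : Type} [NormedAddCommGroup E] [NormedSpace ℝ E]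
  [NormedAddCommGroup F] [NormedSpace ℝ F]

lemma zb_of_zygBase {σ : ℝ} (hσ : 0 < σ) {Ω : Set E} {f : E → F} {A : ℝ} (hA : 0 ≤ A)
    (h : zygBase σ Ω f ≤ ENNReal.ofReal A) : Zb σ Ω f A := by
  unfold zygBase holderNorm at h
  have h1 := (le_self_add.trans le_self_add).trans h
  have h2 := (le_add_self.trans le_self_add).trans h
  have h3 := le_add_self.trans h
  unfold secondDiff at h3
  simp only [iSup_le_iff] at h1 h2 h3
  refine ⟨hA, fun x hx => (ENNReal.ofReal_le_ofReal_iff hA).1 (h1 x hx), fun x hx y hy => ?_,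
    fun x v m0 m1 m2 => ?_⟩
  · rcases eq_or_ne x y with rfl | hxy
    · simp [Real.zero_rpow (half_pos hσ).ne']
    have := (ENNReal.ofReal_le_ofReal_iff hA).1 (h2 x hx y hy hxy)
    have hp : 0 < ‖x - y‖ := norm_pos_iff.2 (sub_ne_zero.2 hxy)
    rwa [div_le_iff₀ (by positivity)] at this
  · rcases eq_or_ne v 0 with rfl | hv
    · have : f x - 2 • f x + f x = 0 := by rw [two_nsmul]; abel
      simp [Real.zero_rpow hσ.ne', this]
    have := (ENNReal.ofReal_le_ofReal_iff hA).1 (h3 x v hv m0 m1 m2)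
    have hp : 0 < ‖v‖ := norm_pos_iff.2 hv
    rwa [div_le_iff₀ (by positivity)] at this

lemma zygBase_of_zb {σ : ℝ} {Ω : Set E} {f : E → F} {A : ℝ}
    (h : Zb σ Ω f A) : zygBase σ Ω f ≤ ENNReal.ofReal (3 * A) := by
  have hA := h.nonneg
  have e : ENNReal.ofReal (3 * A) = ENNReal.ofReal A + ENNReal.ofReal A + ENNReal.ofReal A := by
    rw [← ENNReal.ofReal_add hA hA, ← ENNReal.ofReal_add (by positivity) hA]; congr 1; ring
  rw [e]
  unfold zygBase holderNorm secondDiff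
  refine add_le_add (add_le_add ?_ ?_) ?_
  · simp only [iSup_le_iff]
    exact fun x hx => ENNReal.ofReal_le_ofReal (h.sup x hx)
  · simp only [iSup_le_iff]
    intro x hx y hy hxy
    have hp : 0 < ‖x - y‖ := norm_pos_iff.2 (sub_ne_zero.2 hxy)
    refine ENNReal.ofReal_le_ofReal ?_
    rw [div_le_iff₀ (by positivity)]
    exact h.hol x hx y hy
  · simp only [iSup_le_iff]
    intro x v hv m0 m1 m2
    have hp : 0 < ‖v‖ := norm_pos_iff.2 hv
    refine ENNReal.ofReal_le_ofReal ?_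
    rw [div_le_iff₀ (by positivity)]
    exact h.sec x v m0 m1 m2

lemma ceil_facts {s : ℝ} (hs : 0 < s) :
    0 < s - ((⌈s⌉₊ - 1 : ℕ) : ℝ) ∧ s - ((⌈s⌉₊ - 1 : ℕ) : ℝ) ≤ 1 ∧ ⌈s⌉₊ = (⌈s⌉₊ - 1) + 1 := by
  have h1 : 0 < ⌈s⌉₊ := Nat.ceil_pos.2 hs
  have h2 : ⌈s⌉₊ = (⌈s⌉₊ - 1) + 1 := by omega
  have h3 : ((⌈s⌉₊ : ℕ) : ℝ) = ((⌈s⌉₊ - 1 : ℕ) : ℝ) + 1 := by exact_mod_cast h2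
  have h4 := Nat.le_ceil s
  have h5 := Nat.ceil_lt_add_one hs.le
  exact ⟨by linarith, by linarith, h2⟩

lemma zk_of_mem {s : ℝ} (hs : 0 < s) {Ω : Set E} {f : E → F} {A : ℝ} (hA : 0 ≤ A)
    (hf : MemZyg s Ω f) (h : zygNorm s Ω f ≤ ENNReal.ofReal A) :
    Zk (⌈s⌉₊ - 1) (s - ((⌈s⌉₊ - 1 : ℕ) : ℝ)) Ω f A := by
  obtain ⟨h1, h2, h3⟩ := ceil_facts hs
  refine ⟨hf.1, fun i hi => zb_of_zygBase h1 hA (le_trans ?_ h)⟩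
  unfold zygNorm
  exact Finset.single_le_sum (f := fun i => zygBase (s - ((⌈s⌉₊ - 1 : ℕ) : ℝ)) Ω
    (iteratedFDerivWithin ℝ i f Ω)) (fun _ _ => zero_le) (Finset.mem_range.2 (by omega))

lemma norm_of_zk {s : ℝ} (hs : 0 < s) {Ω : Set E} {f : E → F} {A : ℝ}
    (h : Zk (⌈s⌉₊ - 1) (s - ((⌈s⌉₊ - 1 : ℕ) : ℝ)) Ω f A) :
    zygNorm s Ω f ≤ ENNReal.ofReal (⌈s⌉₊ * (3 * A)) := by
  obtain ⟨h1, h2, h3⟩ := ceil_facts hs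
  unfold zygNorm
  have hA := h.nonneg
  refine (Finset.sum_le_sum (g := fun _ => ENNReal.ofReal (3 * A)) fun i hi =>
    zygBase_of_zb (h.2 i ?_)).trans ?_
  · have := Finset.mem_range.1 hi
    omega
  · rw [Finset.sum_const, Finset.card_range, nsmul_eq_mul,
      ENNReal.ofReal_mul (p := (⌈s⌉₊ : ℝ)) (by positivity), ENNReal.ofReal_natCast]

end

end ZygAux

/-- Composition in Zygmund spaces. If `f ∈ 𝒞^{s₁}(B^n(D₁))` and
`g ∈ 𝒞^{s₂}(B^m(D₂); ℝ^n)` with `g(B^m(D₂)) ⊆ B^n(D₁)`, `0 < s₁ ≤ s₂`, `s₂ > 1`, then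
`f ∘ g ∈ 𝒞^{s₁}(B^m(D₂))` with `‖f∘g‖ ≤ C‖f‖`, `C` depending only on `s₁, s₂, D₁, D₂, m, n`,
and an upper bound `Mg` for `‖g‖_{𝒞^{s₂}}`. -/
theorem zygmund_composition (n m : ℕ) (s₁ s₂ D₁ D₂ Mg : ℝ)
    (hs₁ : 0 < s₁) (hs : s₁ ≤ s₂) (hs₂ : 1 < s₂) (hD₁ : 0 < D₁) (hD₂ : 0 < D₂) :
    ∃ C : ℝ≥0∞, C < ⊤ ∧
      ∀ (f : EuclideanSpace ℝ (Fin n) → ℝ)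
        (g : EuclideanSpace ℝ (Fin m) → EuclideanSpace ℝ (Fin n)),
        MemZyg s₁ (ball (0 : EuclideanSpace ℝ (Fin n)) D₁) f →
        MemZyg s₂ (ball (0 : EuclideanSpace ℝ (Fin m)) D₂) g →
        zygNorm s₂ (ball (0 : EuclideanSpace ℝ (Fin m)) D₂) g ≤ ENNReal.ofReal Mg →
        MapsTo g (ball (0 : EuclideanSpace ℝ (Fin m)) D₂)
          (ball (0 : EuclideanSpace ℝ (Fin n)) D₁) →
          MemZyg s₁ (ball (0 : EuclideanSpace ℝ (Fin m)) D₂) (f ∘ g) ∧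
            zygNorm s₁ (ball (0 : EuclideanSpace ℝ (Fin m)) D₂) (f ∘ g) ≤
              C * zygNorm s₁ (ball (0 : EuclideanSpace ℝ (Fin n)) D₁) f := by
  obtain ⟨a1, a2, a3⟩ := ZygAux.ceil_facts hs₁
  have hs₂0 : 0 < s₂ := by linarith
  obtain ⟨b1, b2, b3⟩ := ZygAux.ceil_facts hs₂0
  have hk2 : ∃ k' : ℕ, ⌈s₂⌉₊ - 1 = k' + 1 := by
    have : 1 < ⌈s₂⌉₊ := Nat.lt_ceil.2 (by simpa using hs₂)
    exact ⟨⌈s₂⌉₊ - 2, by omega⟩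
  obtain ⟨k', hk'⟩ := hk2
  obtain ⟨C, hC, H⟩ := ZygAux.comp_main (E := EuclideanSpace ℝ (Fin n))
    (E' := EuclideanSpace ℝ (Fin m)) hD₁ hD₂ a1 a2 b1 b2 (le_max_right Mg 0) k'
    (⌈s₁⌉₊ - 1) (by rw [← hk']; linarith)
  refine ⟨ENNReal.ofReal (⌈s₁⌉₊ * (3 * C)), ENNReal.ofReal_lt_top, ?_⟩
  intro f g hf hg hgM hm
  have zf := ZygAux.zk_of_mem hs₁ (A := (zygNorm s₁ (ball 0 D₁) f).toReal)
    ENNReal.toReal_nonneg hf (ENNReal.ofReal_toReal hf.2).ge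
  have zg := ZygAux.zk_of_mem hs₂0 (A := max Mg 0) (le_max_right _ _) hg
    (hgM.trans (ENNReal.ofReal_le_ofReal (le_max_left _ _)))
  rw [← hk'] at H
  have z := H _ f g _ zf zg hm
  have hn := ZygAux.norm_of_zk hs₁ z
  refine ⟨⟨z.1, ne_top_of_le_ne_top ENNReal.ofReal_ne_top hn⟩, hn.trans (le_of_eq ?_)⟩
  conv_rhs => rw [← ENNReal.ofReal_toReal hf.2]
  rw [← ENNReal.ofReal_mul (by positivity)]
  congr 1
  ring
end

section
/- Fix s > 1 and D₁, D₂ > 0. Suppose H ∈ 𝒞^s(B^n(D₁); ℝ^n), B^n(D₂) ⊆ H(B^n(D₁)), H : B^n(D₁) → H(B^n(D₁)) is a homeomorphism, and inf_{t ∈ B^n(D₁)} |det dH(t)| ≥ c₀ > 0. Then H^{−1} ∈ 𝒞^s(B^n(D₂); ℝ^n) with ‖H^{−1}‖_{𝒞^s(B^n(D₂); ℝ^n)} ≤ C, where C depends only on n, s, D₁, D₂, c₀, and an upper bound for ‖H‖_{𝒞^s(B^n(D₁); ℝ^n)}. -/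
open Set Metric ENNReal

set_option linter.unusedSectionVars false

section Aux

variable {E : Type} [NormedAddCommGroup E] [NormedSpace ℝ E]
variable {F : Type} [NormedAddCommGroup F] [NormedSpace ℝ F]
variable {G : Type} [NormedAddCommGroup G] [NormedSpace ℝ G]
variable {W : Type} [NormedAddCommGroup W] [NormedSpace ℝ W]

/-- Pointwise version of a bound on `zygBase`. -/
structure ZB (σ K : ℝ) (Ω : Set E) (f : E → F) : Prop where
  nn : 0 ≤ K
  bd : ∀ x ∈ Ω, ‖f x‖ ≤ K
  hol : ∀ x ∈ Ω, ∀ y ∈ Ω, ‖f x - f y‖ ≤ K * ‖x - y‖ ^ (σ / 2)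
  sd : ∀ x h : E, x ∈ Ω → x + h ∈ Ω → x + 2 • h ∈ Ω →
    ‖f (x + 2 • h) - 2 • f (x + h) + f x‖ ≤ K * ‖h‖ ^ σ

lemma ZB.mono {σ K K' : ℝ} {Ω : Set E} {f : E → F} (h : ZB σ K Ω f) (hK : K ≤ K') :
    ZB σ K' Ω f where
  nn := h.nn.trans hK
  bd x hx := (h.bd x hx).trans hK
  hol x hx y hy := (h.hol x hx y hy).trans (by gcongr)
  sd x k h1 h2 h3 := (h.sd x k h1 h2 h3).trans (by gcongr)

lemma ZB.congr {σ K : ℝ} {Ω : Set E} {f g : E → F} (h : ZB σ K Ω f) (hfg : EqOn g f Ω) :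
    ZB σ K Ω g where
  nn := h.nn
  bd x hx := by rw [hfg hx]; exact h.bd x hx
  hol x hx y hy := by rw [hfg hx, hfg hy]; exact h.hol x hx y hy
  sd x k h1 h2 h3 := by rw [hfg h1, hfg h2, hfg h3]; exact h.sd x k h1 h2 h3

lemma ZB.hol_right {σ K : ℝ} {Ω : Set E} {f : E → F} (hf : ZB σ K Ω f) {x h : E}
    (h2 : x + h ∈ Ω) (h3 : x + 2 • h ∈ Ω) :
    ‖f (x + 2 • h) - f (x + h)‖ ≤ K * ‖h‖ ^ (σ / 2) := by
  have := hf.hol _ h3 _ h2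
  rwa [show x + 2 • h - (x + h) = h by rw [two_smul]; abel] at this

lemma ZB.hol_left {σ K : ℝ} {Ω : Set E} {f : E → F} (hf : ZB σ K Ω f) {x h : E}
    (h1 : x ∈ Ω) (h2 : x + h ∈ Ω) :
    ‖f x - f (x + h)‖ ≤ K * ‖h‖ ^ (σ / 2) := by
  have := hf.hol _ h1 _ h2
  rwa [show x - (x + h) = -h by abel, norm_neg] at this

lemma rpow_half_mul {σ : ℝ} (hσ : 0 < σ) (h : E) :
    ‖h‖ ^ (σ / 2) * ‖h‖ ^ (σ / 2) = ‖h‖ ^ σ := by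
  rw [← Real.rpow_add_of_nonneg (norm_nonneg _) (by positivity) (by positivity)]
  congr 1; ring

lemma ZB.add {σ K L : ℝ} {Ω : Set E} {f g : E → F} (hf : ZB σ K Ω f) (hg : ZB σ L Ω g) :
    ZB σ (K + L) Ω (fun x => f x + g x) where
  nn := add_nonneg hf.nn hg.nn
  bd x hx := (norm_add_le _ _).trans (add_le_add (hf.bd x hx) (hg.bd x hx))
  hol x hx y hy := by
    rw [add_sub_add_comm, add_mul]
    exact (norm_add_le _ _).trans (add_le_add (hf.hol x hx y hy) (hg.hol x hx y hy))
  sd x k h1 h2 h3 := by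
    rw [add_mul]
    refine le_trans (le_of_eq ?_) ((norm_add_le _ _).trans
      (add_le_add (hf.sd x k h1 h2 h3) (hg.sd x k h1 h2 h3)))
    congr 1
    simp only [two_smul]; abel

lemma ZB.neg {σ K : ℝ} {Ω : Set E} {f : E → F} (hf : ZB σ K Ω f) :
    ZB σ K Ω (fun x => - f x) where
  nn := hf.nn
  bd x hx := by rw [norm_neg]; exact hf.bd x hx
  hol x hx y hy := by
    rw [show -f x - -f y = -(f x - f y) by abel, norm_neg]
    exact hf.hol x hx y hy
  sd x k h1 h2 h3 := by
    rw [show -f (x + 2 • k) - 2 • -f (x + k) + -f x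
      = -(f (x + 2 • k) - 2 • f (x + k) + f x) by rw [smul_neg]; abel, norm_neg]
    exact hf.sd x k h1 h2 h3

lemma ZB.bilin {σ K L : ℝ} (hσ : 0 < σ) {Ω : Set E} {f : E → F} {g : E → G}
    (B : F →L[ℝ] G →L[ℝ] W)
    (hf : ZB σ K Ω f) (hg : ZB σ L Ω g) :
    ZB σ (4 * (‖B‖ * K * L)) Ω (fun x => B (f x) (g x)) := by
  have hK := hf.nn
  have hL := hg.nn
  have hB : ∀ u v (a b : ℝ), ‖u‖ ≤ a → ‖v‖ ≤ b → ‖B u v‖ ≤ ‖B‖ * a * b := fun u v a b ha hb =>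
    (B.le_opNorm₂ u v).trans (by
      have : 0 ≤ a := (norm_nonneg _).trans ha
      gcongr)
  refine ⟨by positivity, ?_, ?_, ?_⟩
  · intro x hx
    have := hB _ _ _ _ (hf.bd x hx) (hg.bd x hx)
    have : 0 ≤ ‖B‖ * K * L := by positivity
    linarith
  · intro x hx y hy
    have e : B (f x) (g x) - B (f y) (g y) = B (f x - f y) (g x) + B (f y) (g x - g y) := by
      simp
    rw [e]
    have h1 := hB _ _ _ _ (hf.hol x hx y hy) (hg.bd x hx)
    have h2 := hB _ _ _ _ (hf.bd y hy) (hg.hol x hx y hy)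
    have h3 := norm_add_le (B (f x - f y) (g x)) (B (f y) (g x - g y))
    have : 0 ≤ ‖B‖ * K * L * ‖x - y‖ ^ (σ / 2) := by positivity
    nlinarith
  · intro x h hx1 hx2 hx3
    have e : B (f (x + 2 • h)) (g (x + 2 • h)) - 2 • B (f (x + h)) (g (x + h)) + B (f x) (g x)
      = B (f (x + 2 • h) - 2 • f (x + h) + f x) (g (x + h))
        + B (f (x + h)) (g (x + 2 • h) - 2 • g (x + h) + g x)
        + B (f (x + 2 • h) - f (x + h)) (g (x + 2 • h) - g (x + h))
        + B (f x - f (x + h)) (g x - g (x + h)) := by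
      simp only [two_smul, map_add, map_sub, add_apply,
        sub_apply]
      abel
    rw [e]
    have h1 := hB _ _ _ _ (hf.sd x h hx1 hx2 hx3) (hg.bd _ hx2)
    have h2 := hB _ _ _ _ (hf.bd _ hx2) (hg.sd x h hx1 hx2 hx3)
    have h3 := hB _ _ _ _ (hf.hol_right hx2 hx3) (hg.hol_right hx2 hx3)
    have h4 := hB _ _ _ _ (hf.hol_left hx1 hx2) (hg.hol_left hx1 hx2)
    have e3 : ‖B‖ * (K * ‖h‖ ^ (σ / 2)) * (L * ‖h‖ ^ (σ / 2)) = ‖B‖ * K * L * ‖h‖ ^ σ := by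
      rw [← rpow_half_mul hσ h]; ring
    rw [e3] at h3 h4
    refine (norm_add₄_le).trans ?_
    linarith

lemma ZB.inv {R : Type} [NormedRing R] [NormedAlgebra ℝ R] {σ K c : ℝ} (hσ : 0 < σ)
    {Ω : Set E} {A I : E → R}
    (hA : ZB σ K Ω A) (hc : 0 ≤ c) (hI : ∀ x ∈ Ω, ‖I x‖ ≤ c)
    (h1 : ∀ x ∈ Ω, A x * I x = 1) (h2 : ∀ x ∈ Ω, I x * A x = 1) :
    ZB σ (c + c * K * c + (c * K * c + 2 * (c * K * c * K * c))) Ω I := by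
  have hK := hA.nn
  have hm3 : ∀ (u v w : R) (a b d : ℝ), ‖u‖ ≤ a → ‖v‖ ≤ b → ‖w‖ ≤ d →
      ‖u * v * w‖ ≤ a * b * d := by
    intro u v w a b d hu hv hw
    have ha := (norm_nonneg _).trans hu
    have hb := (norm_nonneg _).trans hv
    exact (norm_mul_le _ _).trans (mul_le_mul ((norm_mul_le _ _).trans
      (mul_le_mul hu hv (norm_nonneg _) ha)) hw (norm_nonneg _) (mul_nonneg ha hb))
  have key : ∀ x ∈ Ω, ∀ y ∈ Ω, I x - I y = - (I x * (A x - A y) * I y) := by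
    intro x hx y hy
    rw [mul_sub, sub_mul, h2 x hx, mul_assoc (I x), h1 y hy]
    simp
  have p1 : 0 ≤ c * K * c := by positivity
  have p2 : 0 ≤ c * K * c * K * c := by positivity
  have hol : ∀ x ∈ Ω, ∀ y ∈ Ω, ‖I x - I y‖ ≤ c * K * c * ‖x - y‖ ^ (σ / 2) := by
    intro x hx y hy
    rw [key x hx y hy, norm_neg]
    refine (hm3 _ _ _ _ _ _ (hI x hx) (hA.hol x hx y hy) (hI y hy)).trans (le_of_eq (by ring))
  refine ⟨by positivity, ?_, ?_, ?_⟩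
  · intro x hx
    have := hI x hx
    linarith
  · intro x hx y hy
    refine (hol x hx y hy).trans ?_
    gcongr
    linarith
  · intro x h hx1 hx2 hx3
    have e : I (x + 2 • h) - 2 • I (x + h) + I x =
        -((I (x + 2 • h) - I (x + h)) * (A (x + 2 • h) - A (x + h)) * I (x + h))
        + -((I x - I (x + h)) * (A x - A (x + h)) * I (x + h))
        + -(I (x + h) * (A (x + 2 • h) - 2 • A (x + h) + A x) * I (x + h)) := by
      have e1 := key _ hx3 _ hx2
      have e2 := key _ hx1 _ hx2
      have : I (x + 2 • h) - 2 • I (x + h) + I x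
        = (I (x + 2 • h) - I (x + h)) + (I x - I (x + h)) := by rw [two_smul]; abel
      rw [this]
      nth_rewrite 1 [e1]
      nth_rewrite 1 [e2]
      noncomm_ring
    have r1 : ‖I (x + 2 • h) - I (x + h)‖ ≤ c * K * c * ‖h‖ ^ (σ / 2) := by
      have := hol _ hx3 _ hx2
      rwa [show x + 2 • h - (x + h) = h by rw [two_smul]; abel] at this
    have r2 : ‖I x - I (x + h)‖ ≤ c * K * c * ‖h‖ ^ (σ / 2) := by
      have := hol _ hx1 _ hx2
      rwa [show x - (x + h) = -h by abel, norm_neg] at this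
    have s1 := hm3 _ _ _ _ _ _ r1 (hA.hol_right hx2 hx3) (hI _ hx2)
    have s2 := hm3 _ _ _ _ _ _ r2 (hA.hol_left hx1 hx2) (hI _ hx2)
    have s3 := hm3 _ _ _ _ _ _ (hI _ hx2) (hA.sd x h hx1 hx2 hx3) (hI _ hx2)
    have e3 : c * K * c * ‖h‖ ^ (σ / 2) * (K * ‖h‖ ^ (σ / 2)) * c
        = c * K * c * K * c * ‖h‖ ^ σ := by
      rw [← rpow_half_mul hσ h]; ring
    rw [e3] at s1 s2
    rw [e]
    refine norm_add₃_le.trans ?_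
    rw [norm_neg, norm_neg, norm_neg]
    have p3 : 0 ≤ ‖h‖ ^ σ := by positivity
    have p4 := mul_nonneg p1 p3
    have p5 := mul_nonneg hc p3
    linarith
lemma ZB.ray {σ α D K : ℝ} (hD : 0 < D) (hα0 : 0 < α) (hα1 : α < 1) (hασ : α ≤ σ)
    {f : E → F} (hf : ZB σ K (ball (0 : E) D) f)
    {x u : E} (hx : x ∈ ball (0 : E) D) (hu : u ∈ ball (0 : E) D) (n : ℕ) :
    ∀ τ : ℝ, 0 < τ → τ ≤ 1 → 1 < 2 ^ (n + 1) * τ →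
      ‖f (x + τ • (u - x)) - f x‖ ≤ (4 * K + K * (2 * D) ^ σ / (2 - 2 ^ α)) * τ ^ α := by
  have hK := hf.nn
  have hmem : ∀ τ : ℝ, 0 < τ → τ ≤ 1 → x + τ • (u - x) ∈ ball (0 : E) D := by
    intro τ h0 h1
    exact (convex_ball (0 : E) D).add_smul_sub_mem hx hu ⟨h0.le, h1⟩
  have h2α : (2 : ℝ) ^ α < 2 := by
    calc (2 : ℝ) ^ α < 2 ^ (1 : ℝ) := Real.rpow_lt_rpow_of_exponent_lt (by norm_num) hα1
      _ = 2 := Real.rpow_one 2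
  have hq : 0 ≤ K * (2 * D) ^ σ / (2 - 2 ^ α) := by
    apply div_nonneg (by positivity); linarith
  have big : ∀ τ : ℝ, 0 < τ → τ ≤ 1 → 1 < 2 * τ →
      ‖f (x + τ • (u - x)) - f x‖ ≤ (4 * K + K * (2 * D) ^ σ / (2 - 2 ^ α)) * τ ^ α := by
    intro τ h0 h1 h2
    have h3 : τ ≤ τ ^ α := by
      calc τ = τ ^ (1 : ℝ) := (Real.rpow_one τ).symm
        _ ≤ τ ^ α := Real.rpow_le_rpow_of_exponent_ge h0 h1 hα1.le
    have h4 := norm_sub_le (f (x + τ • (u - x))) (f x)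
    have h5 := hf.bd _ (hmem τ h0 h1)
    have h6 := hf.bd _ hx
    have h7 : 1 / 2 ≤ τ ^ α := by linarith
    have h8 := mul_nonneg hq (h0.le.trans h3)
    nlinarith
  induction n with
  | zero =>
    intro τ h0 h1 h2
    exact big τ h0 h1 (by simpa using h2)
  | succ n ih =>
    intro τ h0 h1 h2
    by_cases h3 : 1 < 2 * τ
    · exact big τ h0 h1 h3
    push Not at h3
    have hi := ih (2 * τ) (by linarith) h3 (by rw [pow_succ] at h2; linarith)
    have e2 : x + (2 * τ) • (u - x) = x + 2 • (τ • (u - x)) := by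
      rw [mul_smul, ofNat_smul_eq_nsmul]
    have hs := hf.sd x (τ • (u - x)) hx (hmem τ h0 h1)
      (by rw [← e2]; exact hmem _ (by linarith) h3)
    rw [← e2] at hs
    have e : (2 : ℝ) • (f (x + τ • (u - x)) - f x) = (f (x + (2 * τ) • (u - x)) - f x)
      - (f (x + (2 * τ) • (u - x)) - 2 • f (x + τ • (u - x)) + f x) := by
      simp only [two_smul]; abel
    have hn := congrArg norm e
    rw [norm_smul, Real.norm_of_nonneg (by norm_num : (0 : ℝ) ≤ 2)] at hn
    have ht := norm_sub_le (f (x + (2 * τ) • (u - x)) - f x)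
      (f (x + (2 * τ) • (u - x)) - 2 • f (x + τ • (u - x)) + f x)
    rw [← hn] at ht
    have hnorm : ‖τ • (u - x)‖ ^ σ ≤ (2 * D) ^ σ * τ ^ α := by
      have h5 : ‖τ • (u - x)‖ ≤ 2 * D * τ := by
        rw [norm_smul, Real.norm_of_nonneg h0.le, mul_comm]
        have := norm_sub_le u x
        rw [mem_ball_zero_iff] at hx hu
        gcongr
        linarith
      calc ‖τ • (u - x)‖ ^ σ ≤ (2 * D * τ) ^ σ :=
            Real.rpow_le_rpow (norm_nonneg _) h5 (by linarith)
        _ = (2 * D) ^ σ * τ ^ σ := Real.mul_rpow (by positivity) h0.le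
        _ ≤ (2 * D) ^ σ * τ ^ α := by
            gcongr ?_ * ?_
            exact Real.rpow_le_rpow_of_exponent_ge h0 h1 hασ
    rw [Real.mul_rpow (by norm_num) h0.le] at hi
    have hq' : K * (2 * D) ^ σ / (2 - 2 ^ α) * (2 - 2 ^ α) = K * (2 * D) ^ σ :=
      div_mul_cancel₀ _ (by linarith)
    have p : 0 < τ ^ α := Real.rpow_pos_of_pos h0 _
    have h9 : K * ‖τ • (u - x)‖ ^ σ ≤ K * ((2 * D) ^ σ * τ ^ α) := by gcongr
    have h10 : 0 ≤ 4 * K * (2 - 2 ^ α) * τ ^ α := by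
      have : 0 ≤ 2 - (2 : ℝ) ^ α := by linarith
      positivity
    set Q := K * (2 * D) ^ σ / (2 - 2 ^ α)
    have h11 : K * ((2 * D) ^ σ * τ ^ α) = Q * (2 - 2 ^ α) * τ ^ α := by rw [hq']; ring
    have h12 : (4 * K + Q) * (2 ^ α * τ ^ α) + Q * (2 - 2 ^ α) * τ ^ α
        + 4 * K * (2 - 2 ^ α) * τ ^ α = 2 * ((4 * K + Q) * τ ^ α) := by ring
    linarith

lemma ZB.hol_improve {σ α D K : ℝ} (hD : 0 < D) (hα0 : 0 < α) (hα1 : α < 1) (hασ : α ≤ σ)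
    {f : E → F} (hf : ZB σ K (ball (0 : E) D) f)
    {x y : E} (hx : x ∈ ball (0 : E) D) (hy : y ∈ ball (0 : E) D) :
    ‖f x - f y‖ ≤ (2 * (4 * K + K * (2 * D) ^ σ / (2 - 2 ^ α)) * (2 / D) ^ α) * ‖x - y‖ ^ α := by
  have hK := hf.nn
  have h2α : (2 : ℝ) ^ α < 2 := by
    calc (2 : ℝ) ^ α < 2 ^ (1 : ℝ) := Real.rpow_lt_rpow_of_exponent_lt (by norm_num) hα1
      _ = 2 := Real.rpow_one 2
  have hq : 0 ≤ K * (2 * D) ^ σ / (2 - 2 ^ α) := by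
    apply div_nonneg (by positivity); linarith
  by_cases hxy : x = y
  · subst hxy
    simp [Real.zero_rpow hα0.ne']
  have ht : 0 < ‖x - y‖ := norm_pos_iff.2 (sub_ne_zero.2 hxy)
  set Q := K * (2 * D) ^ σ / (2 - 2 ^ α) with hQ
  set t := ‖x - y‖ with htd
  have e : 2 * (4 * K + Q) * (2 / D) ^ α * t ^ α = 2 * (4 * K + Q) * (2 * t / D) ^ α := by
    rw [mul_assoc, ← Real.mul_rpow (by positivity) ht.le]
    congr 2; ring
  rw [e]
  have hτ0 : 0 < 2 * t / D := by positivity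
  set τ := 2 * t / D with hτ
  by_cases h1 : τ ≤ 1
  · obtain ⟨n, hn⟩ := pow_unbounded_of_one_lt (1 / τ) (one_lt_two : (1 : ℝ) < 2)
    have hn' : 1 < 2 ^ (n + 1) * τ := by
      rw [div_lt_iff₀ hτ0] at hn
      rw [pow_succ]
      have : 0 < (2 : ℝ) ^ n * τ := by positivity
      linarith
    have h0 : (0 : E) ∈ ball (0 : E) D := mem_ball_self hD
    have hu : ((1 - τ) / τ) • (y - x) ∈ ball (0 : E) D := by
      rw [mem_ball_zero_iff, norm_smul, norm_sub_rev, ← htd, Real.norm_of_nonneg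
        (div_nonneg (by linarith) hτ0.le)]
      have : t = τ * D / 2 := by rw [hτ]; field_simp
      rw [this]
      have : (1 - τ) / τ * (τ * D / 2) = (1 - τ) * D / 2 := by field_simp
      rw [this]
      nlinarith
    have r1 := hf.ray hD hα0 hα1 hασ hx hu n τ hτ0 h1 hn'
    have r2 := hf.ray hD hα0 hα1 hασ hy h0 n τ hτ0 h1 hn'
    have e1 : x + τ • (((1 - τ) / τ) • (y - x) - x) = y + τ • (0 - y) := by
      rw [smul_sub, smul_smul, mul_div_cancel₀ _ hτ0.ne']
      module
    rw [e1] at r1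
    have := norm_sub_le (f (y + τ • (0 - y)) - f y) (f (y + τ • (0 - y)) - f x)
    have e9 : f (y + τ • (0 - y)) - f y - (f (y + τ • (0 - y)) - f x) = f x - f y := by abel
    rw [e9] at this
    linarith
  · have h3 : 1 ≤ τ ^ α := Real.one_le_rpow (by linarith) hα0.le
    have h4 := norm_sub_le (f x) (f y)
    have h5 := hf.bd _ hx
    have h6 := hf.bd _ hy
    nlinarith

/-- Hypotheses on an inner function for the composition lemma. -/
structure InnerB (σ L D₁ D₂ : ℝ) (g : E → E) : Prop where
  nn : 0 ≤ L
  maps : ∀ x ∈ ball (0 : E) D₂, g x ∈ ball (0 : E) D₁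
  diff : DifferentiableOn ℝ g (ball (0 : E) D₂)
  lip : ∀ x ∈ ball (0 : E) D₂, ∀ y ∈ ball (0 : E) D₂, ‖g x - g y‖ ≤ L * ‖x - y‖
  sd : ∀ x h : E, x ∈ ball (0 : E) D₂ → x + h ∈ ball (0 : E) D₂ → x + 2 • h ∈ ball (0 : E) D₂ →
    ‖g (x + 2 • h) - 2 • g (x + h) + g x‖ ≤ L * ‖h‖ ^ (1 + σ / 2)

lemma ZB.comp {σ D₁ D₂ : ℝ} (hσ : 0 < σ) (hσ1 : σ ≤ 1) (hD₁ : 0 < D₁) (K L : ℝ) :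
    ∃ K' : ℝ, ∀ (f : E → F) (g : E → E), ZB σ K (ball (0 : E) D₁) f → InnerB σ L D₁ D₂ g →
      ZB σ K' (ball (0 : E) D₂) (fun x => f (g x)) := by
  set α := σ / (1 + σ / 2) with hα
  have hα0 : 0 < α := by positivity
  have hα1 : α < 1 := by rw [hα, div_lt_one (by positivity)]; linarith
  have hασ : α ≤ σ := by
    rw [hα, div_le_iff₀ (by positivity)]; nlinarith
  have hαm : (1 + σ / 2) * α = σ := by rw [hα]; field_simp
  obtain ⟨Q, hQ⟩ : ∃ Q, Q = 2 * (4 * K + K * (2 * D₁) ^ σ / (2 - 2 ^ α)) * (2 / D₁) ^ α := ⟨_, rfl⟩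
  refine ⟨|K| + |K| * |L| ^ (σ / 2) + |K| * |L| ^ σ + 2 * |Q| * |L| ^ α, ?_⟩
  intro f g hf hg
  have hK := hf.nn
  have hL := hg.nn
  rw [abs_of_nonneg hK, abs_of_nonneg hL]
  have q1 : 0 ≤ K * L ^ (σ / 2) := by positivity
  have q2 : 0 ≤ K * L ^ σ := by positivity
  have q3 : 0 ≤ 2 * |Q| * L ^ α := by positivity
  refine ⟨by positivity, ?_, ?_, ?_⟩
  · intro x hx
    have := hf.bd _ (hg.maps x hx)
    linarith
  · intro x hx y hy
    refine (hf.hol _ (hg.maps x hx) _ (hg.maps y hy)).trans ?_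
    calc K * ‖g x - g y‖ ^ (σ / 2) ≤ K * (L * ‖x - y‖) ^ (σ / 2) := by
          gcongr; exact hg.lip x hx y hy
      _ = K * L ^ (σ / 2) * ‖x - y‖ ^ (σ / 2) := by
          rw [Real.mul_rpow hL (norm_nonneg _)]; ring
      _ ≤ _ := by gcongr; linarith
  · intro x h h1 h2 h3
    have ma := hg.maps _ h1
    have mb := hg.maps _ h2
    have mc := hg.maps _ h3
    have hlip := hg.lip _ h3 _ h1
    have hsd := hg.sd x h h1 h2 h3
    set a := g x
    set b := g (x + h)
    set c := g (x + 2 • h)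
    have hk : ‖(1 / 2 : ℝ) • (c - a)‖ ≤ L * ‖h‖ := by
      rw [norm_smul, Real.norm_of_nonneg (by norm_num)]
      have : ‖x + 2 • h - x‖ = 2 * ‖h‖ := by
        rw [add_sub_cancel_left, ← ofNat_smul_eq_nsmul ℝ, norm_smul]; simp
      rw [this] at hlip
      linarith
    have mb' : a + (1 / 2 : ℝ) • (c - a) ∈ ball (0 : E) D₁ :=
      (convex_ball (0 : E) D₁).add_smul_sub_mem ma mc ⟨by norm_num, by norm_num⟩
    have ec : a + 2 • ((1 / 2 : ℝ) • (c - a)) = c := by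
      rw [← ofNat_smul_eq_nsmul ℝ, smul_smul]; simp
    have r1 := hf.sd a _ ma mb' (by rw [ec]; exact mc)
    rw [ec] at r1
    have r2 := hf.hol_improve hD₁ hα0 hα1 hασ mb' mb
    rw [← hQ] at r2
    have eb : a + (1 / 2 : ℝ) • (c - a) - b = (1 / 2 : ℝ) • (c - 2 • b + a) := by
      rw [← ofNat_smul_eq_nsmul ℝ]; module
    have hb : ‖a + (1 / 2 : ℝ) • (c - a) - b‖ ≤ L * ‖h‖ ^ (1 + σ / 2) := by
      rw [eb, norm_smul, Real.norm_of_nonneg (by norm_num)]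
      have := norm_nonneg (c - 2 • b + a)
      linarith
    have r3 : ‖f (a + (1 / 2 : ℝ) • (c - a)) - f b‖ ≤ |Q| * L ^ α * ‖h‖ ^ σ := by
      calc _ ≤ Q * ‖a + (1 / 2 : ℝ) • (c - a) - b‖ ^ α := r2
        _ ≤ |Q| * (L * ‖h‖ ^ (1 + σ / 2)) ^ α := by
            gcongr
            exact le_abs_self Q
        _ = |Q| * L ^ α * ‖h‖ ^ σ := by
            rw [Real.mul_rpow hL (by positivity), ← Real.rpow_mul (norm_nonneg _), hαm]; ring
    have r4 : K * ‖(1 / 2 : ℝ) • (c - a)‖ ^ σ ≤ K * L ^ σ * ‖h‖ ^ σ := by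
      calc _ ≤ K * (L * ‖h‖) ^ σ := by gcongr
        _ = _ := by rw [Real.mul_rpow hL (norm_nonneg _)]; ring
    have e : f c - 2 • f b + f a = (f c - 2 • f (a + (1 / 2 : ℝ) • (c - a)) + f a)
      + (2 : ℝ) • (f (a + (1 / 2 : ℝ) • (c - a)) - f b) := by
      simp only [two_smul]; abel
    rw [e]
    refine (norm_add_le _ _).trans ?_
    rw [norm_smul, Real.norm_of_nonneg (by norm_num : (0 : ℝ) ≤ 2)]
    have p3 : 0 ≤ ‖h‖ ^ σ := by positivity
    have p4 := mul_nonneg q1 p3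
    have p5 := mul_nonneg hK p3
    linarith

/-- Recursive version of the Zygmund bounds of order `k + σ`. -/
def ZZ (σ K : ℝ) (Ω : Set E) : (k : ℕ) → {F : Type} → [NormedAddCommGroup F] →
    [NormedSpace ℝ F] → (E → F) → Prop
  | 0, _, _, _, f => ZB σ K Ω f
  | k + 1, _, _, _, f => ZB σ K Ω f ∧ DifferentiableOn ℝ f Ω ∧ ZZ σ K Ω k (fderivWithin ℝ f Ω)

lemma ZZ.zb {σ K : ℝ} {Ω : Set E} {k : ℕ} {f : E → F} (h : ZZ σ K Ω k f) : ZB σ K Ω f := by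
  cases k with
  | zero => exact h
  | succ k => exact h.1

lemma ZZ.mono {σ K K' : ℝ} {Ω : Set E} (hK : K ≤ K') (k : ℕ) :
    ∀ {F : Type} [NormedAddCommGroup F] [NormedSpace ℝ F] {f : E → F}, ZZ σ K Ω k f →
    ZZ σ K' Ω k f := by
  induction k with
  | zero => intro F _ _ f h; exact ZB.mono h hK
  | succ k ih => intro F _ _ f h; exact ⟨h.1.mono hK, h.2.1, ih h.2.2⟩

lemma ZZ.pred {σ K : ℝ} {Ω : Set E} (k : ℕ) :
    ∀ {F : Type} [NormedAddCommGroup F] [NormedSpace ℝ F] {f : E → F}, ZZ σ K Ω (k + 1) f →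
    ZZ σ K Ω k f := by
  induction k with
  | zero => intro F _ _ f h; exact h.1
  | succ k ih => intro F _ _ f h; exact ⟨h.1, h.2.1, ih h.2.2⟩

lemma ZZ.congr {σ K : ℝ} {Ω : Set E} (k : ℕ) :
    ∀ {F : Type} [NormedAddCommGroup F] [NormedSpace ℝ F] {f g : E → F}, ZZ σ K Ω k f →
    EqOn g f Ω → ZZ σ K Ω k g := by
  induction k with
  | zero => intro F _ _ f g h hfg; exact ZB.congr h hfg
  | succ k ih =>
    intro F _ _ f g h hfg
    exact ⟨h.1.congr hfg, h.2.1.congr hfg, ih h.2.2 (fun x hx => fderivWithin_congr hfg (hfg hx))⟩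

lemma ZZ.add {σ K L : ℝ} {Ω : Set E} (hΩ : IsOpen Ω) (k : ℕ) :
    ∀ {F : Type} [NormedAddCommGroup F] [NormedSpace ℝ F] {f g : E → F}, ZZ σ K Ω k f →
    ZZ σ L Ω k g → ZZ σ (K + L) Ω k (fun x => f x + g x) := by
  induction k with
  | zero => intro F _ _ f g hf hg; exact ZB.add hf hg
  | succ k ih =>
    intro F _ _ f g hf hg
    exact ⟨hf.1.add hg.1, hf.2.1.add hg.2.1, (ih hf.2.2 hg.2.2).congr k
      (fun x hx => fderivWithin_fun_add (hΩ.uniqueDiffWithinAt hx) (hf.2.1 x hx) (hg.2.1 x hx))⟩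

lemma ZZ.neg {σ K : ℝ} {Ω : Set E} (hΩ : IsOpen Ω) (k : ℕ) :
    ∀ {F : Type} [NormedAddCommGroup F] [NormedSpace ℝ F] {f : E → F}, ZZ σ K Ω k f →
    ZZ σ K Ω k (fun x => - f x) := by
  induction k with
  | zero => intro F _ _ f hf; exact ZB.neg hf
  | succ k ih =>
    intro F _ _ f hf
    exact ⟨hf.1.neg, hf.2.1.neg, (ih hf.2.2).congr k
      (fun x hx => fderivWithin_fun_neg (hΩ.uniqueDiffWithinAt hx))⟩

lemma ZZ.bilin {σ : ℝ} (hσ : 0 < σ) {Ω : Set E} (hΩ : IsOpen Ω) (K L : ℝ) (k : ℕ) :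
    ∀ {F G W : Type} [NormedAddCommGroup F] [NormedSpace ℝ F] [NormedAddCommGroup G]
      [NormedSpace ℝ G] [NormedAddCommGroup W] [NormedSpace ℝ W] (B : F →L[ℝ] G →L[ℝ] W),
    ∃ K' : ℝ, ∀ (f : E → F) (g : E → G), ZZ σ K Ω k f → ZZ σ L Ω k g →
      ZZ σ K' Ω k (fun x => B (f x) (g x)) := by
  induction k with
  | zero =>
    intro F G W _ _ _ _ _ _ B
    exact ⟨_, fun f g hf hg => ZB.bilin hσ B hf hg⟩
  | succ k ih =>
    intro F G W _ _ _ _ _ _ B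
    obtain ⟨K1, h1⟩ := ih (B.precompR E)
    obtain ⟨K2, h2⟩ := ih (B.precompL E)
    refine ⟨max (4 * (‖B‖ * K * L)) (K1 + K2), fun f g hf hg => ?_⟩
    have hd : ∀ x ∈ Ω, HasFDerivWithinAt (fun y => B (f y) (g y))
        (B.precompR E (f x) (fderivWithin ℝ g Ω x) + B.precompL E (fderivWithin ℝ f Ω x) (g x))
        Ω x := fun x hx => B.hasFDerivWithinAt_of_bilinear
          (hf.2.1 x hx).hasFDerivWithinAt (hg.2.1 x hx).hasFDerivWithinAt
    refine ⟨(ZB.bilin hσ B hf.1 hg.1).mono (le_max_left _ _),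
      fun x hx => (hd x hx).differentiableWithinAt, ?_⟩
    refine ZZ.congr k (ZZ.mono (le_max_right _ _) k (ZZ.add hΩ k (h1 f _ (hf.pred k) hg.2.2)
      (h2 _ g hf.2.2 (hg.pred k)))) ?_
    intro x hx
    exact (hd x hx).fderivWithin (hΩ.uniqueDiffWithinAt hx)

lemma ZZ.inv {R : Type} [NormedRing R] [NormedAlgebra ℝ R] [CompleteSpace R] {σ : ℝ} (hσ : 0 < σ)
    {Ω : Set E} (hΩ : IsOpen Ω) (K c : ℝ) (hc : 0 ≤ c) (k : ℕ) :
    ∃ K' : ℝ, ∀ (A I : E → R), ZZ σ K Ω k A → (∀ x ∈ Ω, ‖I x‖ ≤ c) →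
      (∀ x ∈ Ω, A x * I x = 1) → (∀ x ∈ Ω, I x * A x = 1) → ZZ σ K' Ω k I := by
  induction k with
  | zero => exact ⟨_, fun A I hA hI h1 h2 => ZB.inv hσ hA hc hI h1 h2⟩
  | succ k ih =>
    obtain ⟨K1, i1⟩ := ih
    obtain ⟨K2, i2⟩ := ZZ.bilin hσ hΩ K1 K1 k (ContinuousLinearMap.mulLeftRight ℝ R)
    obtain ⟨K3, i3⟩ := ZZ.bilin hσ hΩ K2 K k (ContinuousLinearMap.compL ℝ E R R)
    obtain ⟨K4, i4⟩ : ∃ K4 : ℝ, ∀ (A I : E → R), ZB σ K Ω A → (∀ x ∈ Ω, ‖I x‖ ≤ c) →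
      (∀ x ∈ Ω, A x * I x = 1) → (∀ x ∈ Ω, I x * A x = 1) → ZB σ K4 Ω I :=
      ⟨_, fun A I hA hI h1 h2 => ZB.inv hσ hA hc hI h1 h2⟩
    refine ⟨max K4 K3, fun A I hA hI h1 h2 => ?_⟩
    have hd : ∀ x ∈ Ω, HasFDerivWithinAt I (-(ContinuousLinearMap.compL ℝ E R R
        (ContinuousLinearMap.mulLeftRight ℝ R (I x) (I x)) (fderivWithin ℝ A Ω x))) Ω x := by
      intro x hx
      let u : Rˣ := ⟨A x, I x, h1 x hx, h2 x hx⟩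
      have hr := hasFDerivAt_ringInverse (𝕜 := ℝ) u
      have hcmp := HasFDerivAt.comp_hasFDerivWithinAt x (f := A) hr
        (hA.2.1 x hx).hasFDerivWithinAt
      have heq : ∀ y ∈ Ω, I y = (Ring.inverse ∘ A) y := by
        intro y hy
        exact (Ring.inverse_unit (⟨A y, I y, h1 y hy, h2 y hy⟩ : Rˣ)).symm
      refine (hcmp.congr heq (heq x hx)).congr_fderiv ?_
      ext v
      simp [u]
    refine ⟨(i4 A I hA.1 hI h1 h2).mono (le_max_left _ _),
      fun x hx => (hd x hx).differentiableWithinAt, ?_⟩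
    have hIk := i1 A I (hA.pred k) hI h1 h2
    refine ZZ.congr k (ZZ.mono (le_max_right _ _) k (ZZ.neg hΩ k
      (i3 _ _ (i2 I I hIk hIk) hA.2.2))) ?_
    intro x hx
    exact (hd x hx).fderivWithin (hΩ.uniqueDiffWithinAt hx)

lemma ZZ.comp {σ D₁ D₂ : ℝ} (hσ : 0 < σ) (hσ1 : σ ≤ 1) (hD₁ : 0 < D₁) (K L : ℝ) (k : ℕ) :
    ∀ {F : Type} [NormedAddCommGroup F] [NormedSpace ℝ F], ∃ K' : ℝ, ∀ (f : E → F) (g : E → E),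
      ZZ σ K (ball (0 : E) D₁) k f → InnerB σ L D₁ D₂ g →
      (∀ j, j + 1 = k → ZZ σ L (ball (0 : E) D₂) j (fderivWithin ℝ g (ball (0 : E) D₂))) →
      ZZ σ K' (ball (0 : E) D₂) k (fun x => f (g x)) := by
  induction k with
  | zero =>
    intro F _ _
    obtain ⟨K', h⟩ := ZB.comp (E := E) (F := F) (D₂ := D₂) hσ hσ1 hD₁ K L
    exact ⟨K', fun f g hf hg _ => h f g hf hg⟩
  | succ k ih =>
    intro F _ _
    obtain ⟨K1, i1⟩ := ZB.comp (E := E) (F := F) (D₂ := D₂) hσ hσ1 hD₁ K L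
    obtain ⟨K2, i2⟩ := ih (F := E →L[ℝ] F)
    obtain ⟨K3, i3⟩ := ZZ.bilin hσ (isOpen_ball (x := (0 : E)) (ε := D₂)) K2 L k
      (ContinuousLinearMap.compL ℝ E E F)
    refine ⟨max K1 K3, fun f g hf hg hj => ?_⟩
    have hd : ∀ x ∈ ball (0 : E) D₂, HasFDerivWithinAt (fun x => f (g x))
        (ContinuousLinearMap.compL ℝ E E F (fderivWithin ℝ f (ball (0 : E) D₁) (g x))
          (fderivWithin ℝ g (ball (0 : E) D₂) x)) (ball (0 : E) D₂) x := by
      intro x hx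
      exact HasFDerivWithinAt.comp x (hf.2.1 _ (hg.maps x hx)).hasFDerivWithinAt
        (hg.diff x hx).hasFDerivWithinAt hg.maps
    refine ⟨(i1 f g hf.1 hg).mono (le_max_left _ _),
      fun x hx => (hd x hx).differentiableWithinAt, ?_⟩
    have hgk := hj k rfl
    refine ZZ.congr k (ZZ.mono (le_max_right _ _) k (i3 _ _ (i2 _ g hf.2.2 hg ?_) hgk)) ?_
    · intro j hjk
      subst hjk
      exact hgk.pred j
    · intro x hx
      exact (hd x hx).fderivWithin (isOpen_ball.uniqueDiffWithinAt hx)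

lemma ZB.isom {σ K : ℝ} {Ω : Set E} {f : E → F} (e : F ≃ₗᵢ[ℝ] G) :
    ZB σ K Ω (fun x => e (f x)) ↔ ZB σ K Ω f := by
  have hh : ∀ x y, ‖e (f x) - e (f y)‖ = ‖f x - f y‖ := fun x y => by
    rw [← map_sub, e.norm_map]
  have hs : ∀ x y z, ‖e (f x) - 2 • e (f y) + e (f z)‖ = ‖f x - 2 • f y + f z‖ := fun x y z => by
    rw [← map_nsmul, ← map_sub, ← map_add, e.norm_map]
  constructor
  · intro h
    exact ⟨h.nn, fun x hx => by simpa using h.bd x hx,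
      fun x hx y hy => by rw [← hh]; exact h.hol x hx y hy,
      fun x k h1 h2 h3 => by rw [← hs]; exact h.sd x k h1 h2 h3⟩
  · intro h
    exact ⟨h.nn, fun x hx => by simpa using h.bd x hx,
      fun x hx y hy => by rw [hh]; exact h.hol x hx y hy,
      fun x k h1 h2 h3 => by rw [hs]; exact h.sd x k h1 h2 h3⟩

lemma ZB.iter_zero {σ K : ℝ} {Ω : Set E} {f : E → F} :
    ZB σ K Ω (iteratedFDerivWithin ℝ 0 f Ω) ↔ ZB σ K Ω f := by
  rw [iteratedFDerivWithin_zero_eq_comp]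
  exact ZB.isom (continuousMultilinearCurryFin0 ℝ E F).symm

lemma ZB.iter_succ {σ K : ℝ} {Ω : Set E} (hΩ : IsOpen Ω) {f : E → F} {i : ℕ} :
    ZB σ K Ω (iteratedFDerivWithin ℝ (i + 1) f Ω) ↔
      ZB σ K Ω (iteratedFDerivWithin ℝ i (fderivWithin ℝ f Ω) Ω) := by
  have e : EqOn (iteratedFDerivWithin ℝ (i + 1) f Ω)
      (fun x => (continuousMultilinearCurryRightEquiv' ℝ i E F).symm
        (iteratedFDerivWithin ℝ i (fderivWithin ℝ f Ω) Ω x)) Ω := fun x hx =>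
    iteratedFDerivWithin_succ_eq_comp_right hΩ.uniqueDiffOn hx
  have h0 := ZB.isom (σ := σ) (K := K) (Ω := Ω)
    (f := iteratedFDerivWithin ℝ i (fderivWithin ℝ f Ω) Ω)
    (continuousMultilinearCurryRightEquiv' ℝ i E F).symm
  exact ⟨fun h => h0.1 (h.congr e.symm), fun h => (h0.2 h).congr e⟩

lemma ZZ.of_iter {σ K : ℝ} {Ω : Set E} (hΩ : IsOpen Ω) (k : ℕ) :
    ∀ {F : Type} [NormedAddCommGroup F] [NormedSpace ℝ F] {f : E → F}, ContDiffOn ℝ k f Ω →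
      (∀ i ≤ k, ZB σ K Ω (iteratedFDerivWithin ℝ i f Ω)) → ZZ σ K Ω k f := by
  induction k with
  | zero => intro F _ _ f _ h; exact ZB.iter_zero.1 (h 0 le_rfl)
  | succ k ih =>
    intro F _ _ f hc h
    have hc' := (contDiffOn_succ_iff_fderivWithin hΩ.uniqueDiffOn).1
      (by exact_mod_cast hc : ContDiffOn ℝ ((k : WithTop ℕ∞) + 1) f Ω)
    exact ⟨ZB.iter_zero.1 (h 0 (Nat.zero_le _)), hc'.1,
      ih hc'.2.2 (fun i hi => (ZB.iter_succ hΩ).1 (h (i + 1) (by omega)))⟩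

lemma ZB.continuousOn {σ K : ℝ} (hσ : 0 < σ) {Ω : Set E} {f : E → F} (hf : ZB σ K Ω f) :
    ContinuousOn f Ω := by
  intro x hx
  rw [ContinuousWithinAt, tendsto_iff_norm_sub_tendsto_zero]
  have h1 : Filter.Tendsto (fun y => K * ‖y - x‖ ^ (σ / 2)) (nhdsWithin x Ω) (nhds 0) := by
    have : Continuous (fun y => K * ‖y - x‖ ^ (σ / 2)) := by
      refine continuous_const.mul ((continuous_id.sub continuous_const).norm.rpow_const ?_)
      intro y; right; positivity
    have h2 := (this.tendsto x).mono_left (nhdsWithin_le_nhds (s := Ω))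
    simpa [Real.zero_rpow (by positivity : σ / 2 ≠ 0)] using h2
  refine squeeze_zero' (Filter.Eventually.of_forall fun y => norm_nonneg _) ?_ h1
  filter_upwards [self_mem_nhdsWithin] with y hy
  exact hf.hol y hy x hx

lemma ZZ.iter {σ K : ℝ} (hσ : 0 < σ) {Ω : Set E} (hΩ : IsOpen Ω) (k : ℕ) :
    ∀ {F : Type} [NormedAddCommGroup F] [NormedSpace ℝ F] {f : E → F}, ZZ σ K Ω k f →
      ContDiffOn ℝ k f Ω ∧ ∀ i ≤ k, ZB σ K Ω (iteratedFDerivWithin ℝ i f Ω) := by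
  induction k with
  | zero =>
    intro F _ _ f h
    refine ⟨by simpa using ZB.continuousOn hσ h, ?_⟩
    intro i hi
    obtain rfl : i = 0 := by omega
    exact ZB.iter_zero.2 h
  | succ k ih =>
    intro F _ _ f h
    obtain ⟨a, b⟩ := ih h.2.2
    constructor
    · have := (contDiffOn_succ_iff_fderivWithin (n := (k : WithTop ℕ∞)) hΩ.uniqueDiffOn).2
        ⟨h.2.1, fun hk => by simp at hk, a⟩
      exact_mod_cast this
    · intro i hi
      cases i with
      | zero => exact ZB.iter_zero.2 h.1
      | succ i => exact (ZB.iter_succ hΩ).2 (b i (by omega))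

lemma ZB.of_zygBase {σ M : ℝ} (hσ : 0 < σ) {Ω : Set E} {f : E → F}
    (h : zygBase σ Ω f ≤ ENNReal.ofReal M) : ZB σ (max M 0) Ω f := by
  have hM : ∀ a : ℝ, ENNReal.ofReal a ≤ ENNReal.ofReal M → a ≤ max M 0 := by
    intro a ha
    by_cases h0 : a ≤ 0
    · exact h0.trans (le_max_right _ _)
    · push Not at h0
      exact ((ENNReal.ofReal_le_ofReal_iff' .. ).1 ha).elim (fun h => h.trans (le_max_left _ _))
        (fun h => absurd h (not_le.2 h0))
  refine ⟨le_max_right _ _, ?_, ?_, ?_⟩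
  · intro x hx
    apply hM
    refine le_trans ?_ h
    refine le_trans ?_ (le_self_add : holderNorm (σ / 2) Ω f ≤ _)
    refine le_trans ?_ (le_self_add)
    exact le_iSup₂_of_le x hx le_rfl
  · intro x hx y hy
    by_cases hxy : x = y
    · subst hxy; simp; positivity
    have hp : 0 < ‖x - y‖ ^ (σ / 2) :=
      Real.rpow_pos_of_pos (norm_pos_iff.2 (sub_ne_zero.2 hxy)) _
    rw [← div_le_iff₀ hp]
    apply hM
    refine le_trans ?_ h
    refine le_trans ?_ (le_self_add : holderNorm (σ / 2) Ω f ≤ _)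
    refine le_trans ?_ (le_add_self)
    exact le_iSup₂_of_le x hx (le_iSup₂_of_le y hy (le_iSup_of_le hxy le_rfl))
  · intro x k h1 h2 h3
    by_cases hk : k = 0
    · subst hk
      have : f (x + 2 • (0 : E)) - 2 • f (x + 0) + f x = 0 := by
        simp only [smul_zero, add_zero, two_smul]; abel
      rw [this]; simp; positivity
    have hp : 0 < ‖k‖ ^ σ := Real.rpow_pos_of_pos (norm_pos_iff.2 hk) _
    rw [← div_le_iff₀ hp]
    apply hM
    refine le_trans ?_ h
    refine le_trans ?_ (le_add_self : secondDiff σ Ω f ≤ _)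
    exact le_iSup₂_of_le x k (le_iSup₂_of_le hk h1 (le_iSup₂_of_le h2 h3 le_rfl))

lemma ZB.zygBase_le {σ K : ℝ} {Ω : Set E} {f : E → F} (h : ZB σ K Ω f) :
    zygBase σ Ω f ≤ ENNReal.ofReal K + ENNReal.ofReal K + ENNReal.ofReal K := by
  refine add_le_add (add_le_add ?_ ?_) ?_
  · exact iSup₂_le fun x hx => ENNReal.ofReal_le_ofReal (h.bd x hx)
  · refine iSup₂_le fun x hx => iSup₂_le fun y hy => iSup_le fun hxy => ENNReal.ofReal_le_ofReal ?_
    exact (div_le_iff₀ (Real.rpow_pos_of_pos (norm_pos_iff.2 (sub_ne_zero.2 hxy)) _)).2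
      (h.hol x hx y hy)
  · refine iSup₂_le fun x k => iSup₂_le fun hk h1 => iSup₂_le fun h2 h3 =>
      ENNReal.ofReal_le_ofReal ?_
    exact (div_le_iff₀ (Real.rpow_pos_of_pos (norm_pos_iff.2 hk) _)).2 (h.sd x k h1 h2 h3)

lemma inverse_bound [FiniteDimensional ℝ E] (c₀ K : ℝ) (hc₀ : 0 < c₀) :
    ∃ c : ℝ, 0 ≤ c ∧ ∀ A : E →L[ℝ] E, ‖A‖ ≤ K → c₀ ≤ |A.det| → ‖Ring.inverse A‖ ≤ c := by
  have : CompleteSpace E := FiniteDimensional.complete ℝ E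
  have : ProperSpace (E →L[ℝ] E) := FiniteDimensional.proper ℝ _
  have hcl : IsClosed {A : E →L[ℝ] E | c₀ ≤ |A.det|} :=
    isClosed_le continuous_const (ContinuousLinearMap.continuous_det.abs)
  have hcomp : IsCompact (closedBall (0 : E →L[ℝ] E) K ∩ {A : E →L[ℝ] E | c₀ ≤ |A.det|}) :=
    (isCompact_closedBall _ _).inter_right hcl
  have hcont : ContinuousOn (Ring.inverse : (E →L[ℝ] E) → (E →L[ℝ] E))
      (closedBall (0 : E →L[ℝ] E) K ∩ {A : E →L[ℝ] E | c₀ ≤ |A.det|}) := by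
    intro A hA
    have hdet : A.det ≠ 0 := by
      intro h0
      have := hA.2
      simp only [Set.mem_ofPred_eq, h0, abs_zero] at this
      linarith
    let e := A.toContinuousLinearEquivOfDetNeZero hdet
    have := NormedRing.inverse_continuousAt (ContinuousLinearEquiv.toUnit e)
    exact ContinuousAt.continuousWithinAt this
  obtain ⟨C, hC⟩ := hcomp.exists_bound_of_continuousOn hcont
  exact ⟨max C 0, le_max_right _ _, fun A h1 h2 =>
    (hC A ⟨by simpa using h1, h2⟩).trans (le_max_left _ _)⟩

/-- The standing hypotheses on `H` and its inverse `g`, with derived facts. -/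
structure Hyp (σ K c D₁ D₂ : ℝ) (H g : E → E) : Prop where
  zb : ZB σ K (ball (0 : E) D₁) (fderivWithin ℝ H (ball (0 : E) D₁))
  maps : ∀ x ∈ ball (0 : E) D₂, g x ∈ ball (0 : E) D₁
  diff : DifferentiableOn ℝ g (ball (0 : E) D₂)
  bd : ∀ x ∈ ball (0 : E) D₂, ‖fderivWithin ℝ g (ball (0 : E) D₂) x‖ ≤ c
  inv1 : ∀ x ∈ ball (0 : E) D₂, fderivWithin ℝ H (ball (0 : E) D₁) (g x) *
    fderivWithin ℝ g (ball (0 : E) D₂) x = 1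
  inv2 : ∀ x ∈ ball (0 : E) D₂, fderivWithin ℝ g (ball (0 : E) D₂) x *
    fderivWithin ℝ H (ball (0 : E) D₁) (g x) = 1

lemma Hyp.mk' [FiniteDimensional ℝ E] {σ K c₀ c D₁ D₂ : ℝ} (hc₀ : 0 < c₀)
    (hc : ∀ A : E →L[ℝ] E, ‖A‖ ≤ K → c₀ ≤ |A.det| → ‖Ring.inverse A‖ ≤ c)
    {H g : E → E} (hd : DifferentiableOn ℝ H (ball (0 : E) D₁))
    (hz : ZB σ K (ball (0 : E) D₁) (fderivWithin ℝ H (ball (0 : E) D₁)))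
    (hsub : ball (0 : E) D₂ ⊆ H '' ball (0 : E) D₁)
    (hinv : InvOn g H (ball (0 : E) D₁) (H '' ball (0 : E) D₁))
    (hcont : ContinuousOn g (H '' ball (0 : E) D₁))
    (hdet : ∀ t ∈ ball (0 : E) D₁, c₀ ≤ |(fderivWithin ℝ H (ball (0 : E) D₁) t).det|) :
    Hyp σ K c D₁ D₂ H g := by
  have maps : ∀ x ∈ ball (0 : E) D₂, g x ∈ ball (0 : E) D₁ := by
    intro x hx
    obtain ⟨t, ht, rfl⟩ := hsub hx
    rw [hinv.1 ht]; exact ht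
  have key : ∀ x ∈ ball (0 : E) D₂, ∃ e : E ≃L[ℝ] E,
      (e : E →L[ℝ] E) = fderivWithin ℝ H (ball (0 : E) D₁) (g x) ∧
      HasFDerivAt g (e.symm : E →L[ℝ] E) x := by
    intro x hx
    have hne : (fderivWithin ℝ H (ball (0 : E) D₁) (g x)).det ≠ 0 := by
      intro h0
      have := hdet _ (maps x hx)
      rw [h0, abs_zero] at this
      linarith
    refine ⟨ContinuousLinearMap.toContinuousLinearEquivOfDetNeZero _ hne, by simp, ?_⟩
    have hnb : ball (0 : E) D₂ ∈ nhds x := isOpen_ball.mem_nhds hx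
    apply HasFDerivAt.of_local_left_inverse (f := H)
    · exact hcont.continuousAt (Filter.mem_of_superset hnb hsub)
    · have := (hd _ (maps x hx)).hasFDerivWithinAt.hasFDerivAt (isOpen_ball.mem_nhds (maps x hx))
      simpa using this
    · filter_upwards [hnb] with y hy
      exact hinv.2 (hsub hy)
  have key2 : ∀ x ∈ ball (0 : E) D₂, ∃ e : E ≃L[ℝ] E,
      (e : E →L[ℝ] E) = fderivWithin ℝ H (ball (0 : E) D₁) (g x) ∧
      (e.symm : E →L[ℝ] E) = fderivWithin ℝ g (ball (0 : E) D₂) x := by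
    intro x hx
    obtain ⟨e, h1, h2⟩ := key x hx
    exact ⟨e, h1, (h2.hasFDerivWithinAt.fderivWithin (isOpen_ball.uniqueDiffWithinAt hx)).symm⟩
  refine ⟨hz, maps, ?_, ?_, ?_, ?_⟩
  · intro x hx
    obtain ⟨e, h1, h2⟩ := key x hx
    exact h2.differentiableAt.differentiableWithinAt
  · intro x hx
    obtain ⟨e, h1, h2⟩ := key2 x hx
    have := hc _ (hz.bd _ (maps x hx)) (hdet _ (maps x hx))
    rw [← h1, ContinuousLinearMap.ringInverse_equiv, ContinuousLinearMap.inverse_equiv, h2] at this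
    exact this
  · intro x hx
    obtain ⟨e, h1, h2⟩ := key2 x hx
    rw [← h1, ← h2]
    ext v; simp
  · intro x hx
    obtain ⟨e, h1, h2⟩ := key2 x hx
    rw [← h1, ← h2]
    ext v; simp

lemma InnerB.mono {σ L L' D₁ D₂ : ℝ} {g : E → E} (h : InnerB σ L D₁ D₂ g) (hL : L ≤ L') :
    InnerB σ L' D₁ D₂ g where
  nn := h.nn.trans hL
  maps := h.maps
  diff := h.diff
  lip x hx y hy := (h.lip x hx y hy).trans (by gcongr)
  sd x k h1 h2 h3 := (h.sd x k h1 h2 h3).trans (by gcongr)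

lemma Hyp.inner {σ K c D₁ D₂ : ℝ} (hσ : 0 < σ) (hc : 0 ≤ c) {H g : E → E}
    (h : Hyp σ K c D₁ D₂ H g) : InnerB σ (c + c * (K * c ^ (σ / 2)) * c) D₁ D₂ g := by
  have hK := h.zb.nn
  have hlip : ∀ x ∈ ball (0 : E) D₂, ∀ y ∈ ball (0 : E) D₂, ‖g x - g y‖ ≤ c * ‖x - y‖ := by
    intro x hx y hy
    exact (convex_ball (0 : E) D₂).norm_image_sub_le_of_norm_hasFDerivWithin_le
      (fun z hz => (h.diff z hz).hasFDerivWithinAt) h.bd hy hx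
  have p1 : 0 ≤ c * (K * c ^ (σ / 2)) * c := by positivity
  refine ⟨by positivity, h.maps, h.diff, ?_, ?_⟩
  · intro x hx y hy
    refine (hlip x hx y hy).trans ?_
    gcongr
    linarith
  · intro x k h1 h2 h3
    set I := fderivWithin ℝ g (ball (0 : E) D₂) with hI
    have hol : ∀ u ∈ ball (0 : E) D₂, ∀ v ∈ ball (0 : E) D₂,
        ‖I u - I v‖ ≤ c * (K * c ^ (σ / 2)) * c * ‖u - v‖ ^ (σ / 2) := by
      intro u hu v hv
      have key : I u - I v = - (I u * (fderivWithin ℝ H (ball (0 : E) D₁) (g u) -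
          fderivWithin ℝ H (ball (0 : E) D₁) (g v)) * I v) := by
        rw [mul_sub, sub_mul, h.inv2 u hu, mul_assoc (I u), h.inv1 v hv]
        simp
      have hA := h.zb.hol _ (h.maps u hu) _ (h.maps v hv)
      have hA' : K * ‖g u - g v‖ ^ (σ / 2) ≤ K * c ^ (σ / 2) * ‖u - v‖ ^ (σ / 2) := by
        rw [mul_assoc, ← Real.mul_rpow hc (norm_nonneg _)]
        have := hlip u hu v hv
        gcongr
      rw [key, norm_neg]
      calc _ ≤ c * (K * c ^ (σ / 2) * ‖u - v‖ ^ (σ / 2)) * c := by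
            refine (norm_mul_le _ _).trans (mul_le_mul ((norm_mul_le _ _).trans
              (mul_le_mul (h.bd u hu) (hA.trans hA') (norm_nonneg _) hc)) (h.bd v hv)
              (norm_nonneg _) (by positivity))
        _ = _ := by ring
    have hseg1 : ∀ v ∈ segment ℝ x (x + k), v ∈ ball (0 : E) D₂ := fun v hv =>
      (convex_ball (0 : E) D₂).segment_subset h1 h2 hv
    have hseg2 : ∀ v ∈ segment ℝ x (x + k), v + k ∈ ball (0 : E) D₂ := by
      intro v hv
      refine (convex_ball (0 : E) D₂).segment_subset h2 h3 ?_
      obtain ⟨a, b, ha, hb, hab, rfl⟩ := hv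
      refine ⟨a, b, ha, hb, hab, ?_⟩
      have : k = (a + b) • k := by rw [hab, one_smul]
      nth_rewrite 4 [this]
      rw [two_smul]
      module
    have hder : ∀ v ∈ segment ℝ x (x + k), HasFDerivWithinAt (fun w => g (w + k) - g w)
        (I (v + k) - I v) (segment ℝ x (x + k)) v := by
      intro v hv
      have d1 := (h.diff _ (hseg2 v hv)).hasFDerivWithinAt.hasFDerivAt
        (isOpen_ball.mem_nhds (hseg2 v hv))
      have d2 := (h.diff _ (hseg1 v hv)).hasFDerivWithinAt.hasFDerivAt
        (isOpen_ball.mem_nhds (hseg1 v hv))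
      exact (((hasFDerivAt_comp_add_right k).2 d1).sub d2).hasFDerivWithinAt
    have hmv := (convex_segment x (x + k)).norm_image_sub_le_of_norm_hasFDerivWithin_le
      (C := c * (K * c ^ (σ / 2)) * c * ‖k‖ ^ (σ / 2)) hder (fun v hv => by
        have := hol _ (hseg2 v hv) _ (hseg1 v hv)
        rwa [add_sub_cancel_left] at this) (left_mem_segment ℝ _ _) (right_mem_segment ℝ _ _)
    have e : g (x + 2 • k) - 2 • g (x + k) + g x = g (x + k + k) - g (x + k) - (g (x + k) - g x) := by
      rw [two_smul, two_smul, add_assoc x k k]; abel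
    rw [e]
    refine hmv.trans ?_
    rw [add_sub_cancel_left, Real.rpow_add_of_nonneg (norm_nonneg _) (by norm_num) (by positivity),
      Real.rpow_one]
    have p2 : 0 ≤ c * (‖k‖ * ‖k‖ ^ (σ / 2)) := by positivity
    nlinarith

lemma Hyp.deriv [CompleteSpace E] {σ : ℝ} (hσ : 0 < σ) (hσ1 : σ ≤ 1) {D₁ : ℝ} (D₂ : ℝ)
    (hD₁ : 0 < D₁) (K c : ℝ)
    (hc : 0 ≤ c) (j : ℕ) : ∃ K' : ℝ, ∀ H g : E → E, Hyp σ K c D₁ D₂ H g →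
      ZZ σ K (ball (0 : E) D₁) j (fderivWithin ℝ H (ball (0 : E) D₁)) →
      ZZ σ K' (ball (0 : E) D₂) j (fderivWithin ℝ g (ball (0 : E) D₂)) := by
  induction j with
  | zero =>
    obtain ⟨K1, i1⟩ := ZZ.comp (E := E) (D₂ := D₂) hσ hσ1 hD₁ K
      (c + c * (K * c ^ (σ / 2)) * c) 0 (F := E →L[ℝ] E)
    obtain ⟨K2, i2⟩ := ZZ.inv (R := E →L[ℝ] E) hσ
      (isOpen_ball (x := (0 : E)) (ε := D₂)) K1 c hc 0
    exact ⟨K2, fun H g h hz => i2 _ _ (i1 _ g hz (h.inner hσ hc) (fun j hj => by omega))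
      h.bd h.inv1 h.inv2⟩
  | succ j ih =>
    obtain ⟨K0, i0⟩ := ih
    obtain ⟨K1, i1⟩ := ZZ.comp (E := E) (D₂ := D₂) hσ hσ1 hD₁ K
      (max (c + c * (K * c ^ (σ / 2)) * c) K0) (j + 1) (F := E →L[ℝ] E)
    obtain ⟨K2, i2⟩ := ZZ.inv (R := E →L[ℝ] E) hσ
      (isOpen_ball (x := (0 : E)) (ε := D₂)) K1 c hc (j + 1)
    refine ⟨K2, fun H g h hz => i2 _ _ (i1 _ g hz ((h.inner hσ hc).mono (le_max_left _ _)) ?_)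
      h.bd h.inv1 h.inv2⟩
    intro i hi
    obtain rfl : i = j := by omega
    exact ZZ.mono (le_max_right _ _) i (i0 H g h (hz.pred i))

lemma InnerB.zb {σ L D₁ D₂ : ℝ} (hσ : 0 < σ) (hσ1 : σ ≤ 1) (hD₁ : 0 < D₁) (hD₂ : 0 < D₂)
    {g : E → E} (h : InnerB σ L D₁ D₂ g) :
    ZB σ (D₁ + L * (2 * D₂) ^ (1 - σ / 2)) (ball (0 : E) D₂) g := by
  have hL := h.nn
  have p1 : 0 ≤ L * (2 * D₂) ^ (1 - σ / 2) := by positivity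
  have hle : ∀ x ∈ ball (0 : E) D₂, ∀ y ∈ ball (0 : E) D₂,
      ‖x - y‖ ^ (1 - σ / 2) ≤ (2 * D₂) ^ (1 - σ / 2) := by
    intro x hx y hy
    rw [mem_ball_zero_iff] at hx hy
    have := norm_sub_le x y
    exact Real.rpow_le_rpow (norm_nonneg _) (by linarith) (by linarith)
  refine ⟨by positivity, ?_, ?_, ?_⟩
  · intro x hx
    have := h.maps x hx
    rw [mem_ball_zero_iff] at this
    linarith
  · intro x hx y hy
    have e : ‖x - y‖ = ‖x - y‖ ^ (1 - σ / 2) * ‖x - y‖ ^ (σ / 2) := by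
      rw [← Real.rpow_add_of_nonneg (norm_nonneg _) (by linarith) (by positivity)]
      simp
    calc ‖g x - g y‖ ≤ L * ‖x - y‖ := h.lip x hx y hy
      _ = L * (‖x - y‖ ^ (1 - σ / 2) * ‖x - y‖ ^ (σ / 2)) := by rw [← e]
      _ ≤ L * ((2 * D₂) ^ (1 - σ / 2) * ‖x - y‖ ^ (σ / 2)) := by
          gcongr L * (?_ * _); exact hle x hx y hy
      _ = L * (2 * D₂) ^ (1 - σ / 2) * ‖x - y‖ ^ (σ / 2) := by ring
      _ ≤ _ := by gcongr; linarith
  · intro x k h1 h2 h3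
    have hk := hle _ h2 _ h1
    rw [add_sub_cancel_left] at hk
    have e : ‖k‖ ^ (1 + σ / 2) = ‖k‖ ^ (1 - σ / 2) * ‖k‖ ^ σ := by
      rw [← Real.rpow_add_of_nonneg (norm_nonneg _) (by linarith) (by positivity)]
      congr 1; ring
    calc _ ≤ L * ‖k‖ ^ (1 + σ / 2) := h.sd x k h1 h2 h3
      _ = L * (‖k‖ ^ (1 - σ / 2) * ‖k‖ ^ σ) := by rw [e]
      _ ≤ L * ((2 * D₂) ^ (1 - σ / 2) * ‖k‖ ^ σ) := by gcongr L * (?_ * _)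
      _ = L * (2 * D₂) ^ (1 - σ / 2) * ‖k‖ ^ σ := by ring
      _ ≤ _ := by gcongr; linarith

lemma main_ZZ [FiniteDimensional ℝ E] {σ : ℝ} (hσ : 0 < σ) (hσ1 : σ ≤ 1) {D₁ D₂ c₀ : ℝ}
    (hD₁ : 0 < D₁) (hD₂ : 0 < D₂) (hc₀ : 0 < c₀) (K : ℝ) (k : ℕ) :
    ∃ K' : ℝ, ∀ H g : E → E, ZZ σ K (ball (0 : E) D₁) (k + 1) H →
      ball (0 : E) D₂ ⊆ H '' ball (0 : E) D₁ →
      InvOn g H (ball (0 : E) D₁) (H '' ball (0 : E) D₁) →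
      ContinuousOn g (H '' ball (0 : E) D₁) →
      (∀ t ∈ ball (0 : E) D₁, c₀ ≤ |(fderivWithin ℝ H (ball (0 : E) D₁) t).det|) →
      ZZ σ K' (ball (0 : E) D₂) (k + 1) g := by
  have : CompleteSpace E := FiniteDimensional.complete ℝ E
  obtain ⟨c, hc, hcA⟩ := inverse_bound (E := E) c₀ K hc₀
  obtain ⟨K1, i1⟩ := Hyp.deriv (E := E) hσ hσ1 D₂ hD₁ K c hc k
  refine ⟨max (D₁ + (c + c * (K * c ^ (σ / 2)) * c) * (2 * D₂) ^ (1 - σ / 2)) K1, ?_⟩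
  intro H g hz hsub hinv hcont hdet
  have h := Hyp.mk' hc₀ hcA hz.2.1 hz.2.2.zb hsub hinv hcont hdet
  exact ⟨((h.inner hσ hc).zb hσ hσ1 hD₁ hD₂).mono (le_max_left _ _), h.diff,
    ZZ.mono (le_max_right _ _) k (i1 H g h hz.2.2)⟩

end Aux

/-- Inverse maps in Zygmund spaces. If `s > 1`, `H ∈ 𝒞^s(B^n(D₁); ℝ^n)` (with
`‖H‖_{𝒞^s} ≤ M`) is a homeomorphism onto its image with `inf |det dH| ≥ c₀ > 0` and
`B^n(D₂) ⊆ H(B^n(D₁))`, then `H⁻¹ ∈ 𝒞^s(B^n(D₂); ℝ^n)` with norm bounded by a constant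
depending only on `n, s, D₁, D₂, c₀, M`. -/
theorem zygmund_inverse_map (n : ℕ) (s D₁ D₂ c₀ M : ℝ)
    (hs : 1 < s) (hD₁ : 0 < D₁) (hD₂ : 0 < D₂) (hc₀ : 0 < c₀) :
    ∃ C : ℝ≥0∞, C < ⊤ ∧
      ∀ H Hinv : EuclideanSpace ℝ (Fin n) → EuclideanSpace ℝ (Fin n),
        MemZyg s (ball (0 : EuclideanSpace ℝ (Fin n)) D₁) H →
        zygNorm s (ball (0 : EuclideanSpace ℝ (Fin n)) D₁) H ≤ ENNReal.ofReal M →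
        ball (0 : EuclideanSpace ℝ (Fin n)) D₂ ⊆ H '' ball (0 : EuclideanSpace ℝ (Fin n)) D₁ →
        ContinuousOn H (ball (0 : EuclideanSpace ℝ (Fin n)) D₁) →
        InvOn Hinv H (ball (0 : EuclideanSpace ℝ (Fin n)) D₁)
          (H '' ball (0 : EuclideanSpace ℝ (Fin n)) D₁) →
        ContinuousOn Hinv (H '' ball (0 : EuclideanSpace ℝ (Fin n)) D₁) →
        (∀ t ∈ ball (0 : EuclideanSpace ℝ (Fin n)) D₁,
          c₀ ≤ |LinearMap.det
            ((fderivWithin ℝ H (ball (0 : EuclideanSpace ℝ (Fin n)) D₁) t :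
                EuclideanSpace ℝ (Fin n) →L[ℝ] EuclideanSpace ℝ (Fin n)) :
              EuclideanSpace ℝ (Fin n) →ₗ[ℝ] EuclideanSpace ℝ (Fin n))|) →
          MemZyg s (ball (0 : EuclideanSpace ℝ (Fin n)) D₂) Hinv ∧
            zygNorm s (ball (0 : EuclideanSpace ℝ (Fin n)) D₂) Hinv ≤ C := by
  obtain ⟨k, hk⟩ : ∃ k : ℕ, ⌈s⌉₊ = k + 1 + 1 := by
    have h1 : 1 < ⌈s⌉₊ := Nat.lt_ceil.2 (by simpa using hs)
    exact ⟨⌈s⌉₊ - 2, by omega⟩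
  obtain ⟨σ, hσd⟩ : ∃ σ : ℝ, σ = s - ((k + 1 : ℕ) : ℝ) := ⟨_, rfl⟩
  have hσ : 0 < σ := by
    have : k + 1 < ⌈s⌉₊ := by omega
    have := Nat.lt_ceil.1 this
    linarith
  have hσ1 : σ ≤ 1 := by
    have := Nat.le_ceil s
    rw [hk] at this
    push_cast at this hσd
    linarith
  obtain ⟨K', hK'⟩ := main_ZZ (E := EuclideanSpace ℝ (Fin n)) hσ hσ1 hD₁ hD₂ hc₀ (max M 0) k
  have hnorm : ∀ (D : ℝ) (f : EuclideanSpace ℝ (Fin n) → EuclideanSpace ℝ (Fin n)),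
      zygNorm s (ball (0 : EuclideanSpace ℝ (Fin n)) D) f =
      ∑ i ∈ Finset.range (k + 1 + 1), zygBase σ (ball (0 : EuclideanSpace ℝ (Fin n)) D)
        (iteratedFDerivWithin ℝ i f (ball (0 : EuclideanSpace ℝ (Fin n)) D)) := by
    intro D f
    rw [zygNorm, hk, hσd, Nat.add_sub_cancel]
  obtain ⟨C, hC⟩ : ∃ C : ℝ≥0∞, C = ∑ i ∈ Finset.range (k + 1 + 1),
    (ENNReal.ofReal K' + ENNReal.ofReal K' + ENNReal.ofReal K') := ⟨_, rfl⟩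
  have hCtop : C < ⊤ := by
    rw [hC]
    exact ENNReal.sum_lt_top.2 fun i _ => by simp
  refine ⟨C, hCtop, ?_⟩
  intro H Hinv hmem hM hsub _ hinv hcont hdet
  have hcd : ContDiffOn ℝ ((k + 1 : ℕ) : WithTop ℕ∞) H
      (ball (0 : EuclideanSpace ℝ (Fin n)) D₁) := by
    have := hmem.1
    rwa [hk, Nat.add_sub_cancel] at this
  have hzH : ZZ σ (max M 0) (ball (0 : EuclideanSpace ℝ (Fin n)) D₁) (k + 1) H := by
    refine ZZ.of_iter isOpen_ball (k + 1) hcd ?_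
    intro i hi
    apply ZB.of_zygBase hσ
    rw [hnorm] at hM
    exact le_trans (Finset.single_le_sum
      (f := fun i => zygBase σ (ball (0 : EuclideanSpace ℝ (Fin n)) D₁)
        (iteratedFDerivWithin ℝ i H (ball (0 : EuclideanSpace ℝ (Fin n)) D₁)))
      (fun _ _ => zero_le) (Finset.mem_range.2 (by omega))) hM
  have hz := hK' H Hinv hzH hsub hinv hcont hdet
  obtain ⟨hc1, hb⟩ := ZZ.iter hσ isOpen_ball (k + 1) hz
  have hle : zygNorm s (ball (0 : EuclideanSpace ℝ (Fin n)) D₂) Hinv ≤ C := by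
    rw [hnorm, hC]
    refine Finset.sum_le_sum fun i hi => ZB.zygBase_le (hb i ?_)
    have := Finset.mem_range.1 hi
    omega
  refine ⟨⟨?_, (hle.trans_lt hCtop).ne⟩, hle⟩
  rw [hk, Nat.add_sub_cancel]
  exact hc1
end

section
/- Let U₁ ⊆ ℝ^{n₁}, U₂ ⊆ ℝ^{n₂}, U₃ ⊆ ℝ^{n₃} be open. If s₁ ∈ (0,∞), s₂ ≥ s₁, s₂ ∈ (1,∞), f₁ : U₁ → U₂ is locally 𝒞^{s₁} and f₂ : U₂ → U₃ is locally 𝒞^{s₂}, then f₂ ∘ f₁ : U₁ → U₃ is locally 𝒞^{s₁}. -/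
open Set Metric ENNReal

/-- `f` is locally `𝒞^s` on `U`: every point of `U` has a ball inside `U` on which `f` lies
in the Zygmund space `𝒞^s`. -/
def LocZyg {E F : Type*} [NormedAddCommGroup E] [NormedSpace ℝ E]
    [NormedAddCommGroup F] [NormedSpace ℝ F] (s : ℝ) (U : Set E) (f : E → F) : Prop :=
  ∀ x ∈ U, ∃ ε > 0, Metric.ball x ε ⊆ U ∧ MemZyg s (Metric.ball x ε) f

open Filter Topology Asymptotics

set_option linter.unusedSectionVars false
set_option linter.unusedVariables false

section ZygAux

variable {X Y W V : Type} [NormedAddCommGroup X] [NormedSpace ℝ X]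
  [NormedAddCommGroup Y] [NormedSpace ℝ Y] [NormedAddCommGroup W] [NormedSpace ℝ W]
  [NormedAddCommGroup V] [NormedSpace ℝ V]

/-- Local Hölder condition at a point. -/
def HolAt (θ : ℝ) (f : X → Y) (p : X) : Prop :=
  (fun q : X × X => f q.2 - f q.1) =O[𝓝 (p, p)] fun q => ‖q.2 - q.1‖ ^ θ

/-- Local second difference condition at a point. -/
def SdAt (σ : ℝ) (f : X → Y) (p : X) : Prop :=
  (fun q : X × X => f (q.2 + (q.2 - q.1)) - f q.2 - (f q.2 - f q.1)) =O[𝓝 (p, p)]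
    fun q => ‖q.2 - q.1‖ ^ σ

/-- Local Zygmund condition of order `σ ∈ (0,1]` at a point. -/
def ZbAt (σ : ℝ) (f : X → Y) (p : X) : Prop := HolAt (σ / 2) f p ∧ SdAt σ f p

/-- Local Zygmund condition of order `m + σ`. -/
def ZAt (m : ℕ) (σ : ℝ) (f : X → Y) (p : X) : Prop :=
  ContDiffAt ℝ m f p ∧ ZbAt σ (iteratedFDeriv ℝ m f) p

lemma tendsto_third (p : X) :
    Tendsto (fun q : X × X => q.2 + (q.2 - q.1)) (𝓝 (p, p)) (𝓝 p) := by
  have : Continuous (fun q : X × X => q.2 + (q.2 - q.1)) := by fun_prop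
  simpa using this.tendsto (p, p)

lemma tendsto_fst' (p : X) : Tendsto (fun q : X × X => q.1) (𝓝 (p, p)) (𝓝 p) :=
  continuous_fst.tendsto (p, p)

lemma tendsto_snd' (p : X) : Tendsto (fun q : X × X => q.2) (𝓝 (p, p)) (𝓝 p) :=
  continuous_snd.tendsto (p, p)

lemma tendsto_normdiff (p : X) :
    Tendsto (fun q : X × X => ‖q.2 - q.1‖) (𝓝 (p, p)) (𝓝[≥] 0) := by
  refine tendsto_nhdsWithin_iff.2 ⟨?_, Eventually.of_forall fun q => norm_nonneg _⟩
  have : Continuous (fun q : X × X => ‖q.2 - q.1‖) := by fun_prop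
  simpa using this.tendsto (p, p)

lemma rpow_mono_diff (p : X) {a b : ℝ} (hab : a ≤ b) (hb : 0 < b) :
    (fun q : X × X => ‖q.2 - q.1‖ ^ b) =O[𝓝 (p, p)] fun q => ‖q.2 - q.1‖ ^ a :=
  (IsBigO.rpow_rpow_nhdsGE_zero_of_le hab hb.ne').comp_tendsto (tendsto_normdiff p)

lemma HolAt.mono {a b : ℝ} {f : X → Y} {p : X} (h : HolAt b f p) (hab : a ≤ b) (hb : 0 < b) :
    HolAt a f p := h.trans (rpow_mono_diff p hab hb)

lemma SdAt.mono {a b : ℝ} {f : X → Y} {p : X} (h : SdAt b f p) (hab : a ≤ b) (hb : 0 < b) :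
    SdAt a f p := h.trans (rpow_mono_diff p hab hb)

lemma ZbAt.mono {a b : ℝ} {f : X → Y} {p : X} (h : ZbAt b f p) (hab : a ≤ b) (hb : 0 < b) :
    ZbAt a f p := ⟨h.1.mono (by linarith) (by linarith), h.2.mono hab hb⟩

lemma HolAt.continuousAt {θ : ℝ} (hθ : 0 < θ) {f : X → Y} {p : X} (h : HolAt θ f p) :
    ContinuousAt f p := by
  have h1 : Tendsto (fun x : X => (p, x)) (𝓝 p) (𝓝 (p, p)) := by
    have : Continuous (fun x : X => (p, x)) := by fun_prop
    exact this.tendsto p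
  have h2 := IsBigO.comp_tendsto h h1
  have h3 : Tendsto (fun x : X => ‖x - p‖ ^ θ) (𝓝 p) (𝓝 0) := by
    have : Continuous (fun x : X => ‖x - p‖ ^ θ) :=
      (continuous_id.sub continuous_const).norm.rpow_const (fun _ => Or.inr hθ.le)
    simpa [Real.zero_rpow hθ.ne'] using this.tendsto p
  have h4 := h2.trans_tendsto h3
  simp only [Function.comp_def] at h4
  exact tendsto_sub_nhds_zero_iff.1 h4

lemma HolAt.congr {θ : ℝ} {f g : X → Y} {p : X} (h : HolAt θ f p) (e : f =ᶠ[𝓝 p] g) :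
    HolAt θ g p := by
  refine IsBigO.congr' h ?_ EventuallyEq.rfl
  filter_upwards [(tendsto_fst' p).eventually e, (tendsto_snd' p).eventually e] with q h1 h2
  rw [h1, h2]

lemma SdAt.congr {θ : ℝ} {f g : X → Y} {p : X} (h : SdAt θ f p) (e : f =ᶠ[𝓝 p] g) :
    SdAt θ g p := by
  refine IsBigO.congr' h ?_ EventuallyEq.rfl
  filter_upwards [(tendsto_fst' p).eventually e, (tendsto_snd' p).eventually e,
    (tendsto_third p).eventually e] with q h1 h2 h3
  rw [h1, h2, h3]

lemma ZbAt.congr {θ : ℝ} {f g : X → Y} {p : X} (h : ZbAt θ f p) (e : f =ᶠ[𝓝 p] g) :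
    ZbAt θ g p := ⟨h.1.congr e, h.2.congr e⟩

lemma ZbAt.continuousAt {θ : ℝ} (hθ : 0 < θ) {f : X → Y} {p : X} (h : ZbAt θ f p) :
    ContinuousAt f p := h.1.continuousAt (half_pos hθ)

lemma ZAt.congr {m : ℕ} {θ : ℝ} {f g : X → Y} {p : X} (h : ZAt m θ f p) (e : f =ᶠ[𝓝 p] g) :
    ZAt m θ g p := ⟨h.1.congr_of_eventuallyEq e.symm, h.2.congr (e.iteratedFDeriv ℝ m)⟩

/-- Post-composition with an additive norm-preserving map. -/
lemma ZbAt.norm_iff {σ : ℝ} {F : X → W} {f : X → Y} {p : X} (L : Y → W)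
    (hL : ∀ a b, L (a - b) = L a - L b) (hn : ∀ a, ‖L a‖ = ‖a‖) (hF : ∀ x, F x = L (f x)) :
    ZbAt σ F p ↔ ZbAt σ f p := by
  unfold ZbAt HolAt SdAt
  simp only [hF, ← hL]
  refine and_congr ?_ ?_ <;>
  · rw [← isBigO_norm_left]
    simp only [hn]
    rw [isBigO_norm_left]

/-- Post-composition with a linear isometry. -/
lemma ZbAt.isometry_iff {σ : ℝ} (L : Y ≃ₗᵢ[ℝ] W) {f : X → Y} {p : X} :
    ZbAt σ (fun x => L (f x)) p ↔ ZbAt σ f p := by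
  unfold ZbAt HolAt SdAt
  simp only [← map_sub]
  refine and_congr ?_ ?_ <;>
  · rw [← isBigO_norm_left]
    simp only [LinearIsometryEquiv.norm_map]
    rw [isBigO_norm_left]

lemma SdAt.of_hol {θ : ℝ} {f : X → Y} {p : X} (h : HolAt θ f p) : SdAt θ f p := by
  have ht : Tendsto (fun q : X × X => (q.2, q.2 + (q.2 - q.1))) (𝓝 (p, p)) (𝓝 (p, p)) :=
    (tendsto_snd' p).prodMk_nhds (tendsto_third p)
  have h2 := IsBigO.comp_tendsto h ht
  simp only [Function.comp_def, add_sub_cancel_left] at h2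
  exact h2.sub h

lemma HolAt.of_contDiffAt {f : X → Y} {p : X} (h : ContDiffAt ℝ 1 f p) : HolAt 1 f p := by
  have := (h.hasStrictFDerivAt one_ne_zero).isBigO_sub
  have ht : Tendsto (fun q : X × X => (q.2, q.1)) (𝓝 (p, p)) (𝓝 (p, p)) :=
    (tendsto_snd' p).prodMk_nhds (tendsto_fst' p)
  have h2 := this.comp_tendsto ht
  simp only [Function.comp_def] at h2
  unfold HolAt
  simpa using h2.norm_right

lemma ZbAt.of_contDiffAt {σ : ℝ} (hσ : σ ≤ 1) {f : X → Y} {p : X}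
    (h : ContDiffAt ℝ 1 f p) : ZbAt σ f p :=
  ⟨(HolAt.of_contDiffAt h).mono (by linarith) one_pos,
    (SdAt.of_hol (HolAt.of_contDiffAt h)).mono hσ one_pos⟩

lemma ZAt.of_contDiffAt {m : ℕ} {σ : ℝ} (hσ : σ ≤ 1) {f : X → Y} {p : X}
    (h : ContDiffAt ℝ (m + 1 : ℕ) f p) : ZAt m σ f p :=
  ⟨h.of_le (by exact_mod_cast Nat.le_succ m), ZbAt.of_contDiffAt hσ
    (h.iteratedFDeriv_right (by rw [add_comm]; exact_mod_cast le_rfl))⟩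

lemma ZAt.pred {m : ℕ} {σ τ : ℝ} (hσ : τ ≤ 1) {f : X → Y} {p : X}
    (h : ZAt (m + 1) σ f p) : ZAt m τ f p := ZAt.of_contDiffAt hσ h.1

lemma ZAt.zero_iff {σ : ℝ} (hσ : 0 < σ) {f : X → Y} {p : X} :
    ZAt 0 σ f p ↔ ContDiffAt ℝ 0 f p ∧ ZbAt σ f p := by
  unfold ZAt
  rw [iteratedFDeriv_zero_eq_comp]
  exact and_congr Iff.rfl (ZbAt.isometry_iff _)

lemma ZAt.succ_iff {m : ℕ} {σ : ℝ} {f : X → Y} {p : X} :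
    ZAt (m + 1) σ f p ↔ (∀ᶠ x in 𝓝 p, DifferentiableAt ℝ f x) ∧ ZAt m σ (fderiv ℝ f) p := by
  unfold ZAt
  rw [← and_assoc]
  have hz : ZbAt σ (iteratedFDeriv ℝ (m + 1) f) p ↔ ZbAt σ (iteratedFDeriv ℝ m (fderiv ℝ f)) p := by
    refine ZbAt.norm_iff (fun y => (continuousMultilinearCurryRightEquiv' ℝ m X Y).symm y) ?_ ?_ ?_
    · intro a b
      exact LinearIsometryEquiv.map_sub _ a b
    · intro a
      exact LinearIsometryEquiv.norm_map _ a
    · intro x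
      exact iteratedFDeriv_succ_eq_comp_right
  refine and_congr ?_ hz
  constructor
  · intro h
    refine ⟨?_, h.fderiv_right (by exact_mod_cast le_rfl)⟩
    have h1 : ContDiffAt ℝ 1 f p := h.of_le (by exact_mod_cast Nat.le_add_left 1 m)
    filter_upwards [h1.eventually (by simp)] with x hx
    exact hx.differentiableAt one_ne_zero
  · rintro ⟨h1, h2⟩
    exact_mod_cast contDiffAt_succ_iff_hasFDerivAt.2
      ⟨fderiv ℝ f, ⟨_, h1, fun x hx => DifferentiableAt.hasFDerivAt hx⟩, h2⟩

lemma ZbAt.add {σ : ℝ} {f g : X → Y} {p : X} (hf : ZbAt σ f p) (hg : ZbAt σ g p) :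
    ZbAt σ (fun x => f x + g x) p := by
  refine ⟨(IsBigO.add hf.1 hg.1).congr_left fun q => ?_,
      (IsBigO.add hf.2 hg.2).congr_left fun q => ?_⟩ <;> beta_reduce <;> abel

lemma ZAt.add {m : ℕ} {σ : ℝ} {f g : X → Y} {p : X} (hf : ZAt m σ f p) (hg : ZAt m σ g p) :
    ZAt m σ (fun x => f x + g x) p := by
  refine ⟨hf.1.add hg.1, ?_⟩
  refine (hf.2.add hg.2).congr ?_
  filter_upwards [hf.1.eventually (by simp), hg.1.eventually (by simp)] with x h1 h2
  exact (iteratedFDeriv_add_apply h1 h2).symm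

/-- Bilinear products, base case. -/
lemma ZbAt.bilin {σ : ℝ} (hσ : 0 < σ) (B : Y →L[ℝ] W →L[ℝ] V) {u : X → Y} {v : X → W} {p : X}
    (hu : ZbAt σ u p) (hv : ZbAt σ v p) : ZbAt σ (fun x => B (u x) (v x)) p := by
  have cu := hu.continuousAt hσ
  have cv := hv.continuousAt hσ
  have bu : (fun q : X × X => u q.2) =O[𝓝 (p, p)] fun _ => (1 : ℝ) :=
    (cu.tendsto.comp (tendsto_snd' p)).isBigO_one ℝ
  have bv : (fun q : X × X => v q.2) =O[𝓝 (p, p)] fun _ => (1 : ℝ) :=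
    (cv.tendsto.comp (tendsto_snd' p)).isBigO_one ℝ
  have bu1 : (fun q : X × X => u q.1) =O[𝓝 (p, p)] fun _ => (1 : ℝ) :=
    (cu.tendsto.comp (tendsto_fst' p)).isBigO_one ℝ
  have bB : ∀ {a : X × X → Y} {b : X × X → W} {r s : X × X → ℝ},
      a =O[𝓝 (p, p)] r → b =O[𝓝 (p, p)] s →
      (fun q => B (a q) (b q)) =O[𝓝 (p, p)] fun q => r q * s q := by
    intro a b r s ha hb
    refine IsBigO.trans ?_ (ha.norm_left.mul hb.norm_left)
    refine IsBigO.of_bound ‖B‖ (Eventually.of_forall fun q => ?_)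
    simpa [mul_assoc] using B.le_opNorm₂ (a q) (b q)
  constructor
  · have h1 := bB bu1 hv.1
    have h2 := bB hu.1 bv
    simp only [one_mul, mul_one] at h1 h2
    refine (h1.add h2).congr_left fun q => ?_
    simp only [map_sub, _root_.sub_apply]
    abel
  · have ht : Tendsto (fun q : X × X => (q.2, q.2 + (q.2 - q.1))) (𝓝 (p, p)) (𝓝 (p, p)) :=
      (tendsto_snd' p).prodMk_nhds (tendsto_third p)
    have hu2 := IsBigO.comp_tendsto hu.1 ht
    have hv2 := IsBigO.comp_tendsto hv.1 ht
    simp only [Function.comp_def, add_sub_cancel_left] at hu2 hv2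
    have e : ∀ q : X × X, ‖q.2 - q.1‖ ^ (σ / 2) * ‖q.2 - q.1‖ ^ (σ / 2) = ‖q.2 - q.1‖ ^ σ := by
      intro q
      rw [← Real.rpow_add_of_nonneg (norm_nonneg _) (half_pos hσ).le (half_pos hσ).le, add_halves]
    have h1 := bB bu hv.2
    have h2 := bB hu.2 bv
    have h3 := bB hu2 hv2
    have h4 := bB hu.1 hv.1
    simp only [one_mul, mul_one, e] at h1 h2 h3 h4
    refine (((h1.add h2).add h3).add h4).congr_left fun q => ?_
    simp only [map_sub, _root_.sub_apply]
    abel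

lemma ZAt.differentiableAt {m : ℕ} {σ : ℝ} {f : X → Y} {p : X}
    (hf : ZAt (m + 1) σ f p) : ∀ᶠ x in 𝓝 p, DifferentiableAt ℝ f x := (ZAt.succ_iff.1 hf).1

end ZygAux

section ZygAux2

lemma ZAt.bilin {X : Type} [NormedAddCommGroup X] [NormedSpace ℝ X] (m : ℕ) {σ : ℝ}
    (hσ : 0 < σ) (hσ1 : σ ≤ 1) :
    ∀ {Y W V : Type} [NormedAddCommGroup Y] [NormedSpace ℝ Y] [NormedAddCommGroup W]
      [NormedSpace ℝ W] [NormedAddCommGroup V] [NormedSpace ℝ V]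
      (B : Y →L[ℝ] W →L[ℝ] V) {u : X → Y} {v : X → W} {p : X}
      (_ : ZAt m σ u p) (_ : ZAt m σ v p), ZAt m σ (fun x => B (u x) (v x)) p := by
  induction m with
  | zero =>
    intro Y W V _ _ _ _ _ _ B u v p hu hv
    rw [ZAt.zero_iff hσ] at *
    exact ⟨B.isBoundedBilinearMap.contDiff.contDiffAt.comp p (hu.1.prodMk hv.1), hu.2.bilin hσ B hv.2⟩
  | succ m ih =>
    intro Y W V _ _ _ _ _ _ B u v p hu hv
    rw [ZAt.succ_iff]
    have h1 := ih (B.precompR X) (hu.pred hσ1) (ZAt.succ_iff.1 hv).2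
    have h2 := ih (B.precompL X) (ZAt.succ_iff.1 hu).2 (hv.pred hσ1)
    refine ⟨?_, (h1.add h2).congr ?_⟩
    · filter_upwards [hu.differentiableAt, hv.differentiableAt] with x hx hy
      exact (B.hasFDerivAt_of_bilinear hx.hasFDerivAt hy.hasFDerivAt).differentiableAt
    · filter_upwards [hu.differentiableAt, hv.differentiableAt] with x hx hy
      exact (B.hasFDerivAt_of_bilinear hx.hasFDerivAt hy.hasFDerivAt).fderiv.symm

end ZygAux2

section ZygAux3

variable {X Y W V : Type} [NormedAddCommGroup X] [NormedSpace ℝ X]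
  [NormedAddCommGroup Y] [NormedSpace ℝ Y] [NormedAddCommGroup W] [NormedSpace ℝ W]
  [NormedAddCommGroup V] [NormedSpace ℝ V]

/-- Second differences improve the Hölder exponent. -/
lemma SdAt.hol {θ s : ℝ} (hθ : 0 < θ) (hθs : θ < s) (hs : s ≤ 1) {f : X → Y} {p : X}
    (hc : ContinuousAt f p) (h : SdAt s f p) : HolAt θ f p := by
  obtain ⟨A, hA, hb⟩ := h.exists_nonneg
  rw [IsBigOWith, Metric.eventually_nhds_iff_ball] at hb
  obtain ⟨r₁, hr₁, hb⟩ := hb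
  have hc' : ∀ᶠ x in 𝓝 p, ‖f x - f p‖ ≤ 1 := by
    have := Metric.tendsto_nhds.1 hc 1 one_pos
    filter_upwards [this] with x hx
    rw [dist_eq_norm] at hx
    exact hx.le
  rw [Metric.eventually_nhds_iff_ball] at hc'
  obtain ⟨r₂, hr₂, hc'⟩ := hc'
  obtain ⟨r, hr, hr1, hrr₁, hrr₂⟩ : ∃ r > 0, r ≤ 1 ∧ r ≤ r₁ ∧ r ≤ r₂ :=
    ⟨min 1 (min r₁ r₂), by positivity, by simp, by simp, by simp⟩
  have h2θ : (0 : ℝ) < 2 - 2 ^ θ := by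
    have := Real.rpow_lt_rpow_of_exponent_lt one_lt_two (hθs.trans_le hs)
    rw [Real.rpow_one] at this
    linarith
  obtain ⟨K, hK0, hK1, hK2⟩ : ∃ K : ℝ, 0 ≤ K ∧ 2 ≤ K * (r / 4) ^ θ ∧ A ≤ K * (2 - 2 ^ θ) := by
    have h4 : 0 < (r / 4) ^ θ := by positivity
    refine ⟨max (2 / (r / 4) ^ θ) (A / (2 - 2 ^ θ)), ?_, ?_, ?_⟩
    · exact le_max_of_le_left (by positivity)
    · rw [← div_le_iff₀ h4]; exact le_max_left _ _
    · rw [← div_le_iff₀ h2θ]; exact le_max_right _ _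
  have main : ∀ x ∈ Metric.ball p (r / 2), ∀ k : ℕ, ∀ h : X, ‖h‖ < r / 2 → r / 4 ≤ 2 ^ k * ‖h‖ →
      ‖f (x + h) - f x‖ ≤ K * ‖h‖ ^ θ := by
    intro x hx
    rw [mem_ball_iff_norm] at hx
    have hball : ∀ h : X, ‖h‖ < r / 2 → ‖x + h - p‖ < r := by
      intro h hh
      calc ‖x + h - p‖ = ‖(x - p) + h‖ := by congr 1; abel
        _ ≤ ‖x - p‖ + ‖h‖ := norm_add_le _ _
        _ < r := by linarith
    have base : ∀ h : X, ‖h‖ < r / 2 → r / 4 ≤ ‖h‖ → ‖f (x + h) - f x‖ ≤ K * ‖h‖ ^ θ := by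
      intro h hh hh4
      have e1 := hc' (x + h) (by rw [mem_ball_iff_norm]; linarith [hball h hh])
      have e2 := hc' x (by rw [mem_ball_iff_norm]; linarith)
      calc ‖f (x + h) - f x‖ = ‖(f (x + h) - f p) - (f x - f p)‖ := by congr 1; abel
        _ ≤ ‖f (x + h) - f p‖ + ‖f x - f p‖ := norm_sub_le _ _
        _ ≤ 2 := by linarith
        _ ≤ K * (r / 4) ^ θ := hK1
        _ ≤ K * ‖h‖ ^ θ := by gcongr
    intro k
    induction k with
    | zero => intro h hh hh4; exact base h hh (by simpa using hh4)
    | succ k ih =>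
      intro h hh hk
      by_cases h4 : r / 4 ≤ ‖h‖
      · exact base h hh h4
      push Not at h4
      have n2 : ‖h + h‖ = 2 * ‖h‖ := by
        rw [← two_smul ℝ h, norm_smul]; simp
      have i1 := ih (h + h) (by rw [n2]; linarith) (by rw [n2]; rw [pow_succ] at hk; linarith)
      have i2 := hb (x, x + h) (by
        rw [mem_ball_iff_norm, Prod.mk_sub_mk, Prod.norm_mk, max_lt_iff]
        exact ⟨by linarith, by linarith [hball h hh]⟩)
      simp only [add_sub_cancel_left] at i2
      rw [Real.norm_of_nonneg (by positivity : 0 ≤ ‖h‖ ^ s), add_assoc] at i2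
      have i3 : ‖h‖ ^ s ≤ ‖h‖ ^ θ := by
        rcases (norm_nonneg h).eq_or_lt with h0 | h0
        · rw [← h0, Real.zero_rpow (hθ.trans hθs).ne', Real.zero_rpow hθ.ne']
        · exact Real.rpow_le_rpow_of_exponent_ge h0 (by linarith) hθs.le
      rw [n2, Real.mul_rpow (by norm_num) (norm_nonneg _)] at i1
      have i4 : 2 * ‖f (x + h) - f x‖ ≤ ‖f (x + (h + h)) - f x‖
          + ‖f (x + (h + h)) - f (x + h) - (f (x + h) - f x)‖ := by
        calc 2 * ‖f (x + h) - f x‖ = ‖(2 : ℝ) • (f (x + h) - f x)‖ := by rw [norm_smul]; simp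
          _ = ‖(f (x + (h + h)) - f x) - (f (x + (h + h)) - f (x + h) - (f (x + h) - f x))‖ := by
            rw [two_smul]; congr 1; abel
          _ ≤ _ := norm_sub_le _ _
      have i5 : A * ‖h‖ ^ s ≤ K * (2 - 2 ^ θ) * ‖h‖ ^ θ :=
        mul_le_mul hK2 i3 (by positivity) (by positivity)
      nlinarith
  refine IsBigO.of_bound K ?_
  have hN : Metric.ball (p, p) (r / 4) ∈ 𝓝 (p, p) := Metric.ball_mem_nhds _ (by positivity)
  filter_upwards [hN] with q hq
  rw [mem_ball_iff_norm, Prod.norm_def, max_lt_iff] at hq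
  simp only [Prod.fst_sub, Prod.snd_sub] at hq
  rw [Real.norm_of_nonneg (by positivity)]
  by_cases h0 : q.2 - q.1 = 0
  · have : q.2 = q.1 := sub_eq_zero.1 h0
    rw [this, sub_self, norm_zero]; positivity
  have hp := norm_pos_iff.2 h0
  obtain ⟨k, hk⟩ := pow_unbounded_of_one_lt (r / 4 / ‖q.2 - q.1‖) (one_lt_two (α := ℝ))
  rw [div_lt_iff₀ hp] at hk
  have := main q.1 (by rw [mem_ball_iff_norm]; linarith) k (q.2 - q.1) (by
    calc ‖q.2 - q.1‖ = ‖(q.2 - p) - (q.1 - p)‖ := by congr 1; abel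
      _ ≤ ‖q.2 - p‖ + ‖q.1 - p‖ := norm_sub_le _ _
      _ < r / 2 := by linarith) hk.le
  rwa [add_sub_cancel] at this

/-- Second differences of `C^{1,ε}` maps. -/
lemma SdAt.of_fderiv {ε : ℝ} (hε : 0 ≤ ε) {f : X → Y} {p : X}
    (hd : ∀ᶠ x in 𝓝 p, DifferentiableAt ℝ f x) (h : HolAt ε (fderiv ℝ f) p) :
    SdAt (1 + ε) f p := by
  obtain ⟨A, hA, hb⟩ := h.exists_nonneg
  rw [IsBigOWith, Metric.eventually_nhds_iff_ball] at hb
  obtain ⟨r₁, hr₁, hb⟩ := hb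
  rw [Metric.eventually_nhds_iff_ball] at hd
  obtain ⟨r₂, hr₂, hd⟩ := hd
  obtain ⟨r, hr, hrr₁, hrr₂⟩ : ∃ r > 0, r ≤ r₁ ∧ r ≤ r₂ :=
    ⟨min r₁ r₂, by positivity, by simp, by simp⟩
  refine IsBigO.of_bound (2 * A) ?_
  have hN : Metric.ball p r ∈ 𝓝 p := Metric.ball_mem_nhds _ (by positivity)
  filter_upwards [(tendsto_fst' p).eventually hN, (tendsto_snd' p).eventually hN,
    (tendsto_third p).eventually hN] with q h1 h2 h3
  obtain ⟨a, b⟩ := q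
  simp only at h1 h2 h3 ⊢
  set s := Metric.ball p r ∩ Metric.closedBall b ‖b - a‖ with hs
  have cs : Convex ℝ s := (convex_ball _ _).inter (convex_closedBall _ _)
  have bs : b ∈ s := ⟨h2, by simp⟩
  have as : a ∈ s := ⟨h1, by rw [mem_closedBall_iff_norm, norm_sub_rev]⟩
  have cs' : b + (b - a) ∈ s := ⟨h3, by rw [mem_closedBall_iff_norm, add_sub_cancel_left]⟩
  have hds : ∀ x ∈ s, DifferentiableAt ℝ f x := fun x hx => hd x (Metric.ball_subset_ball hrr₂ hx.1)
  have bound : ∀ x ∈ s, ‖fderiv ℝ f x - fderiv ℝ f b‖ ≤ A * ‖b - a‖ ^ ε := by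
    intro x hx
    have := hb (b, x) (by
      have q1 := mem_ball_iff_norm.1 h2
      have q2 := mem_ball_iff_norm.1 hx.1
      rw [mem_ball_iff_norm, Prod.mk_sub_mk, Prod.norm_mk, max_lt_iff]
      exact ⟨by linarith, by linarith⟩)
    simp only at this
    rw [Real.norm_of_nonneg (by positivity)] at this
    refine this.trans ?_
    have := mem_closedBall_iff_norm.1 hx.2
    gcongr
  have t1 := Convex.norm_image_sub_le_of_norm_fderiv_le' hds bound cs bs cs'
  have t2 := Convex.norm_image_sub_le_of_norm_fderiv_le' hds bound cs bs as
  rw [add_sub_cancel_left] at t1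
  rw [norm_sub_rev a b] at t2
  rw [Real.norm_of_nonneg (by positivity), Real.rpow_add_of_nonneg (norm_nonneg _) zero_le_one hε,
    Real.rpow_one]
  calc ‖f (b + (b - a)) - f b - (f b - f a)‖
      = ‖(f (b + (b - a)) - f b - fderiv ℝ f b (b - a)) + (f a - f b - fderiv ℝ f b (a - b))‖ := by
        congr 1; simp only [map_sub]; abel
    _ ≤ _ := norm_add_le _ _
    _ ≤ A * ‖b - a‖ ^ ε * ‖b - a‖ + A * ‖b - a‖ ^ ε * ‖b - a‖ := add_le_add t1 t2
    _ = _ := by ring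

lemma HolAt.comp {α θ : ℝ} (hα : 0 < α) (hθ : 0 < θ) {g : Y → W} {f : X → Y} {p : X}
    (hg : HolAt α g (f p)) (hf : HolAt θ f p) : HolAt (θ * α) (g ∘ f) p := by
  have c := (hf.continuousAt hθ).tendsto
  have ht : Tendsto (fun q : X × X => (f q.1, f q.2)) (𝓝 (p, p)) (𝓝 (f p, f p)) :=
    (c.comp (tendsto_fst' p)).prodMk_nhds (c.comp (tendsto_snd' p))
  have h1 := IsBigO.comp_tendsto hg ht
  have h2 := IsBigO.rpow hα.le (Eventually.of_forall fun q => by simp only [Pi.zero_apply]; positivity)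
    (IsBigO.norm_left hf)
  simp only [← Real.rpow_mul (norm_nonneg _)] at h2
  exact h1.trans h2

lemma SdAt.comp {α β θ γ δ : ℝ} (hα : 0 < α) (hβ : 0 < β) (hθ : 0 < θ) (hγ : 0 < γ)
    (h1 : δ ≤ γ * α) (h2 : δ ≤ θ * β) {g : Y → W} {f : X → Y} {p : X}
    (hg : HolAt α g (f p)) (hg' : SdAt β g (f p)) (hf : HolAt θ f p) (hf' : SdAt γ f p) :
    SdAt δ (g ∘ f) p := by
  have c := (hf.continuousAt hθ).tendsto
  have ht : Tendsto (fun q : X × X => (f q.1, f q.2)) (𝓝 (p, p)) (𝓝 (f p, f p)) :=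
    (c.comp (tendsto_fst' p)).prodMk_nhds (c.comp (tendsto_snd' p))
  have ht2 : Tendsto (fun q : X × X => (f q.2 + (f q.2 - f q.1), f (q.2 + (q.2 - q.1))))
      (𝓝 (p, p)) (𝓝 (f p, f p)) :=
    ((tendsto_third (f p)).comp ht).prodMk_nhds (c.comp (tendsto_third p))
  have a1 := IsBigO.comp_tendsto hg' ht
  have a2 := IsBigO.rpow hβ.le
    (Eventually.of_forall fun q => by simp only [Pi.zero_apply]; positivity) (IsBigO.norm_left hf)
  have b1 := IsBigO.comp_tendsto hg ht2
  have b2 := IsBigO.rpow hα.le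
    (Eventually.of_forall fun q => by simp only [Pi.zero_apply]; positivity) (IsBigO.norm_left hf')
  simp only [← Real.rpow_mul (norm_nonneg _)] at a2 b2
  have a3 := (a1.trans a2).trans (rpow_mono_diff p h2 (by positivity))
  have b3 : (fun q : X × X => g (f (q.2 + (q.2 - q.1))) - g (f q.2 + (f q.2 - f q.1)))
      =O[𝓝 (p, p)] fun q => ‖q.2 - q.1‖ ^ δ := by
    refine (b1.trans ?_).trans (rpow_mono_diff p h1 (by positivity))
    refine b2.congr_left fun q => ?_
    simp only [Function.comp_def]
    congr 2
    abel
  refine (b3.add a3).congr_left fun q => ?_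
  simp only [Function.comp_def]
  abel

lemma ZAt.one_sd {σ : ℝ} (hσ : 0 < σ) {f : X → Y} {p : X} (h : ZAt 1 σ f p) :
    HolAt 1 f p ∧ SdAt (1 + σ / 2) f p := by
  obtain ⟨h1, h2⟩ := ZAt.succ_iff.1 h
  exact ⟨HolAt.of_contDiffAt (by simpa using h.1),
    SdAt.of_fderiv (half_pos hσ).le h1 ((ZAt.zero_iff hσ).1 h2).2.1⟩

lemma exponent_exists {σ τ : ℝ} (hσ : 0 < σ) (hτ : 0 < τ) :
    ∃ θ, 0 < θ ∧ θ < σ ∧ σ ≤ θ * (1 + τ / 2) := by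
  refine ⟨σ / (1 + τ / 2), by positivity, div_lt_self hσ (by linarith), ?_⟩
  rw [div_mul_cancel₀]
  positivity

/-- Composition, base case with regular outer map. -/
lemma ZAt.comp_zero_one {σ τ : ℝ} (hσ : 0 < σ) (hσ1 : σ ≤ 1) (hτ : 0 < τ) {g : Y → W} {f : X → Y}
    {p : X} (hg : ZAt 1 τ g (f p)) (hf : ZAt 0 σ f p) : ZAt 0 σ (g ∘ f) p := by
  obtain ⟨g1, g2⟩ := hg.one_sd hτ
  obtain ⟨f0, f1, f2⟩ := (ZAt.zero_iff hσ).1 hf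
  obtain ⟨θ, hθ, hθσ, hθ2⟩ := exponent_exists hσ hτ
  rw [ZAt.zero_iff hσ]
  refine ⟨(hg.1.of_le (by simp)).comp p f0, ?_, ?_⟩
  · simpa using HolAt.comp one_pos (half_pos hσ) g1 f1
  · exact SdAt.comp one_pos (by positivity) hθ hσ (by simp) hθ2 g1 g2
      (f2.hol hθ hθσ hσ1 (f1.continuousAt (half_pos hσ))) f2

/-- Composition, base case with regular inner map. -/
lemma ZAt.comp_one_zero {σ : ℝ} (hσ : 0 < σ) (hσ1 : σ ≤ 1) {g : Y → W} {f : X → Y}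
    {p : X} (hg : ZAt 0 σ g (f p)) (hf : ZAt 1 σ f p) : ZAt 0 σ (g ∘ f) p := by
  obtain ⟨f1, f2⟩ := hf.one_sd hσ
  obtain ⟨g0, g1, g2⟩ := (ZAt.zero_iff hσ).1 hg
  obtain ⟨θ, hθ, hθσ, hθ2⟩ := exponent_exists hσ hσ
  rw [ZAt.zero_iff hσ]
  refine ⟨g0.comp p (hf.1.of_le (by simp)), ?_, ?_⟩
  · simpa using HolAt.comp (half_pos hσ) one_pos g1 f1
  · exact SdAt.comp hθ hσ one_pos (by positivity) (by rwa [mul_comm]) (by simp)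
      (g2.hol hθ hθσ hσ1 (g1.continuousAt (half_pos hσ))) g2 f1 f2

lemma ZAt.comp_step {m : ℕ} {σ : ℝ} (hσ : 0 < σ) (hσ1 : σ ≤ 1) {g : Y → W} {f : X → Y} {p : X}
    (hg : ∀ᶠ y in 𝓝 (f p), DifferentiableAt ℝ g y) (hf : ZAt (m + 1) σ f p)
    (h : ZAt m σ (fderiv ℝ g ∘ f) p) : ZAt (m + 1) σ (g ∘ f) p := by
  have c : ContinuousAt f p := hf.1.continuousAt
  obtain ⟨f1, f2⟩ := ZAt.succ_iff.1 hf
  rw [ZAt.succ_iff]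
  refine ⟨?_, (ZAt.bilin m hσ hσ1 (ContinuousLinearMap.compL ℝ X Y W) h f2).congr ?_⟩
  · filter_upwards [f1, c.eventually hg] with x h1 h2
    exact h2.comp x h1
  · filter_upwards [f1, c.eventually hg] with x h1 h2
    rw [fderiv_comp x h2 h1]
    rfl

end ZygAux3

section ZygAux4

lemma ZAt.comp_succ {X Y : Type} [NormedAddCommGroup X] [NormedSpace ℝ X] [NormedAddCommGroup Y]
    [NormedSpace ℝ Y] (m : ℕ) {σ : ℝ} (hσ : 0 < σ) (hσ1 : σ ≤ 1) :
    ∀ {W : Type} [NormedAddCommGroup W] [NormedSpace ℝ W] {g : Y → W} {f : X → Y} {p : X}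
      (_ : ZAt m σ g (f p)) (_ : ZAt (m + 1) σ f p), ZAt m σ (g ∘ f) p := by
  induction m with
  | zero =>
    intro W _ _ g f p hg hf
    exact ZAt.comp_one_zero hσ hσ1 hg hf
  | succ m ih =>
    intro W _ _ g f p hg hf
    obtain ⟨g1, g2⟩ := ZAt.succ_iff.1 hg
    exact ZAt.comp_step hσ hσ1 g1 (hf.pred hσ1) (ih g2 (hf.pred hσ1))

lemma ZAt.comp {X Y W : Type} [NormedAddCommGroup X] [NormedSpace ℝ X] [NormedAddCommGroup Y]
    [NormedSpace ℝ Y] [NormedAddCommGroup W] [NormedSpace ℝ W]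
    (m : ℕ) {σ : ℝ} (hσ : 0 < σ) (hσ1 : σ ≤ 1) {g : Y → W} {f : X → Y} {p : X}
    (hg : ZAt (m + 1) σ g (f p)) (hf : ZAt (m + 1) σ f p) : ZAt (m + 1) σ (g ∘ f) p := by
  obtain ⟨g1, g2⟩ := ZAt.succ_iff.1 hg
  exact ZAt.comp_step hσ hσ1 g1 hf (ZAt.comp_succ m hσ hσ1 g2 hf)

end ZygAux4

section ZygAux5

variable {X Y : Type} [NormedAddCommGroup X] [NormedSpace ℝ X]
  [NormedAddCommGroup Y] [NormedSpace ℝ Y]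

lemma zygBase_congr {σ : ℝ} {Ω : Set X} {F G : X → Y} (h : EqOn F G Ω) :
    zygBase σ Ω F = zygBase σ Ω G := by
  unfold zygBase holderNorm secondDiff
  congr 1
  · congr 1
    · refine iSup_congr fun x => iSup_congr fun hx => ?_
      rw [h hx]
    · refine iSup_congr fun x => iSup_congr fun hx => iSup_congr fun y =>
        iSup_congr fun hy => ?_
      rw [h hx, h hy]
  · refine iSup_congr fun x => iSup_congr fun k => iSup_congr fun _ => iSup_congr fun h1 =>
      iSup_congr fun h2 => iSup_congr fun h3 => ?_
    rw [h h1, h h2, h h3]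

lemma two_nsmul_diff (a b c : Y) : a - 2 • b + c = a - b - (b - c) := by
  rw [two_nsmul]; abel

lemma ZbAt.of_zygBase {σ ε : ℝ} (hσ : 0 < σ) (hε : 0 < ε) {F : X → Y} {p : X}
    (h : zygBase σ (Metric.ball p ε) F ≠ ⊤) : ZbAt σ F p := by
  unfold zygBase holderNorm at h
  rw [ENNReal.add_ne_top, ENNReal.add_ne_top] at h
  obtain ⟨⟨-, h1⟩, h2⟩ := h
  have hN : Metric.ball p ε ∈ 𝓝 p := Metric.ball_mem_nhds _ hε
  constructor
  · refine IsBigO.of_bound (ENNReal.toReal (⨆ (x ∈ Metric.ball p ε) (y ∈ Metric.ball p ε)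
      (_ : x ≠ y), ENNReal.ofReal (‖F x - F y‖ / ‖x - y‖ ^ (σ / 2)))) ?_
    filter_upwards [(tendsto_fst' p).eventually hN, (tendsto_snd' p).eventually hN] with q q1 q2
    by_cases hq : q.2 = q.1
    · rw [hq, sub_self, norm_zero]; positivity
    have := le_iSup₂_of_le (f := fun x (_ : x ∈ Metric.ball p ε) =>
      ⨆ (y ∈ Metric.ball p ε) (_ : x ≠ y), ENNReal.ofReal (‖F x - F y‖ / ‖x - y‖ ^ (σ / 2)))
      q.2 q2 (le_iSup₂_of_le (f := fun y (_ : y ∈ Metric.ball p ε) =>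
      ⨆ (_ : q.2 ≠ y), ENNReal.ofReal (‖F q.2 - F y‖ / ‖q.2 - y‖ ^ (σ / 2))) q.1 q1
        (le_iSup_of_le (f := fun _ : q.2 ≠ q.1 => _) hq le_rfl))
    rw [ENNReal.ofReal_le_iff_le_toReal h1] at this
    have hpos : 0 < ‖q.2 - q.1‖ := norm_pos_iff.2 (sub_ne_zero.2 hq)
    rw [div_le_iff₀ (by positivity)] at this
    rwa [Real.norm_of_nonneg (by positivity)]
  · refine IsBigO.of_bound (ENNReal.toReal (secondDiff σ (Metric.ball p ε) F)) ?_
    filter_upwards [(tendsto_fst' p).eventually hN, (tendsto_snd' p).eventually hN,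
      (tendsto_third p).eventually hN] with q q1 q2 q3
    by_cases hq : q.2 = q.1
    · rw [hq]; simp; positivity
    have hne : q.2 - q.1 ≠ 0 := sub_ne_zero.2 hq
    have e2 : q.1 + (q.2 - q.1) = q.2 := by abel
    have e3 : q.1 + 2 • (q.2 - q.1) = q.2 + (q.2 - q.1) := by rw [two_nsmul]; abel
    have : ENNReal.ofReal (‖F (q.1 + 2 • (q.2 - q.1)) - 2 • F (q.1 + (q.2 - q.1)) + F q.1‖
        / ‖q.2 - q.1‖ ^ σ) ≤ secondDiff σ (Metric.ball p ε) F := by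
      unfold secondDiff
      refine le_iSup_of_le q.1 (le_iSup_of_le (q.2 - q.1) (le_iSup_of_le hne (le_iSup_of_le q1
        (le_iSup_of_le ?_ (le_iSup_of_le ?_ le_rfl)))))
      · rw [e2]; exact q2
      · rw [e3]; exact q3
    rw [ENNReal.ofReal_le_iff_le_toReal h2, e2, e3, two_nsmul_diff] at this
    have hpos : 0 < ‖q.2 - q.1‖ := norm_pos_iff.2 hne
    rw [div_le_iff₀ (by positivity)] at this
    rwa [Real.norm_of_nonneg (by positivity)]

lemma ZbAt.eventually_zygBase {σ : ℝ} (hσ : 0 < σ) {F : X → Y} {p : X}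
    (h : ZbAt σ F p) : ∀ᶠ r in 𝓝[>] (0 : ℝ), zygBase σ (Metric.ball p r) F ≠ ⊤ := by
  obtain ⟨A, hA, ha⟩ := IsBigO.exists_nonneg h.1
  obtain ⟨B, hB, hb⟩ := IsBigO.exists_nonneg h.2
  have hc : ∀ᶠ x in 𝓝 p, ‖F x‖ ≤ ‖F p‖ + 1 := by
    have := (h.continuousAt hσ).norm.eventually (gt_mem_nhds (lt_add_one ‖F p‖))
    filter_upwards [this] with x hx using hx.le
  rw [IsBigOWith, Metric.eventually_nhds_iff_ball] at ha hb
  rw [Metric.eventually_nhds_iff_ball] at hc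
  obtain ⟨r₁, hr₁, ha⟩ := ha
  obtain ⟨r₂, hr₂, hb⟩ := hb
  obtain ⟨r₃, hr₃, hc⟩ := hc
  have hm : Ioo (0 : ℝ) (min r₁ (min r₂ r₃)) ∈ 𝓝[>] (0 : ℝ) := Ioo_mem_nhdsGT (by positivity)
  filter_upwards [hm] with r hr
  have hr1 : r ≤ r₁ := hr.2.le.trans (by simp)
  have hr2 : r ≤ r₂ := hr.2.le.trans (by simp)
  have hr3 : r ≤ r₃ := hr.2.le.trans (by simp)
  have hmem : ∀ {x y : X} {R : ℝ}, x ∈ Metric.ball p r → y ∈ Metric.ball p r → r ≤ R →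
      (x, y) ∈ Metric.ball (p, p) R := by
    intro x y R hx hy hR
    rw [← ball_prod_same]
    exact ⟨Metric.ball_subset_ball hR hx, Metric.ball_subset_ball hR hy⟩
  unfold zygBase holderNorm secondDiff
  rw [ENNReal.add_ne_top, ENNReal.add_ne_top]
  refine ⟨⟨?_, ?_⟩, ?_⟩
  · refine ne_top_of_le_ne_top (b := ENNReal.ofReal (‖F p‖ + 1)) ENNReal.ofReal_ne_top ?_
    exact iSup₂_le fun x hx => ENNReal.ofReal_le_ofReal (hc x (Metric.ball_subset_ball hr3 hx))
  · refine ne_top_of_le_ne_top (b := ENNReal.ofReal A) ENNReal.ofReal_ne_top ?_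
    refine iSup₂_le fun x hx => iSup₂_le fun y hy => iSup_le fun hxy => ?_
    refine ENNReal.ofReal_le_ofReal ?_
    have hpos : 0 < ‖x - y‖ := norm_pos_iff.2 (sub_ne_zero.2 hxy)
    rw [div_le_iff₀ (by positivity)]
    have := ha (y, x) (hmem hy hx hr1)
    rwa [Real.norm_of_nonneg (by positivity)] at this
  · refine ne_top_of_le_ne_top (b := ENNReal.ofReal B) ENNReal.ofReal_ne_top ?_
    refine iSup_le fun x => iSup_le fun k => iSup_le fun hk => iSup_le fun h1 => iSup_le fun h2 =>
      iSup_le fun h3 => ?_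
    refine ENNReal.ofReal_le_ofReal ?_
    have hpos : 0 < ‖k‖ := norm_pos_iff.2 hk
    rw [div_le_iff₀ (by positivity), two_nsmul_diff]
    have := hb (x, x + k) (hmem h1 h2 hr2)
    simp only [add_sub_cancel_left] at this
    rw [Real.norm_of_nonneg (by positivity)] at this
    rwa [two_nsmul, ← add_assoc]

lemma ceil_frac {s : ℝ} (hs : 0 < s) :
    0 < s - (⌈s⌉₊ - 1 : ℕ) ∧ s - (⌈s⌉₊ - 1 : ℕ) ≤ 1 ∧ ⌈s⌉₊ - 1 + 1 = ⌈s⌉₊ := by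
  have h1 : 1 ≤ ⌈s⌉₊ := Nat.one_le_iff_ne_zero.2 (Nat.ceil_pos.2 hs).ne'
  have h2 := Nat.ceil_lt_add_one hs.le
  have h3 := Nat.le_ceil s
  rw [Nat.cast_sub h1]
  push_cast
  exact ⟨by linarith, by linarith, by omega⟩

lemma MemZyg.zAt {s ε : ℝ} (hs : 0 < s) (hε : 0 < ε) {f : X → Y} {p : X}
    (h : MemZyg s (Metric.ball p ε) f) : ZAt (⌈s⌉₊ - 1) (s - (⌈s⌉₊ - 1 : ℕ)) f p := by
  obtain ⟨c1, c2, c3⟩ := ceil_frac hs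
  refine ⟨h.1.contDiffAt (Metric.ball_mem_nhds _ hε), ?_⟩
  have h2 := h.2
  unfold zygNorm at h2
  rw [ENNReal.sum_ne_top] at h2
  have h3 := h2 (⌈s⌉₊ - 1) (Finset.mem_range.2 (by omega))
  rw [zygBase_congr (iteratedFDerivWithin_of_isOpen _ Metric.isOpen_ball)] at h3
  exact ZbAt.of_zygBase c1 hε h3

lemma ZAt.locZyg {s : ℝ} (hs : 0 < s) {U : Set X} (hU : IsOpen U) {f : X → Y}
    (h : ∀ p ∈ U, ZAt (⌈s⌉₊ - 1) (s - (⌈s⌉₊ - 1 : ℕ)) f p) : LocZyg s U f := by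
  intro p hp
  obtain ⟨c1, c2, c3⟩ := ceil_frac hs
  have hz := h p hp
  have h1 : ∀ᶠ r in 𝓝[>] (0 : ℝ), Metric.ball p r ⊆ U :=
    nhdsWithin_le_nhds (eventually_ball_subset (hU.mem_nhds hp))
  have h2 : ∀ᶠ r in 𝓝[>] (0 : ℝ), ContDiffOn ℝ (⌈s⌉₊ - 1 : ℕ) f (Metric.ball p r) := by
    have e : ∀ᶠ x in 𝓝 p, ContDiffAt ℝ (⌈s⌉₊ - 1 : ℕ) f x := hz.1.eventually (by simp)
    filter_upwards [nhdsWithin_le_nhds (eventually_ball_subset e)] with r hr x hx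
    have hx' : ContDiffAt ℝ (⌈s⌉₊ - 1 : ℕ) f x := hr hx
    exact hx'.contDiffWithinAt
  have h3 : ∀ᶠ r in 𝓝[>] (0 : ℝ), ∀ i ∈ Finset.range ⌈s⌉₊,
      zygBase (s - (⌈s⌉₊ - 1 : ℕ)) (Metric.ball p r) (iteratedFDeriv ℝ i f) ≠ ⊤ := by
    rw [Filter.eventually_all_finset]
    intro i hi
    refine ZbAt.eventually_zygBase c1 ?_
    rcases Nat.lt_or_ge i (⌈s⌉₊ - 1) with hlt | hge
    · exact (ZAt.of_contDiffAt c2 (hz.1.of_le (by exact_mod_cast hlt))).2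
    · have : i = ⌈s⌉₊ - 1 := by have := Finset.mem_range.1 hi; omega
      rw [this]
      exact hz.2
  obtain ⟨r, r1, r2, r3, r4⟩ := (h1.and (h2.and (h3.and self_mem_nhdsWithin))).exists
  refine ⟨r, r4, r1, r2, ?_⟩
  unfold zygNorm
  rw [ENNReal.sum_ne_top]
  intro i hi
  rw [zygBase_congr (iteratedFDerivWithin_of_isOpen _ Metric.isOpen_ball)]
  exact r3 i hi

lemma ZAt.embed {m n : ℕ} {σ τ : ℝ} (hσ : σ ≤ 1) (hτ : 0 < τ) (h : m + σ ≤ n + τ) (hmn : m ≤ n)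
    {f : X → Y} {p : X} (hf : ZAt n τ f p) : ZAt m σ f p := by
  rcases hmn.lt_or_eq with hlt | rfl
  · exact ZAt.of_contDiffAt hσ (hf.1.of_le (by exact_mod_cast hlt))
  · exact ⟨hf.1, hf.2.mono (by linarith) hτ⟩

end ZygAux5

/-- Composition of locally Zygmund maps. If `0 < s₁ ≤ s₂`, `s₂ > 1`,
`f₁ : U₁ → U₂` is locally `𝒞^{s₁}` and `f₂ : U₂ → U₃` is locally `𝒞^{s₂}`, then
`f₂ ∘ f₁ : U₁ → U₃` is locally `𝒞^{s₁}`. -/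
theorem locZyg_comp (n₁ n₂ n₃ : ℕ) (s₁ s₂ : ℝ) (hs₁ : 0 < s₁) (hs : s₁ ≤ s₂) (hs₂ : 1 < s₂)
    (U₁ : Set (EuclideanSpace ℝ (Fin n₁))) (U₂ : Set (EuclideanSpace ℝ (Fin n₂)))
    (U₃ : Set (EuclideanSpace ℝ (Fin n₃)))
    (hU₁ : IsOpen U₁) (hU₂ : IsOpen U₂) (hU₃ : IsOpen U₃)
    (f₁ : EuclideanSpace ℝ (Fin n₁) → EuclideanSpace ℝ (Fin n₂))
    (f₂ : EuclideanSpace ℝ (Fin n₂) → EuclideanSpace ℝ (Fin n₃))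
    (hmaps₁ : Set.MapsTo f₁ U₁ U₂) (hmaps₂ : Set.MapsTo f₂ U₂ U₃)
    (hf₁ : LocZyg s₁ U₁ f₁) (hf₂ : LocZyg s₂ U₂ f₂) :
    LocZyg s₁ U₁ (f₂ ∘ f₁) := by
  refine ZAt.locZyg hs₁ hU₁ fun p hp => ?_
  have hs2 : 0 < s₂ := hs₁.trans_le hs
  obtain ⟨ε₁, e1, -, k1⟩ := hf₁ p hp
  obtain ⟨ε₂, e2, -, k2⟩ := hf₂ (f₁ p) (hmaps₁ hp)
  have z1 := k1.zAt hs₁ e1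
  have z2 := k2.zAt hs2 e2
  obtain ⟨c1, c2, c3⟩ := ceil_frac hs₁
  obtain ⟨d1, d2, d3⟩ := ceil_frac hs2
  have hn : 2 ≤ ⌈s₂⌉₊ := Nat.lt_ceil.2 (by exact_mod_cast hs₂)
  have hmn : ⌈s₁⌉₊ ≤ ⌈s₂⌉₊ := Nat.ceil_mono hs
  have hmn' : ⌈s₁⌉₊ - 1 ≤ ⌈s₂⌉₊ - 1 := by omega
  rcases Nat.eq_zero_or_pos (⌈s₁⌉₊ - 1) with h0 | h0
  · have z2' : ZAt 1 (min 1 (s₂ - (⌈s₂⌉₊ - 1 : ℕ))) f₂ (f₁ p) := by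
      refine z2.embed (min_le_left _ _) d1 ?_ (by omega)
      have : (1 : ℝ) ≤ (⌈s₂⌉₊ - 1 : ℕ) := by exact_mod_cast (by omega : 1 ≤ ⌈s₂⌉₊ - 1)
      push_cast
      linarith [min_le_right 1 (s₂ - (⌈s₂⌉₊ - 1 : ℕ))]
    generalize s₁ - (⌈s₁⌉₊ - 1 : ℕ) = σ at *
    rw [h0] at z1 ⊢
    exact ZAt.comp_zero_one c1 c2 (lt_min one_pos d1) z2' z1
  · have z2' : ZAt (⌈s₁⌉₊ - 1) (s₁ - (⌈s₁⌉₊ - 1 : ℕ)) f₂ (f₁ p) :=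
      z2.embed c2 d1 (by linarith) hmn'
    generalize s₁ - (⌈s₁⌉₊ - 1 : ℕ) = σ at *
    obtain ⟨m, hm⟩ := Nat.exists_eq_add_of_le' h0
    rw [hm] at z1 z2' ⊢
    exact ZAt.comp m c1 c2 z2' z1
end
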